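/- Let l > 0 and λ₊, λ₋ ≥ 0. There exists C > 0 depending only on l, λ₊, λ₋ such that every minimizer u of J(C_1, λ₊, λ₋) on the cone of length l with ∫_{C_1} |Du|² ≤ 1 satisfies, for every r ∈ (0, 1/2), the gradient bound |Du| ≤ C/r almost everywhere on the annulus C_{1/2} ∖ C_r. -/

import Mathlib

open MeasureTheory Set

noncomputable section

/-- The cone distance on the cone of length `l`, in polar coordinates:
`d((r,θ),(s,φ)) = sqrt(r² + s² − 2 r s cos(min(δ, π)))` with
`δ = min_{k ∈ ℤ} |θ − φ + k l|`. -/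
def coneDist (l : ℝ) (p q : ℝ × ℝ) : ℝ :=
  Real.sqrt (p.1 ^ 2 + q.1 ^ 2 -
    2 * p.1 * q.1 * Real.cos (min (⨅ k : ℤ, |p.2 - q.2 + (k : ℝ) * l|) Real.pi))

/-- A Lipschitz function on the cone ball `C_R` of the cone of length `l`, given in
polar coordinates: `l`-periodic in `θ` and Lipschitz for the cone distance (this forces
a well-defined vertex value `u 0 _` and continuity at the vertex). -/
structure ConeLip (l R : ℝ) (u : ℝ → ℝ → ℝ) : Prop where
  periodic : ∀ r θ : ℝ, u r (θ + l) = u r θ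
  lipschitz : ∃ K : ℝ, ∀ p q : ℝ × ℝ, p.1 ∈ Set.Icc 0 R → q.1 ∈ Set.Icc 0 R →
    |u p.1 p.2 - u q.1 q.2| ≤ K * coneDist l p q

/-- The squared cone gradient `|Du|² = (∂_r u)² + (∂_θ u)²/r²` at a polar point,
computed from Lean's a.e.-defined derivatives. -/
def gradSq (u : ℝ → ℝ → ℝ) (p : ℝ × ℝ) : ℝ :=
  (deriv (fun s => u s p.2) p.1) ^ 2 + (deriv (fun φ => u p.1 φ) p.2) ^ 2 / p.1 ^ 2

/-- The two-phase functional
`J(u, C_R) = ∫_{C_R} |Du|² + λ₊ area({u > 0} ∩ C_R) + λ₋ area({u < 0} ∩ C_R)`,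
computed in polar coordinates with area measure `r dr dθ`, `θ` ranging over `(0, l)`. -/
def Jfun (l lp lm : ℝ) (u : ℝ → ℝ → ℝ) (R : ℝ) : ℝ :=
  ∫ p in Set.Ioo (0:ℝ) R ×ˢ Set.Ioo (0:ℝ) l,
    (gradSq u p + (if 0 < u p.1 p.2 then lp else 0)
      + (if u p.1 p.2 < 0 then lm else 0)) * p.1

/-- The Dirichlet energy `∫_{C_R} |Du|²` with respect to the area measure `r dr dθ`. -/
def Dir (l : ℝ) (u : ℝ → ℝ → ℝ) (R : ℝ) : ℝ :=
  ∫ p in Set.Ioo (0:ℝ) R ×ˢ Set.Ioo (0:ℝ) l, gradSq u p * p.1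

/-- `u` is a minimizer of `J(C_R, λ₊, λ₋)` on the cone of length `l`: a cone Lipschitz
function beating every cone Lipschitz competitor with the same boundary values on
`{r = R}`. -/
def IsMinimizerJ (l lp lm R : ℝ) (u : ℝ → ℝ → ℝ) : Prop :=
  ConeLip l R u ∧ ∀ w : ℝ → ℝ → ℝ, ConeLip l R w → (∀ θ : ℝ, w R θ = u R θ) →
    Jfun l lp lm u R ≤ Jfun l lp lm w R

/-- Dot product of the gradients of two real functions on the plane. -/
def gdot (v η : ℂ → ℝ) (z : ℂ) : ℝ :=
  fderiv ℝ v z 1 * fderiv ℝ η z 1 + fderiv ℝ v z Complex.I * fderiv ℝ η z Complex.I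

lemma measurable_gdot (v η : ℂ → ℝ) : Measurable (gdot v η) := by
  unfold gdot
  exact ((measurable_fderiv_apply_const ℝ v 1).mul (measurable_fderiv_apply_const ℝ η 1)).add
    ((measurable_fderiv_apply_const ℝ v _).mul (measurable_fderiv_apply_const ℝ η _))

lemma abs_fderiv_le {v : ℂ → ℝ} {K : NNReal} (hv : LipschitzWith K v) (z w : ℂ) :
    |fderiv ℝ v z w| ≤ K * ‖w‖ := by
  have h := (fderiv ℝ v z).le_opNorm w
  rw [Real.norm_eq_abs] at h
  exact h.trans (mul_le_mul_of_nonneg_right (norm_fderiv_le_of_lipschitz ℝ hv) (norm_nonneg _))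

lemma abs_gdot_le {v η : ℂ → ℝ} {K K' : NNReal} (hv : LipschitzWith K v)
    (hη : LipschitzWith K' η) (z : ℂ) : |gdot v η z| ≤ 2 * K * K' := by
  have h1 := abs_fderiv_le hv z 1
  have h2 := abs_fderiv_le hv z Complex.I
  have h3 := abs_fderiv_le hη z 1
  have h4 := abs_fderiv_le hη z Complex.I
  simp only [norm_one, Complex.norm_I, mul_one] at h1 h2 h3 h4
  unfold gdot
  refine (abs_add_le _ _).trans ?_
  rw [abs_mul, abs_mul]
  have := mul_le_mul h1 h3 (abs_nonneg _) K.2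
  have := mul_le_mul h2 h4 (abs_nonneg _) K.2
  linarith

lemma gdot_self_nonneg (v : ℂ → ℝ) (z : ℂ) : 0 ≤ gdot v v z := by
  unfold gdot; nlinarith [sq_nonneg (fderiv ℝ v z 1), sq_nonneg (fderiv ℝ v z Complex.I)]

/-- radial derivative along angle `θ` -/
def dR (v : ℂ → ℝ) (z : ℂ) (θ : ℝ) : ℝ :=
  fderiv ℝ v z 1 * Real.cos θ + fderiv ℝ v z Complex.I * Real.sin θ
/-- angular derivative along angle `θ` -/
def dT (v : ℂ → ℝ) (z : ℂ) (θ : ℝ) : ℝ :=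
  - fderiv ℝ v z 1 * Real.sin θ + fderiv ℝ v z Complex.I * Real.cos θ

lemma dR_sq_add_dT_sq (v : ℂ → ℝ) (z : ℂ) (θ : ℝ) :
    dR v z θ ^ 2 + dT v z θ ^ 2 = gdot v v z := by
  unfold dR dT gdot
  linear_combination ((fderiv ℝ v z 1) ^ 2 + (fderiv ℝ v z Complex.I) ^ 2) *
    Real.cos_sq_add_sin_sq θ

lemma clm_decomp (L : ℂ →L[ℝ] ℝ) (w : ℂ) : L w = L 1 * w.re + L Complex.I * w.im := by
  conv_lhs => rw [← Complex.re_add_im w]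
  have h1 : (w.re : ℂ) = w.re • (1:ℂ) := by simp
  have h2 : (w.im : ℂ) * Complex.I = w.im • Complex.I := by simp
  rw [h1, h2, map_add, map_smul, map_smul, smul_eq_mul, smul_eq_mul]; ring

lemma hasDerivAt_radial {v : ℂ → ℝ} {x : ℂ} {ρ θ : ℝ}
    (h : DifferentiableAt ℝ v (circleMap x ρ θ)) :
    HasDerivAt (fun ρ => v (circleMap x ρ θ)) (dR v (circleMap x ρ θ) θ) ρ := by
  have h1 : HasDerivAt (fun ρ : ℝ => circleMap x ρ θ) (Complex.exp (θ * Complex.I)) ρ := by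
    unfold circleMap
    have := ((Complex.ofRealCLM.hasDerivAt (x := ρ)).mul_const
      (Complex.exp (θ * Complex.I))).const_add x
    simpa using this
  have := h.hasFDerivAt.comp_hasDerivAt ρ h1
  rw [clm_decomp, Complex.exp_ofReal_mul_I_re, Complex.exp_ofReal_mul_I_im] at this
  exact this

lemma hasDerivAt_angular {v : ℂ → ℝ} {x : ℂ} {ρ θ : ℝ}
    (h : DifferentiableAt ℝ v (circleMap x ρ θ)) :
    HasDerivAt (fun θ => v (circleMap x ρ θ)) (ρ * dT v (circleMap x ρ θ) θ) θ := by
  have h1 := hasDerivAt_circleMap x ρ θ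
  have := h.hasFDerivAt.comp_hasDerivAt θ h1
  rw [clm_decomp] at this
  have e1 : (ρ * Complex.exp (θ * Complex.I) * Complex.I).re = - ρ * Real.sin θ := by
    simp [Complex.exp_ofReal_mul_I_re, Complex.exp_ofReal_mul_I_im]
  have e2 : (ρ * Complex.exp (θ * Complex.I) * Complex.I).im = ρ * Real.cos θ := by
    simp [Complex.exp_ofReal_mul_I_re, Complex.exp_ofReal_mul_I_im]
  have e3 : circleMap 0 ρ θ = ρ * Complex.exp (θ * Complex.I) := by simp [circleMap]
  rw [e3, e1, e2] at this
  refine HasDerivAt.congr_deriv (f := fun θ => v (circleMap x ρ θ)) this ?_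
  unfold dT; ring

lemma circleMap_eq_polar (x : ℂ) (p : ℝ × ℝ) :
    circleMap x p.1 p.2 = x + Complex.polarCoord.symm p := by
  rw [Complex.polarCoord_symm_apply, circleMap, Complex.exp_mul_I]
  simp

lemma continuous_circleMap2 (x : ℂ) : Continuous (fun p : ℝ × ℝ => circleMap x p.1 p.2) := by
  unfold circleMap; fun_prop

lemma polar_ae_prod {P : ℂ → Prop} (hP : ∀ᵐ z, P z) (x : ℂ) :
    ∀ᵐ p : ℝ × ℝ, p ∈ Ioi (0:ℝ) ×ˢ Ioo (-Real.pi) Real.pi → P (circleMap x p.1 p.2) := by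
  have hP' : ∀ᵐ z, P (x + z) :=
    (measurePreserving_add_left volume x).quasiMeasurePreserving.ae hP
  obtain ⟨N, hN, hNm, hN0⟩ := exists_measurable_superset_of_null (ae_iff.1 hP')
  have h := Complex.lintegral_comp_polarCoord_symm (N.indicator 1)
  rw [lintegral_indicator_one hNm, hN0] at h
  have htgt : polarCoord.target = Ioi (0:ℝ) ×ˢ Ioo (-Real.pi) Real.pi := rfl
  have hms : MeasurableSet (Ioi (0:ℝ) ×ˢ Ioo (-Real.pi) Real.pi) := by
    exact measurableSet_Ioi.prod measurableSet_Ioo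
  have hpm : Measurable (fun p : ℝ × ℝ => Complex.polarCoord.symm p) := by
    have : (fun p : ℝ × ℝ => Complex.polarCoord.symm p) = fun p => circleMap 0 p.1 p.2 := by
      ext1 p; rw [circleMap_eq_polar]; simp
    rw [this]; exact (continuous_circleMap2 0).measurable
  have hm : Measurable (fun p : ℝ × ℝ => ENNReal.ofReal p.1 •
      (N.indicator (1 : ℂ → ENNReal) (Complex.polarCoord.symm p))) := by
    exact Measurable.smul (f := fun p : ℝ × ℝ => ENNReal.ofReal p.1)
      measurable_fst.ennreal_ofReal ((measurable_one.indicator hNm).comp hpm)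
  rw [lintegral_eq_zero_iff hm] at h
  rw [Filter.EventuallyEq, htgt, ae_restrict_iff' hms] at h
  filter_upwards [h] with p hp hp2
  have := hp hp2
  rw [circleMap_eq_polar]
  by_contra hcon
  have h3 : Complex.polarCoord.symm p ∈ N := hN hcon
  have h4 : (0:ℝ) < p.1 := hp2.1
  rw [indicator_of_mem h3] at this
  simp [not_le.2 h4] at this

lemma polar_ae {P : ℂ → Prop} (hP : ∀ᵐ z, P z) (x : ℂ) :
    ∀ᵐ ρ : ℝ, 0 < ρ → ∀ᵐ θ : ℝ, θ ∈ Ioo (-Real.pi) Real.pi → P (circleMap x ρ θ) := by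
  have h := Measure.ae_ae_of_ae_prod (polar_ae_prod hP x)
  filter_upwards [h] with ρ hρ h0
  filter_upwards [hρ] with θ hθ h1
  exact hθ ⟨h0, h1⟩

lemma polar_ae' {P : ℂ → Prop} (hP : ∀ᵐ z, P z) (x : ℂ) :
    ∀ᵐ θ : ℝ, θ ∈ Ioo (-Real.pi) Real.pi → ∀ᵐ ρ : ℝ, 0 < ρ → P (circleMap x ρ θ) := by
  have h0 : ∀ᵐ p : ℝ × ℝ, p.swap ∈ Ioi (0:ℝ) ×ˢ Ioo (-Real.pi) Real.pi →
      P (circleMap x p.swap.1 p.swap.2) :=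
    (Measure.measurePreserving_swap (μ := (volume : Measure ℝ))
      (ν := (volume : Measure ℝ))).quasiMeasurePreserving.ae (polar_ae_prod hP x)
  have h := Measure.ae_ae_of_ae_prod h0
  filter_upwards [h] with ρ hρ h0
  filter_upwards [hρ] with θ hθ h1
  exact hθ ⟨h1, h0⟩

/-- Polar coordinates: joint form on a ball. -/
lemma polar_integral_prod (f : ℂ → ℝ) (x : ℂ) (r : ℝ) :
    ∫ z in Metric.closedBall x r, f z =
      ∫ p in Ioc 0 r ×ˢ Ioo (-Real.pi) Real.pi, p.1 * f (circleMap x p.1 p.2) := by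
  rw [← integral_indicator measurableSet_closedBall,
    ← integral_add_left_eq_self (μ := (volume : Measure ℂ)) _ x,
    ← Complex.integral_comp_polarCoord_symm,
    show polarCoord.target = Ioi (0:ℝ) ×ˢ Ioo (-Real.pi) Real.pi from rfl,
    ← integral_indicator (measurableSet_Ioi.prod measurableSet_Ioo),
    ← integral_indicator (measurableSet_Ioc.prod measurableSet_Ioo)]
  congr 1
  ext1 p
  by_cases hp : p ∈ Ioi (0:ℝ) ×ˢ Ioo (-Real.pi) Real.pi
  · rw [indicator_of_mem hp, ← circleMap_eq_polar]
    have h0 : 0 < p.1 := hp.1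
    by_cases hr : p.1 ≤ r
    · rw [indicator_of_mem (s := Ioc 0 r ×ˢ _) ⟨⟨h0, hr⟩, hp.2⟩, indicator_of_mem, smul_eq_mul]
      simp [circleMap, abs_of_pos h0, hr]
    · rw [indicator_of_notMem (s := Ioc 0 r ×ˢ _) (fun h => hr h.1.2), indicator_of_notMem,
        smul_zero]
      simpa [circleMap, abs_of_pos h0] using hr
  · rw [indicator_of_notMem hp, indicator_of_notMem]
    exact fun h => hp ⟨h.1.1, h.2⟩

lemma polar_integrable {f : ℂ → ℝ} (hf : Measurable f) (x : ℂ) (r : ℝ) {C : ℝ}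
    (hC : ∀ z ∈ Metric.closedBall x r, |f z| ≤ C) :
    IntegrableOn (fun p : ℝ × ℝ => p.1 * f (circleMap x p.1 p.2))
      (Ioc 0 r ×ˢ Ioo (-Real.pi) Real.pi) := by
  have hm : MeasurableSet (Ioc 0 r ×ˢ Ioo (-Real.pi) Real.pi) :=
    measurableSet_Ioc.prod measurableSet_Ioo
  refine Measure.integrableOn_of_bounded (M := r * C) ?_ ?_ ?_
  · rw [Measure.volume_eq_prod, Measure.prod_prod]
    exact (ENNReal.mul_lt_top (by simp) (by simp)).ne
  · exact (measurable_fst.mul (hf.comp (continuous_circleMap2 x).measurable)).aestronglyMeasurable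
  · rw [ae_restrict_iff' hm]
    refine Filter.Eventually.of_forall fun p hp => ?_
    have h0 : 0 < p.1 := hp.1.1
    have hr : p.1 ≤ r := hp.1.2
    rw [norm_mul, Real.norm_eq_abs, Real.norm_eq_abs, abs_of_pos h0]
    refine mul_le_mul hr (hC _ ?_) (abs_nonneg _) (h0.le.trans hr)
    simp [circleMap, abs_of_pos h0, hr]

lemma polar_integral {f : ℂ → ℝ} (hf : Measurable f) (x : ℂ) {r : ℝ} (hr : 0 ≤ r) {C : ℝ}
    (hC : ∀ z ∈ Metric.closedBall x r, |f z| ≤ C) :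
    ∫ z in Metric.closedBall x r, f z =
      ∫ ρ in (0:ℝ)..r, ρ * ∫ θ in (-Real.pi)..Real.pi, f (circleMap x ρ θ) := by
  rw [polar_integral_prod, Measure.volume_eq_prod, setIntegral_prod,
    intervalIntegral.integral_of_le hr]
  · congr 1; ext1 ρ
    rw [intervalIntegral.integral_of_le (by linarith [Real.pi_pos]),
      integral_Ioc_eq_integral_Ioo, integral_const_mul]
  · have := polar_integrable hf x r hC
    rwa [Measure.volume_eq_prod] at this

/-- indicator of positivity -/
def pos (t : ℝ) : ℝ := if 0 < t then 1 else 0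

lemma pos_nonneg (t : ℝ) : 0 ≤ pos t := by unfold pos; split_ifs <;> norm_num
lemma pos_le_one (t : ℝ) : pos t ≤ 1 := by unfold pos; split_ifs <;> norm_num
lemma measurable_pos : Measurable pos :=
  Measurable.ite measurableSet_Ioi measurable_const measurable_const
lemma abs_pos_le (t : ℝ) : |pos t| ≤ 1 := by
  rw [abs_of_nonneg (pos_nonneg t)]; exact pos_le_one t

lemma ii_of_bdd {f : ℝ → ℝ} (hf : Measurable f) {a b C : ℝ} (h : ∀ x ∈ uIoc a b, |f x| ≤ C) :
    IntervalIntegrable f volume a b := by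
  rw [intervalIntegrable_iff]
  refine Measure.integrableOn_of_bounded (M := C) (by simp [uIoc]) hf.aestronglyMeasurable ?_
  rw [ae_restrict_iff' measurableSet_uIoc]
  exact Filter.Eventually.of_forall h

lemma cot_lipschitz {δ : ℝ} (hδ : 0 < δ) (hδ2 : δ ≤ Real.pi / 2) :
    ∃ K : NNReal, LipschitzOnWith K (fun t => Real.cos t / Real.sin t) (Icc δ (Real.pi - δ)) := by
  have hs : ∀ t ∈ Icc δ (Real.pi - δ), Real.sin δ ≤ Real.sin t := by
    intro t ht
    rcases le_total t (Real.pi / 2) with h | h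
    · exact Real.sin_le_sin_of_le_of_le_pi_div_two (by linarith [Real.pi_pos]) h ht.1
    · rw [← Real.sin_pi_sub t]
      exact Real.sin_le_sin_of_le_of_le_pi_div_two (by linarith [Real.pi_pos]) (by linarith)
        (by linarith [ht.2])
  have hs0 : 0 < Real.sin δ := Real.sin_pos_of_pos_of_lt_pi hδ (by linarith [Real.pi_pos])
  refine ⟨(1 / Real.sin δ ^ 2).toNNReal, ?_⟩
  refine (convex_Icc _ _).lipschitzOnWith_of_nnnorm_hasDerivWithin_le
    (f' := fun t => - (1 / Real.sin t ^ 2)) (fun t ht => ?_) (fun t ht => ?_)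
  · have h0 : Real.sin t ≠ 0 := (hs0.trans_le (hs t ht)).ne'
    have := ((Real.hasDerivAt_cos t).div (Real.hasDerivAt_sin t) h0).hasDerivWithinAt
      (s := Icc δ (Real.pi - δ))
    refine this.congr_deriv ?_
    field_simp
    linarith [Real.sin_sq_add_cos_sq t]
  · rw [← NNReal.coe_le_coe]
    rw [coe_nnnorm, Real.coe_toNNReal _ (by positivity), norm_neg, Real.norm_of_nonneg (by positivity)]
    exact one_div_le_one_div_of_le (by positivity) (pow_le_pow_left₀ hs0.le (hs t ht) 2)

lemma wirtinger_aux {h : ℝ → ℝ} {K : NNReal} (hh : LipschitzWith K h) {a b : ℝ} (hab : a ≤ b)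
    (ha : h a ≤ 0) (hb : h b ≤ 0) {ε : ℝ} (hε : 0 < ε) :
    (Real.pi / ((∫ θ in a..b, pos (h θ)) + 2 * ε)) ^ 2 * ∫ θ in a..b, (max (h θ) 0) ^ 2 ≤
      ∫ θ in a..b, pos (h θ) * (deriv h θ) ^ 2 := by
  set m := ∫ θ in a..b, pos (h θ) with hm
  set ω := Real.pi / (m + 2 * ε) with hω
  have hposm : Measurable fun θ => pos (h θ) := measurable_pos.comp hh.continuous.measurable
  have hii : ∀ c d, IntervalIntegrable (fun θ => pos (h θ)) volume c d := fun c d =>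
    ii_of_bdd hposm (C := 1) (fun x _ => abs_pos_le _)
  have hm0 : 0 ≤ m := intervalIntegral.integral_nonneg hab (fun _ _ => pos_nonneg _)
  have hωpos : 0 < ω := by have := Real.pi_pos; positivity
  have hωm : ω * (m + 2 * ε) = Real.pi := by
    rw [hω]; field_simp
  set T : ℝ → ℝ := fun θ => ∫ t in a..θ, pos (h t) with hT
  have hTsub : ∀ x y, T y - T x = ∫ t in x..y, pos (h t) := fun x y =>
    intervalIntegral.integral_interval_sub_left (hii _ _) (hii _ _)
  have hTlip : LipschitzWith 1 T := by
    refine LipschitzWith.of_dist_le_mul fun x y => ?_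
    rw [dist_comm, Real.dist_eq, hTsub, NNReal.coe_one, one_mul, Real.dist_eq, abs_sub_comm]
    have := intervalIntegral.norm_integral_le_of_norm_le_const (C := 1) (a := x) (b := y)
      (f := fun t => pos (h t)) (fun t _ => abs_pos_le _)
    simpa using this
  have hT0 : ∀ θ ∈ Icc a b, 0 ≤ T θ := fun θ hθ =>
    intervalIntegral.integral_nonneg hθ.1 (fun _ _ => pos_nonneg _)
  have hTm : ∀ θ ∈ Icc a b, T θ ≤ m := by
    intro θ hθ
    have h1 : m - T θ = ∫ t in θ..b, pos (h t) := hTsub θ b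
    have h2 : 0 ≤ ∫ t in θ..b, pos (h t) :=
      intervalIntegral.integral_nonneg hθ.2 (fun _ _ => pos_nonneg _)
    linarith
  have hδ2 : ω * ε ≤ Real.pi / 2 := by nlinarith
  obtain ⟨Kc, hKc⟩ := cot_lipschitz (mul_pos hωpos hε) hδ2
  have hmaps : MapsTo (fun θ => ω * (T θ + ε)) (Icc a b) (Icc (ω * ε) (Real.pi - ω * ε)) := by
    intro θ hθ
    have h1 := hT0 θ hθ
    have h2 := hTm θ hθ
    constructor
    · nlinarith
    · nlinarith
  have hlin : LipschitzWith ⟨ω, hωpos.le⟩ (fun θ => ω * (T θ + ε)) := by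
    refine LipschitzWith.of_dist_le_mul fun x y => ?_
    have := hTlip.dist_le_mul x y
    rw [Real.dist_eq] at this ⊢
    rw [show ω * (T x + ε) - ω * (T y + ε) = ω * (T x - T y) by ring, abs_mul, abs_of_pos hωpos]
    simp only [NNReal.coe_one, one_mul] at this
    exact mul_le_mul_of_nonneg_left this hωpos.le
  have hφac : AbsolutelyContinuousOnInterval
      (fun θ => Real.cos (ω * (T θ + ε)) / Real.sin (ω * (T θ + ε))) a b := by
    apply LipschitzOnWith.absolutelyContinuousOnInterval (K := Kc * ⟨ω, hωpos.le⟩)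
    rw [uIcc_of_le hab]
    exact hKc.comp hlin.lipschitzOnWith hmaps
  have hglip : LipschitzWith K (fun θ => max (h θ) 0) := hh.max_const 0
  have hgac : AbsolutelyContinuousOnInterval (fun θ => max (h θ) 0) a b :=
    hglip.lipschitzOnWith.absolutelyContinuousOnInterval
  set φ : ℝ → ℝ := fun θ => Real.cos (ω * (T θ + ε)) / Real.sin (ω * (T θ + ε)) with hφ
  have hGac : AbsolutelyContinuousOnInterval
      (fun θ => φ θ * (max (h θ) 0 * max (h θ) 0)) a b := hφac.fun_mul (hgac.fun_mul hgac)
  have hFTC := hGac.integral_deriv_eq_sub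
  rw [max_eq_right ha, max_eq_right hb] at hFTC
  simp only [mul_zero, sub_zero] at hFTC
  have hderivm : Measurable (deriv h) := measurable_deriv h
  have hdb : ∀ θ, |deriv h θ| ≤ K := fun θ => norm_deriv_le_of_lipschitz hh
  have hI1 : IntervalIntegrable (fun θ => pos (h θ) * (deriv h θ) ^ 2) volume a b := by
    refine ii_of_bdd (hposm.mul (hderivm.pow_const 2)) (C := (K:ℝ)^2) (fun x _ => ?_)
    change |pos (h x) * (deriv h x) ^ 2| ≤ _
    rw [abs_mul, abs_pow]
    have := pow_le_pow_left₀ (abs_nonneg _) (hdb x) 2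
    nlinarith [abs_pos_le (h x), abs_nonneg (pos (h x)), sq_nonneg (|deriv h x|)]
  have hI2 : IntervalIntegrable (fun θ => (max (h θ) 0) ^ 2) volume a b :=
    (hglip.continuous.pow 2).intervalIntegrable _ _
  have hle : ∫ θ in a..b, ω * deriv (fun θ => φ θ * (max (h θ) 0 * max (h θ) 0)) θ ≤
      ∫ θ in a..b, (pos (h θ) * (deriv h θ) ^ 2 - ω ^ 2 * (max (h θ) 0) ^ 2) := by
    refine intervalIntegral.integral_mono_ae_restrict hab
      (hGac.intervalIntegrable_deriv.const_mul ω) (hI1.sub (hI2.const_mul _)) ?_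
    refine (ae_restrict_iff' measurableSet_Icc).2 ?_
    filter_upwards [hh.ae_differentiableAt_real] with θ hθd hθ
    by_cases hp : 0 < h θ
    · -- positive
      have hev : ∀ᶠ t in nhds θ, 0 < h t := hh.continuous.continuousAt.eventually (lt_mem_nhds hp)
      have hTd : HasDerivAt T 1 θ := by
        have hc : ContinuousAt (fun t => pos (h t)) θ := by
          refine (continuousAt_const (y := (1:ℝ))).congr ?_
          filter_upwards [hev] with t ht
          simp [pos, ht]
        have := intervalIntegral.integral_hasDerivAt_right (hii a θ)
          (hposm.stronglyMeasurable.stronglyMeasurableAtFilter) hc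
        rw [show pos (h θ) = 1 by simp [pos, hp]] at this
        exact this
      have hs : Real.sin (ω * (T θ + ε)) ≠ 0 := by
        have h3 := hmaps hθ
        refine (Real.sin_pos_of_pos_of_lt_pi (by nlinarith [h3.1]) ?_).ne'
        have := h3.2
        simp only at this
        nlinarith
      have h1 : HasDerivAt (fun θ => ω * (T θ + ε)) (ω * 1) θ := (hTd.add_const ε).const_mul ω
      have hφd := (h1.cos).div h1.sin hs
      have hhd := hθd.hasDerivAt
      have hG := hφd.mul (hhd.mul hhd)
      have hG2 := hG.congr_of_eventuallyEq (f₁ := fun θ => φ θ * (max (h θ) 0 * max (h θ) 0)) (by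
        filter_upwards [hev] with t ht
        simp [φ, max_eq_left ht.le])
      rw [hG2.deriv, max_eq_left hp.le]
      have hpp : pos (h θ) = 1 := by simp [pos, hp]
      rw [hpp]
      simp only [Pi.mul_apply, Pi.div_apply]
      have hsc := Real.sin_sq_add_cos_sq (ω * (T θ + ε))
      set S := Real.sin (ω * (T θ + ε))
      set Cc := Real.cos (ω * (T θ + ε))
      have e : ω * (((-S * (ω * 1) * S - Cc * (Cc * (ω * 1))) / S ^ 2) * (h θ * h θ) +
          Cc / S * (deriv h θ * h θ + h θ * deriv h θ)) =
          1 * deriv h θ ^ 2 - ω ^ 2 * h θ ^ 2 - (deriv h θ - ω * (Cc / S) * h θ) ^ 2 := by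
        field_simp
        ring
      nlinarith [sq_nonneg (deriv h θ - ω * (Cc / S) * h θ)]
    · -- nonpositive
      push Not at hp
      have hz : HasDerivAt (fun θ => φ θ * (max (h θ) 0 * max (h θ) 0)) 0 θ ∨
          deriv (fun θ => φ θ * (max (h θ) 0 * max (h θ) 0)) θ = 0 := by
        by_cases hdiff : DifferentiableAt ℝ (fun θ => φ θ * (max (h θ) 0 * max (h θ) 0)) θ
        swap
        · right; exact deriv_zero_of_not_differentiableAt hdiff
        left
        have hs : Real.sin (ω * (T θ + ε)) ≠ 0 := by
          have h3 := hmaps hθ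
          refine (Real.sin_pos_of_pos_of_lt_pi (by nlinarith [h3.1]) ?_).ne'
          have := h3.2
          simp only at this
          nlinarith
        have hφc : ContinuousAt φ θ := by
          have hTc : ContinuousAt (fun θ => ω * (T θ + ε)) θ := hlin.continuous.continuousAt
          exact (Real.continuous_cos.continuousAt.comp hTc).div
            (Real.continuous_sin.continuousAt.comp hTc) hs
        have hO : (fun t => max (h t) 0) =O[nhds θ] fun t => t - θ := by
          refine Asymptotics.IsBigO.of_bound K (Filter.Eventually.of_forall fun t => ?_)
          have := hglip.dist_le_mul t θ
          simpa [Real.dist_eq, max_eq_right hp] using this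
        have ho : (fun t => max (h t) 0) =o[nhds θ] fun _ => (1:ℝ) := by
          rw [Asymptotics.isLittleO_one_iff]
          have := hglip.continuous.continuousAt (x := θ)
          simpa [ContinuousAt, max_eq_right hp] using this
        have hφO : φ =O[nhds θ] fun _ => (1:ℝ) := hφc.isBigO_one ℝ
        have hfin := hφO.mul_isLittleO (ho.mul_isBigO hO)
        rw [hasDerivAt_iff_isLittleO]
        simpa [max_eq_right hp] using hfin
      have hz' : deriv (fun θ => φ θ * (max (h θ) 0 * max (h θ) 0)) θ = 0 := by
        rcases hz with h | h
        · exact h.deriv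
        · exact h
      rw [hz', max_eq_right hp]
      simp [pos, not_lt.2 hp]
  rw [intervalIntegral.integral_const_mul, hFTC, mul_zero,
    intervalIntegral.integral_sub hI1 (hI2.const_mul _), intervalIntegral.integral_const_mul] at hle
  linarith

lemma wirtinger {h : ℝ → ℝ} {K : NNReal} (hh : LipschitzWith K h) {a b : ℝ} (hab : a ≤ b)
    (ha : h a ≤ 0) (hb : h b ≤ 0) :
    Real.pi ^ 2 * ∫ θ in a..b, (max (h θ) 0) ^ 2 ≤
      (∫ θ in a..b, pos (h θ)) ^ 2 * ∫ θ in a..b, pos (h θ) * (deriv h θ) ^ 2 := by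
  set m := ∫ θ in a..b, pos (h θ) with hm
  have hm0 : 0 ≤ m := intervalIntegral.integral_nonneg hab (fun _ _ => pos_nonneg _)
  have key : ∀ ε > 0, Real.pi ^ 2 * ∫ θ in a..b, (max (h θ) 0) ^ 2 ≤
      (m + 2 * ε) ^ 2 * ∫ θ in a..b, pos (h θ) * (deriv h θ) ^ 2 := by
    intro ε hε
    have := wirtinger_aux hh hab ha hb hε
    rw [← hm, div_pow, div_mul_eq_mul_div, div_le_iff₀ (by positivity)] at this
    linarith
  have ht : Filter.Tendsto (fun ε : ℝ => (m + 2 * ε) ^ 2 *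
      ∫ θ in a..b, pos (h θ) * (deriv h θ) ^ 2) (nhdsWithin 0 (Ioi 0))
      (nhds ((m + 2 * 0) ^ 2 * ∫ θ in a..b, pos (h θ) * (deriv h θ) ^ 2)) := by
    apply Filter.Tendsto.mono_left _ nhdsWithin_le_nhds
    apply Continuous.tendsto
    fun_prop
  rw [mul_zero, add_zero] at ht
  refine ge_of_tendsto ht ?_
  filter_upwards [self_mem_nhdsWithin] with ε hε
  exact key ε hε

lemma abs_ii_le {f : ℝ → ℝ} {a b C : ℝ} (h : ∀ t, |f t| ≤ C) :
    |∫ t in a..b, f t| ≤ C * |b - a| :=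
  intervalIntegral.norm_integral_le_of_norm_le_const (E := ℝ) (fun t _ => h t)

lemma gdot_polar (v η : ℂ → ℝ) (z : ℂ) (θ : ℝ) :
    gdot v η z = dR v z θ * dR η z θ + dT v z θ * dT η z θ := by
  unfold dR dT gdot
  linear_combination -(fderiv ℝ v z 1 * fderiv ℝ η z 1 +
    fderiv ℝ v z Complex.I * fderiv ℝ η z Complex.I) * Real.cos_sq_add_sin_sq θ

lemma gdot_const_mul (v η : ℂ → ℝ) (t : ℝ) (z : ℂ) :
    gdot v (fun z => t * η z) z = t * gdot v η z := by
  have : fderiv ℝ (fun z => t * η z) z = t • fderiv ℝ η z := by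
    have := fderiv_const_smul_field (𝕜 := ℝ) (f := η) t
    exact congrFun this z
  unfold gdot
  rw [this]
  simp only [smul_apply, smul_eq_mul]
  ring

lemma gdot_comm (v η : ℂ → ℝ) (z : ℂ) : gdot v η z = gdot η v z := by
  unfold gdot; ring

lemma gdot_radial {v η : ℂ → ℝ} {x : ℂ} {ρ θ f' : ℝ} {f : ℝ → ℝ} (hρ : 0 < ρ)
    (hη : ∀ z, η z = f ‖z - x‖) (hd : DifferentiableAt ℝ η (circleMap x ρ θ))
    (hf : HasDerivAt f f' ρ) :
    gdot v η (circleMap x ρ θ) = f' * dR v (circleMap x ρ θ) θ := by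
  have h1 := hasDerivAt_radial hd
  have h2 := hasDerivAt_angular hd
  have e1 : HasDerivAt (fun ρ => η (circleMap x ρ θ)) f' ρ := by
    refine hf.congr_of_eventuallyEq ?_
    filter_upwards [lt_mem_nhds hρ] with t ht
    rw [hη, circleMap_sub_center, norm_circleMap_zero, abs_of_pos ht]
  have e2 : HasDerivAt (fun θ => η (circleMap x ρ θ)) 0 θ := by
    have : (fun θ => η (circleMap x ρ θ)) = fun _ => f ρ := by
      ext1 t
      rw [hη, circleMap_sub_center, norm_circleMap_zero, abs_of_pos hρ]
    rw [this]; exact hasDerivAt_const _ _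
  have k1 := h1.unique e1
  have k2 := h2.unique e2
  have k3 : dT η (circleMap x ρ θ) θ = 0 := by
    rcases mul_eq_zero.1 k2 with h | h
    · exact absurd h hρ.ne'
    · exact h
  rw [gdot_polar v η _ θ, k1, k3]; ring

/-- circle integrals -/
def cInt (v : ℂ → ℝ) (x : ℂ) (ρ : ℝ) : ℝ := ∫ θ in (-Real.pi)..Real.pi, v (circleMap x ρ θ)

lemma abs_dR_le {v : ℂ → ℝ} {K : NNReal} (hv : LipschitzWith K v) (z : ℂ) (θ : ℝ) :
    |dR v z θ| ≤ 2 * K := by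
  have h1 := abs_fderiv_le hv z 1
  have h2 := abs_fderiv_le hv z Complex.I
  simp only [norm_one, Complex.norm_I, mul_one] at h1 h2
  unfold dR
  refine (abs_add_le _ _).trans ?_
  rw [abs_mul, abs_mul]
  have := mul_le_mul h1 (Real.abs_cos_le_one θ) (abs_nonneg _) K.2
  have := mul_le_mul h2 (Real.abs_sin_le_one θ) (abs_nonneg _) K.2
  linarith

lemma abs_dT_le {v : ℂ → ℝ} {K : NNReal} (hv : LipschitzWith K v) (z : ℂ) (θ : ℝ) :
    |dT v z θ| ≤ 2 * K := by
  have h1 := abs_fderiv_le hv z 1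
  have h2 := abs_fderiv_le hv z Complex.I
  simp only [norm_one, Complex.norm_I, mul_one] at h1 h2
  unfold dT
  refine (abs_add_le _ _).trans ?_
  rw [abs_mul, abs_mul, abs_neg]
  have := mul_le_mul h1 (Real.abs_sin_le_one θ) (abs_nonneg _) K.2
  have := mul_le_mul h2 (Real.abs_cos_le_one θ) (abs_nonneg _) K.2
  linarith

lemma measurable_dR2 (v : ℂ → ℝ) (x : ℂ) :
    Measurable (fun p : ℝ × ℝ => dR v (circleMap x p.1 p.2) p.2) := by
  unfold dR
  have hc := (continuous_circleMap2 x).measurable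
  have h1 := (measurable_fderiv_apply_const ℝ v 1).comp hc
  have h2 := (measurable_fderiv_apply_const ℝ v Complex.I).comp hc
  exact (h1.mul (Real.measurable_cos.comp measurable_snd)).add
    (h2.mul (Real.measurable_sin.comp measurable_snd))

lemma measurable_dT2 (v : ℂ → ℝ) (x : ℂ) :
    Measurable (fun p : ℝ × ℝ => dT v (circleMap x p.1 p.2) p.2) := by
  unfold dT
  have hc := (continuous_circleMap2 x).measurable
  have h1 := (measurable_fderiv_apply_const ℝ v 1).comp hc
  have h2 := (measurable_fderiv_apply_const ℝ v Complex.I).comp hc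
  exact (h1.neg.mul (Real.measurable_sin.comp measurable_snd)).add
    (h2.mul (Real.measurable_cos.comp measurable_snd))

lemma lip_ray {v : ℂ → ℝ} {K : NNReal} (hv : LipschitzWith K v) (x : ℂ) (θ : ℝ) :
    LipschitzWith K (fun ρ : ℝ => v (circleMap x ρ θ)) := by
  refine LipschitzWith.of_dist_le_mul fun a b => ?_
  refine (hv.dist_le_mul _ _).trans ?_
  refine mul_le_mul_of_nonneg_left ?_ K.2
  have : circleMap x a θ - circleMap x b θ = ((a - b : ℝ) : ℂ) * Complex.exp (θ * Complex.I) := by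
    simp [circleMap]; ring
  rw [dist_eq_norm, this, norm_mul, Complex.norm_exp_ofReal_mul_I, mul_one, Complex.norm_real,
    Real.dist_eq, Real.norm_eq_abs]

lemma prod_integrable_of_bdd {F : ℝ × ℝ → ℝ} (hF : Measurable F) {C : ℝ} (h : ∀ p, |F p| ≤ C)
    (a b c d : ℝ) :
    Integrable F ((volume.restrict (uIoc a b)).prod (volume.restrict (uIoc c d))) := by
  have : IsFiniteMeasure (volume.restrict (uIoc a b)) := ⟨by simp [uIoc]⟩
  have : IsFiniteMeasure (volume.restrict (uIoc c d)) := ⟨by simp [uIoc]⟩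
  exact Integrable.of_bound hF.aestronglyMeasurable C (Filter.Eventually.of_forall h)

lemma swap_bdd {F : ℝ × ℝ → ℝ} (hF : Measurable F) {C : ℝ} (h : ∀ p, |F p| ≤ C)
    (a b c d : ℝ) :
    ∫ ρ in a..b, ∫ θ in c..d, F (ρ, θ) = ∫ θ in c..d, ∫ ρ in a..b, F (ρ, θ) := by
  simp_rw [intervalIntegral.intervalIntegral_eq_integral_uIoc]
  rw [integral_smul, integral_smul, integral_integral_swap, smul_comm]
  exact prod_integrable_of_bdd hF h a b c d

/-- FTC for circle integrals. -/
lemma cInt_ftc {v : ℂ → ℝ} {K : NNReal} (hv : LipschitzWith K v) (x : ℂ) {a b : ℝ}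
    (ha : 0 ≤ a) (hab : a ≤ b) :
    ∫ ρ in a..b, ∫ θ in (-Real.pi)..Real.pi, dR v (circleMap x ρ θ) θ = cInt v x b - cInt v x a := by
  have hpi := Real.pi_pos
  rw [swap_bdd (measurable_dR2 v x) (fun p => abs_dR_le hv _ _)]
  unfold cInt
  have hcont : ∀ ρ, Continuous fun θ => v (circleMap x ρ θ) := fun ρ =>
    hv.continuous.comp (continuous_circleMap x ρ)
  rw [← intervalIntegral.integral_sub ((hcont b).intervalIntegrable _ _)
    ((hcont a).intervalIntegrable _ _)]
  refine intervalIntegral.integral_congr_ae' ?_ ?_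
  swap
  · refine Filter.Eventually.of_forall fun θ hθ => ?_
    have : Real.pi < - Real.pi := hθ.1.trans_le hθ.2
    linarith
  have h := polar_ae' hv.ae_differentiableAt x
  filter_upwards [h, (show ∀ᵐ θ : ℝ, θ ≠ Real.pi from by simp [ae_iff, measure_singleton])]
    with θ hθ hne hmem
  have hθ' := hθ ⟨hmem.1, lt_of_le_of_ne hmem.2 hne⟩
  have hac : AbsolutelyContinuousOnInterval (fun ρ : ℝ => v (circleMap x ρ θ)) a b :=
    (lip_ray hv x θ).lipschitzOnWith.absolutelyContinuousOnInterval
  rw [← hac.integral_deriv_eq_sub]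
  refine intervalIntegral.integral_congr_ae' ?_ ?_
  · filter_upwards [hθ'] with ρ hρ hm
    exact (hasDerivAt_radial (hρ (ha.trans_lt hm.1))).deriv.symm
  · refine Filter.Eventually.of_forall fun ρ hρ => ?_
    have : b < a := hρ.1.trans_le hρ.2
    linarith

/-- The logarithmic test profile. -/
def lprof (a b t : ℝ) : ℝ := Real.log b - Real.log (max a (min b t))

lemma lprof_lip {a b : ℝ} (ha : 0 < a) : LipschitzWith (1/a).toNNReal (lprof a b) := by
  have hlog : LipschitzOnWith (1/a).toNNReal Real.log (Ici a) := by
    refine (convex_Ici a).lipschitzOnWith_of_nnnorm_hasDerivWithin_le (f' := fun t => t⁻¹)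
      (fun t ht => (Real.hasDerivAt_log (ha.trans_le ht).ne').hasDerivWithinAt) (fun t ht => ?_)
    rw [← NNReal.coe_le_coe, coe_nnnorm, Real.coe_toNNReal _ (by positivity)]
    have ht0 : 0 < t := ha.trans_le ht
    rw [Real.norm_of_nonneg (by positivity)]
    change t⁻¹ ≤ 1 / a
    rw [← one_div]
    exact one_div_le_one_div_of_le ha ht
  have hcl : LipschitzWith 1 (fun t : ℝ => max a (min b t)) :=
    (LipschitzWith.id.const_min b).const_max a
  refine LipschitzWith.of_dist_le_mul fun s t => ?_
  have h1 := hlog.dist_le_mul (max a (min b s)) (mem_Ici.2 (le_max_left _ _))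
    (max a (min b t)) (mem_Ici.2 (le_max_left _ _))
  have h2 := hcl.dist_le_mul s t
  simp only [NNReal.coe_one, one_mul] at h2
  unfold lprof
  rw [dist_sub_left]
  exact h1.trans (mul_le_mul_of_nonneg_left h2 (by positivity))

lemma lprof_zero {a b t : ℝ} (hab : a ≤ b) (ht : b ≤ t) : lprof a b t = 0 := by
  unfold lprof; rw [min_eq_left ht, max_eq_right hab, sub_self]

lemma lprof_deriv_mid {a b t : ℝ} (ha : 0 < a) (h1 : a < t) (h2 : t < b) :
    HasDerivAt (lprof a b) (-(1/t)) t := by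
  have : HasDerivAt (fun t => Real.log b - Real.log t) (-(1/t)) t := by
    have := (Real.hasDerivAt_log (ha.trans h1).ne').const_sub (Real.log b)
    simpa using this
  refine this.congr_of_eventuallyEq ?_
  filter_upwards [lt_mem_nhds h1, gt_mem_nhds h2] with s hs1 hs2
  unfold lprof
  rw [min_eq_right hs2.le, max_eq_right hs1.le]

lemma lprof_deriv_in {a b t : ℝ} (h1 : t < a) : HasDerivAt (lprof a b) 0 t := by
  refine (hasDerivAt_const t (Real.log b - Real.log a)).congr_of_eventuallyEq ?_
  filter_upwards [gt_mem_nhds h1] with s hs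
  unfold lprof
  rw [max_eq_left ((min_le_right _ _).trans hs.le)]

def ltest (x : ℂ) (a b : ℝ) (z : ℂ) : ℝ := lprof a b ‖z - x‖

lemma lip_norm_sub (x : ℂ) : LipschitzWith 1 (fun z : ℂ => ‖z - x‖) := by
  refine LipschitzWith.of_dist_le_mul fun s t => ?_
  rw [NNReal.coe_one, one_mul, Real.dist_eq, dist_eq_norm]
  have := abs_norm_sub_norm_le (s - x) (t - x)
  simpa using this

lemma ltest_lip (x : ℂ) {a b : ℝ} (ha : 0 < a) :
    LipschitzWith (1/a).toNNReal (ltest x a b) := by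
  have := (lprof_lip (b := b) ha).comp (lip_norm_sub x)
  rw [mul_one] at this
  exact this

lemma ltest_integral {v : ℂ → ℝ} {K : NNReal} (hv : LipschitzWith K v) (x : ℂ) {a b : ℝ}
    (ha : 0 < a) (hab : a ≤ b) :
    ∫ z in Metric.closedBall x b, gdot v (ltest x a b) z = cInt v x a - cInt v x b := by
  have hb : 0 ≤ b := ha.le.trans hab
  have hηl := ltest_lip x (b := b) ha
  rw [polar_integral (measurable_gdot _ _) x hb (fun z _ => abs_gdot_le hv hηl z)]
  have key : ∀ᵐ ρ : ℝ, 0 < ρ → (ρ < a → ρ * ∫ θ in (-Real.pi)..Real.pi,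
      gdot v (ltest x a b) (circleMap x ρ θ) = 0) ∧ (a < ρ → ρ < b →
      ρ * ∫ θ in (-Real.pi)..Real.pi, gdot v (ltest x a b) (circleMap x ρ θ) =
      - ∫ θ in (-Real.pi)..Real.pi, dR v (circleMap x ρ θ) θ) := by
    filter_upwards [polar_ae hηl.ae_differentiableAt x] with ρ hρ h0
    have hθ := hρ h0
    have hcong : ∀ f', HasDerivAt (lprof a b) f' ρ → ∫ θ in (-Real.pi)..Real.pi,
        gdot v (ltest x a b) (circleMap x ρ θ) =
        f' * ∫ θ in (-Real.pi)..Real.pi, dR v (circleMap x ρ θ) θ := by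
      intro f' hf'
      rw [← intervalIntegral.integral_const_mul]
      refine intervalIntegral.integral_congr_ae' ?_ ?_
      · filter_upwards [hθ, (show ∀ᵐ θ : ℝ, θ ≠ Real.pi from by simp [ae_iff, measure_singleton])]
          with θ hd hne hm
        exact gdot_radial h0 (fun z => rfl) (hd ⟨hm.1, lt_of_le_of_ne hm.2 hne⟩) hf'
      · refine Filter.Eventually.of_forall fun θ hθ => ?_
        have : Real.pi < - Real.pi := hθ.1.trans_le hθ.2
        linarith [Real.pi_pos]
    constructor
    · intro h
      rw [hcong 0 (lprof_deriv_in h)]; ring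
    · intro h1 h2
      rw [hcong _ (lprof_deriv_mid ha h1 h2)]
      field_simp
  have hne : ∀ c : ℝ, ∀ᵐ θ : ℝ, θ ≠ c := fun c => by simp [ae_iff, measure_singleton]
  have hmeas : Measurable fun ρ => ρ * ∫ θ in (-Real.pi)..Real.pi,
      gdot v (ltest x a b) (circleMap x ρ θ) := by
    simp_rw [intervalIntegral.integral_of_le (show -Real.pi ≤ Real.pi by linarith [Real.pi_pos])]
    exact measurable_id.mul (((measurable_gdot v (ltest x a b)).comp
      (continuous_circleMap2 x).measurable).stronglyMeasurable.integral_prod_right').measurable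
  have hii : ∀ c d, IntervalIntegrable (fun ρ => ρ * ∫ θ in (-Real.pi)..Real.pi,
      gdot v (ltest x a b) (circleMap x ρ θ)) volume c d := by
    intro c d
    refine ii_of_bdd hmeas (C := (|c| + |d|) * (2 * K * (1/a) * |Real.pi - -Real.pi|)) ?_
    intro ρ hρ
    rw [abs_mul]
    refine mul_le_mul ?_ ?_ (abs_nonneg _) (by positivity)
    · have := abs_le_max_abs_abs hρ.1.le hρ.2
      refine this.trans ?_
      have k1 := abs_nonneg c
      have k2 := abs_nonneg d
      refine max_le ?_ ?_
      · rcases min_cases c d with h | h <;> rw [h.1] <;> linarith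
      · rcases max_cases c d with h | h <;> rw [h.1] <;> linarith
    · refine abs_ii_le (fun θ => ?_)
      have := abs_gdot_le hv hηl (circleMap x ρ θ)
      rwa [Real.coe_toNNReal _ (by positivity)] at this
  rw [← intervalIntegral.integral_add_adjacent_intervals (hii 0 a) (hii a b)]
  have i1 : ∫ ρ in (0:ℝ)..a, ρ * ∫ θ in (-Real.pi)..Real.pi,
      gdot v (ltest x a b) (circleMap x ρ θ) = 0 := by
    refine (intervalIntegral.integral_congr_ae (g := fun _ => (0:ℝ)) ?_).trans (by simp)
    filter_upwards [key, hne a] with ρ hk hn hm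
    rw [uIoc_of_le ha.le] at hm
    exact (hk hm.1).1 (lt_of_le_of_ne hm.2 hn)
  have i2 : ∫ ρ in a..b, ρ * ∫ θ in (-Real.pi)..Real.pi,
      gdot v (ltest x a b) (circleMap x ρ θ) = - (cInt v x b - cInt v x a) := by
    rw [← cInt_ftc hv x ha.le hab, ← intervalIntegral.integral_neg]
    refine intervalIntegral.integral_congr_ae ?_
    filter_upwards [key, hne b] with ρ hk hn hm
    rw [uIoc_of_le hab] at hm
    exact (hk (ha.trans hm.1)).2 hm.1 (lt_of_le_of_ne hm.2 hn)
  rw [i1, i2]; ring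

/-- Local almost-minimality in the plane. -/
structure LocMin (v : ℂ → ℝ) (K : NNReal) (Λ : ℝ) (c : ℂ) (R : ℝ) : Prop where
  lip : LipschitzWith K v
  hΛ : 0 ≤ Λ
  h1 : ∀ (η : ℂ → ℝ) (K' : NNReal) (x : ℂ) (ρ : ℝ), LipschitzWith K' η → 0 < ρ →
    Metric.closedBall x ρ ⊆ Metric.closedBall c R → (∀ z, z ∉ Metric.closedBall x ρ → η z = 0) →
    0 ≤ 2 * (∫ z in Metric.closedBall x ρ, gdot v η z) +
      (∫ z in Metric.closedBall x ρ, gdot η η z) + Λ * (Real.pi * ρ ^ 2)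
  h2 : ∀ (η : ℂ → ℝ) (K' : NNReal) (x : ℂ) (ρ : ℝ), LipschitzWith K' η → 0 < ρ →
    Metric.closedBall x ρ ⊆ Metric.closedBall c R → (∀ z, z ∉ Metric.closedBall x ρ → η z = 0) →
    (∀ z, |η z| ≤ |v z| / 2) →
    0 ≤ 2 * (∫ z in Metric.closedBall x ρ, gdot v η z) +
      (∫ z in Metric.closedBall x ρ, gdot η η z)
  energy : ∫ z in Metric.closedBall c R, gdot v v z ≤ 1

lemma gdot_neg_left (v η : ℂ → ℝ) (z : ℂ) : gdot (fun z => - v z) η z = - gdot v η z := by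
  have := gdot_const_mul η v (-1) z
  simp only [neg_mul, one_mul] at this
  rw [gdot_comm, this, gdot_comm]

lemma gdot_neg_right (v η : ℂ → ℝ) (z : ℂ) : gdot v (fun z => - η z) z = - gdot v η z := by
  rw [gdot_comm, gdot_neg_left, gdot_comm]

lemma lip_neg {v : ℂ → ℝ} {K : NNReal} (h : LipschitzWith K v) :
    LipschitzWith K (fun z => - v z) := h.neg

lemma lip_cmul {v : ℂ → ℝ} {K : NNReal} (h : LipschitzWith K v) (t : ℝ) :
    LipschitzWith (‖t‖₊ * K) (fun z => t * v z) := by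
  refine LipschitzWith.of_dist_le_mul fun a b => ?_
  have := mul_le_mul_of_nonneg_left (h.dist_le_mul a b) (abs_nonneg t)
  rw [Real.dist_eq, ← mul_sub, abs_mul, ← Real.dist_eq]
  simpa [mul_assoc] using this

lemma LocMin.neg {v : ℂ → ℝ} {K : NNReal} {Λ R : ℝ} {c : ℂ} (h : LocMin v K Λ c R) :
    LocMin (fun z => - v z) K Λ c R where
  lip := lip_neg h.lip
  hΛ := h.hΛ
  h1 := by
    intro η K' x ρ hη hρ hs hz
    have := h.h1 (fun z => - η z) K' x ρ (lip_neg hη) hρ hs (fun z hz' => by rw [hz z hz', neg_zero])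
    simpa only [gdot_neg_left, gdot_neg_right, neg_neg] using this
  h2 := by
    intro η K' x ρ hη hρ hs hz hle
    have := h.h2 (fun z => - η z) K' x ρ (lip_neg hη) hρ hs (fun z hz' => by rw [hz z hz', neg_zero])
      (fun z => by have := hle z; rwa [abs_neg] at this ⊢)
    simpa only [gdot_neg_left, gdot_neg_right, neg_neg] using this
  energy := by
    simpa only [gdot_neg_left, gdot_neg_right, neg_neg] using h.energy

lemma zero_of_quad {A B δ : ℝ} (hδ : 0 < δ) (h : ∀ t, |t| ≤ δ → 0 ≤ 2 * (t * A) + t ^ 2 * B) :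
    A = 0 := by
  by_contra hA
  have hAp : 0 < |A| := abs_pos.2 hA
  set t0 := min δ (|A| / (|B| + 1)) with ht0
  have ht0p : 0 < t0 := lt_min hδ (by positivity)
  have hB : t0 * (|B| + 1) ≤ |A| := by
    have := min_le_right δ (|A| / (|B| + 1))
    rw [← ht0, le_div_iff₀ (by positivity)] at this
    exact this
  have h1 := h t0 (by rw [abs_of_pos ht0p]; exact min_le_left _ _)
  have h2 := h (-t0) (by rw [abs_neg, abs_of_pos ht0p]; exact min_le_left _ _)
  have h3 : B ≤ |B| := le_abs_self B
  have h4 : 2 * (t0 * |A|) ≤ t0 ^ 2 * B := by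
    rcases abs_cases A with h | h <;> rw [h.1] <;> nlinarith
  have h5 : 2 * |A| ≤ t0 * B := by
    have : t0 * (2 * |A|) ≤ t0 * (t0 * B) := by nlinarith
    exact le_of_mul_le_mul_left this ht0p
  nlinarith

lemma LocMin.ortho {v : ℂ → ℝ} {K : NNReal} {Λ R : ℝ} {c : ℂ} (h : LocMin v K Λ c R)
    {η : ℂ → ℝ} {K' : NNReal} {x : ℂ} {ρ C : ℝ} (hη : LipschitzWith K' η) (hρ : 0 < ρ)
    (hs : Metric.closedBall x ρ ⊆ Metric.closedBall c R)
    (hz : ∀ z, z ∉ Metric.closedBall x ρ → η z = 0) (hC : ∀ z, |η z| ≤ C * |v z|) :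
    ∫ z in Metric.closedBall x ρ, gdot v η z = 0 := by
  refine zero_of_quad (δ := 1 / (2 * (|C| + 1))) (B := ∫ z in Metric.closedBall x ρ, gdot η η z)
    (by positivity) fun t ht => ?_
  have := h.h2 (fun z => t * η z) (‖t‖₊ * K') x ρ (lip_cmul hη t) hρ hs
    (fun z hz' => by rw [hz z hz', mul_zero]) (fun z => ?_)
  · have e : ∀ z, gdot (fun z => t * η z) (fun z => t * η z) z = t ^ 2 * gdot η η z := by
      intro z; rw [gdot_const_mul, gdot_comm, gdot_const_mul]; ring
    simp_rw [e, gdot_const_mul, integral_const_mul] at this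
    exact this
  · rw [abs_mul]
    have h1 : |η z| ≤ (|C| + 1) * |v z| := (hC z).trans
      (mul_le_mul_of_nonneg_right (by linarith [le_abs_self C]) (abs_nonneg _))
    calc |t| * |η z| ≤ 1 / (2 * (|C| + 1)) * ((|C| + 1) * |v z|) :=
          mul_le_mul ht h1 (abs_nonneg _) (by positivity)
      _ = |v z| / 2 := by field_simp

lemma vol_closedBall (x : ℂ) {r : ℝ} (hr : 0 ≤ r) :
    volume.real (Metric.closedBall x r) = Real.pi * r ^ 2 := by
  rw [measureReal_def, Complex.volume_closedBall]
  simp [ENNReal.toReal_ofReal hr]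
  ring

lemma int_ball_le {f : ℂ → ℝ} {C : ℝ} (x : ℂ) {r : ℝ} (hr : 0 ≤ r) (hf : ∀ z, |f z| ≤ C) :
    |∫ z in Metric.closedBall x r, f z| ≤ C * (Real.pi * r ^ 2) := by
  have := norm_setIntegral_le_of_norm_le_const (μ := volume) (s := Metric.closedBall x r)
    (f := f) (C := C) (by simp [Complex.volume_closedBall, ENNReal.mul_lt_top]) (fun z _ => hf z)
  rwa [vol_closedBall x hr] at this

lemma cInt_const {v : ℂ → ℝ} {K : NNReal} (hv : LipschitzWith K v) (x : ℂ) {ρ : ℝ} (hρ : 0 ≤ ρ) :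
    |cInt v x ρ - 2 * Real.pi * v x| ≤ 2 * Real.pi * K * ρ := by
  have e : cInt v x ρ - 2 * Real.pi * v x =
      ∫ θ in (-Real.pi)..Real.pi, (v (circleMap x ρ θ) - v x) := by
    rw [intervalIntegral.integral_sub]
    · unfold cInt; simp only [intervalIntegral.integral_const, smul_eq_mul]; ring
    · exact (hv.continuous.comp (continuous_circleMap x ρ)).intervalIntegrable _ _
    · simp
  rw [e]
  refine (abs_ii_le (C := K * ρ) fun θ => ?_).trans (le_of_eq ?_)
  · have := hv.dist_le_mul (circleMap x ρ θ) x
    rw [Real.dist_eq, dist_eq_norm, circleMap_sub_center, norm_circleMap_zero, abs_of_nonneg hρ] at this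
    exact this
  · rw [sub_neg_eq_add, abs_of_pos (by linarith [Real.pi_pos])]; ring

lemma LocMin.dyadic {v : ℂ → ℝ} {K : NNReal} {Λ R : ℝ} {c : ℂ} (h : LocMin v K Λ c R)
    {x : ℂ} {b : ℝ} (hb : 0 < b) (hs : Metric.closedBall x b ⊆ Metric.closedBall c R) :
    |cInt v x (b / 2) - cInt v x b| ≤ b / 2 * (8 * Real.pi + Λ * Real.pi) := by
  have ha : 0 < b / 2 := by positivity
  have hηl := ltest_lip x (b := b) ha
  have hz : ∀ z, z ∉ Metric.closedBall x b → ltest x (b / 2) b z = 0 := by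
    intro z hz
    refine lprof_zero (by linarith) ?_
    rw [Metric.mem_closedBall, dist_eq_norm, not_le] at hz
    exact hz.le
  have key : ∀ t : ℝ, 0 ≤ 2 * (t * (cInt v x (b / 2) - cInt v x b)) + t ^ 2 * (8 * Real.pi) +
      Λ * (Real.pi * b ^ 2) := by
    intro t
    have := h.h1 (fun z => t * ltest x (b/2) b z) _ x b (lip_cmul hηl t) hb hs
      (fun z hz' => by rw [hz z hz', mul_zero])
    have e : ∀ z, gdot (fun z => t * ltest x (b/2) b z) (fun z => t * ltest x (b/2) b z) z
        = t ^ 2 * gdot (ltest x (b/2) b) (ltest x (b/2) b) z := by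
      intro z; rw [gdot_const_mul, gdot_comm, gdot_const_mul]; ring
    simp_rw [e, gdot_const_mul, integral_const_mul] at this
    rw [ltest_integral h.lip x ha (by linarith)] at this
    have h3 := int_ball_le x hb.le (fun z => abs_gdot_le hηl hηl z)
    rw [Real.coe_toNNReal _ (by positivity)] at h3
    have h4 : 2 * (1 / (b / 2)) * (1 / (b / 2)) * (Real.pi * b ^ 2) = 8 * Real.pi := by
      field_simp; norm_num
    rw [h4] at h3
    have h5 := mul_le_mul_of_nonneg_left ((le_abs_self _).trans h3) (sq_nonneg t)
    linarith
  have k1 := key b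
  have k2 := key (-b)
  rw [abs_le]
  constructor
  · have : 0 ≤ b * (2 * (cInt v x (b / 2) - cInt v x b) + b * (8 * Real.pi) + Λ * Real.pi * b) := by
      nlinarith
    have := nonneg_of_mul_nonneg_right this hb
    linarith
  · have : 0 ≤ b * (-2 * (cInt v x (b / 2) - cInt v x b) + b * (8 * Real.pi) + Λ * Real.pi * b) := by
      nlinarith
    have := nonneg_of_mul_nonneg_right this hb
    linarith

lemma LocMin.cInt_zero {v : ℂ → ℝ} {K : NNReal} {Λ R : ℝ} {c : ℂ} (h : LocMin v K Λ c R)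
    {x : ℂ} (hx : v x = 0) {b : ℝ} (hb : 0 < b)
    (hs : Metric.closedBall x b ⊆ Metric.closedBall c R) :
    |cInt v x b| ≤ (8 * Real.pi + Λ * Real.pi) * b := by
  have key : ∀ n : ℕ, ∀ b, 0 < b → Metric.closedBall x b ⊆ Metric.closedBall c R →
      |cInt v x b| ≤ (8 * Real.pi + Λ * Real.pi) * b + 2 * Real.pi * K * b * (1/2) ^ n := by
    intro n
    induction n with
    | zero =>
      intro b hb hs
      have := cInt_const h.lip x hb.le
      rw [hx, mul_zero, sub_zero] at this
      have := mul_nonneg h.hΛ Real.pi_pos.le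
      have := Real.pi_pos
      have : 0 ≤ (8 * Real.pi + Λ * Real.pi) * b := by positivity
      rw [pow_zero, mul_one]; linarith
    | succ n ih =>
      intro b hb hs
      have h1 := ih (b/2) (by positivity)
        ((Metric.closedBall_subset_closedBall (by linarith)).trans hs)
      have h2 := h.dyadic hb hs
      have h3 : |cInt v x b| ≤ |cInt v x (b/2)| + |cInt v x (b / 2) - cInt v x b| := by
        have := abs_sub (cInt v x (b/2)) (cInt v x (b / 2) - cInt v x b)
        simpa using this
      rw [pow_succ]
      linarith
  have ht : Filter.Tendsto (fun n : ℕ => (8 * Real.pi + Λ * Real.pi) * b +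
      2 * Real.pi * K * b * (1/2) ^ n) Filter.atTop (nhds ((8 * Real.pi + Λ * Real.pi) * b +
      2 * Real.pi * K * b * 0)) :=
    ((tendsto_pow_atTop_nhds_zero_of_lt_one (by norm_num) (by norm_num)).const_mul _).const_add _
  rw [mul_zero, add_zero] at ht
  exact ge_of_tendsto' ht (fun n => key n b hb hs)

lemma LocMin.cInt_free {v : ℂ → ℝ} {K : NNReal} {Λ R : ℝ} {c : ℂ} (h : LocMin v K Λ c R)
    {x : ℂ} {b : ℝ} (hb : 0 < b) (hs : Metric.closedBall x b ⊆ Metric.closedBall c R)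
    (hne : ∀ z ∈ Metric.closedBall x b, v z ≠ 0) :
    cInt v x b = 2 * Real.pi * v x := by
  obtain ⟨z0, hz0, hmin⟩ := (isCompact_closedBall x b).exists_isMinOn
    ⟨x, Metric.mem_closedBall_self hb.le⟩ (f := fun z => |v z|)
    (h.lip.continuous.abs.continuousOn)
  have hm : 0 < |v z0| := abs_pos.2 (hne z0 hz0)
  have key : ∀ a, 0 < a → a ≤ b → cInt v x a = cInt v x b := by
    intro a ha hab
    have hηl := ltest_lip x (b := b) ha
    have hz : ∀ z, z ∉ Metric.closedBall x b → ltest x a b z = 0 := by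
      intro z hz
      refine lprof_zero hab ?_
      rw [Metric.mem_closedBall, dist_eq_norm, not_le] at hz
      exact hz.le
    have hbd : ∀ z ∈ Metric.closedBall x b, |ltest x a b z| ≤ 1 / a * b := by
      intro z hz
      have := (lprof_lip (b := b) ha).dist_le_mul ‖z - x‖ b
      rw [lprof_zero hab le_rfl, dist_zero_right, Real.norm_eq_abs,
        Real.coe_toNNReal _ (by positivity)] at this
      refine this.trans (mul_le_mul_of_nonneg_left ?_ (by positivity))
      rw [Metric.mem_closedBall, dist_eq_norm] at hz
      rw [Real.dist_eq, abs_le]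
      constructor <;> linarith [norm_nonneg (z - x)]
    have := h.ortho (C := 1 / a * b / |v z0|) hηl hb hs hz (fun z => ?_)
    · rw [ltest_integral h.lip x ha hab] at this
      linarith
    · by_cases hzb : z ∈ Metric.closedBall x b
      · refine (hbd z hzb).trans ?_
        rw [div_mul_eq_mul_div (1 / a * b) |v z0| |v z|, le_div_iff₀ hm]
        exact mul_le_mul_of_nonneg_left (hmin hzb) (by positivity)
      · rw [hz z hzb, abs_zero]; positivity
  have ht : ∀ a, 0 < a → a ≤ b → |cInt v x b - 2 * Real.pi * v x| ≤ 2 * Real.pi * K * a := by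
    intro a ha hab
    rw [← key a ha hab]; exact cInt_const h.lip x ha.le
  by_contra hcon
  have hp : 0 < |cInt v x b - 2 * Real.pi * v x| := abs_pos.2 (sub_ne_zero.2 hcon)
  set D := |cInt v x b - 2 * Real.pi * v x|
  have hpi := Real.pi_pos
  have hK : (0:ℝ) ≤ K := K.2
  have hL : 0 < 2 * Real.pi * K + 1 := by positivity
  have := ht (min b (D / (2 * (2 * Real.pi * K + 1)))) (lt_min hb (by positivity)) (min_le_left _ _)
  have h2 : 2 * Real.pi * K * min b (D / (2 * (2 * Real.pi * K + 1))) ≤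
      (2 * Real.pi * K + 1) * (D / (2 * (2 * Real.pi * K + 1))) :=
    mul_le_mul (by linarith) (min_le_right _ _) (le_min hb.le (by positivity)) hL.le
  have h3 : (2 * Real.pi * K + 1) * (D / (2 * (2 * Real.pi * K + 1))) = D / 2 := by
    field_simp
  linarith

/-- cone-shaped averaging kernel -/
def kern (a : ℝ) (z : ℂ) : ℝ := 3 / (Real.pi * a ^ 2) * max (1 - ‖z‖ / a) 0

lemma kern_nonneg (a : ℝ) (z : ℂ) : 0 ≤ kern a z := by
  unfold kern; have := Real.pi_pos; positivity

lemma kern_le {a : ℝ} (ha : 0 < a) (z : ℂ) : kern a z ≤ 3 / (Real.pi * a ^ 2) := by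
  unfold kern
  have := Real.pi_pos
  refine mul_le_of_le_one_right (by positivity) (max_le ?_ zero_le_one)
  have : 0 ≤ ‖z‖ / a := by positivity
  linarith

lemma kern_cont (a : ℝ) : Continuous (kern a) := by
  unfold kern; fun_prop

lemma kern_lip {a : ℝ} (ha : 0 < a) (z w : ℂ) :
    |kern a z - kern a w| ≤ 3 / (Real.pi * a ^ 3) * ‖z - w‖ := by
  unfold kern
  have := Real.pi_pos
  rw [← mul_sub, abs_mul, abs_of_nonneg (by positivity)]
  have h1 : |max (1 - ‖z‖ / a) 0 - max (1 - ‖w‖ / a) 0| ≤ ‖z - w‖ / a := by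
    refine (abs_max_sub_max_le_abs _ _ _).trans ?_
    rw [show 1 - ‖z‖ / a - (1 - ‖w‖ / a) = (‖w‖ - ‖z‖) / a by ring, abs_div, abs_of_pos ha]
    refine div_le_div_of_nonneg_right ?_ ha.le
    rw [norm_sub_rev]; exact abs_norm_sub_norm_le w z
  calc _ ≤ 3 / (Real.pi * a ^ 2) * (‖z - w‖ / a) := mul_le_mul_of_nonneg_left h1 (by positivity)
    _ = _ := by field_simp

lemma kern_zero {a : ℝ} (ha : 0 < a) {z : ℂ} (hz : a ≤ ‖z‖) : kern a z = 0 := by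
  unfold kern
  have : 1 ≤ ‖z‖ / a := by rw [le_div_iff₀ ha]; linarith
  rw [max_eq_right (by linarith), mul_zero]

lemma kern_mean {f : ℂ → ℝ} (hf : Continuous f) {y : ℂ} {a m : ℝ} (ha : 0 < a)
    (hm : ∀ ρ, 0 < ρ → ρ ≤ a → cInt f y ρ = 2 * Real.pi * m) :
    ∫ z in Metric.closedBall y a, f z * kern a (z - y) = m := by
  have hpi := Real.pi_pos
  have hcont : Continuous fun z => f z * kern a (z - y) :=
    hf.mul ((kern_cont a).comp (continuous_id.sub continuous_const))
  obtain ⟨C, hC⟩ := (isCompact_closedBall y a).exists_bound_of_continuousOn hcont.continuousOn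
  rw [polar_integral hcont.measurable y ha.le (C := C) hC]
  have : ∫ ρ in (0:ℝ)..a, ρ * ∫ θ in (-Real.pi)..Real.pi,
      f (circleMap y ρ θ) * kern a (circleMap y ρ θ - y) =
      ∫ ρ in (0:ℝ)..a, (6 * m / a ^ 2) * (ρ - ρ ^ 2 / a) := by
    refine intervalIntegral.integral_congr_ae (Filter.Eventually.of_forall fun ρ hρ => ?_)
    rw [uIoc_of_le ha.le] at hρ
    have e : ∀ θ, kern a (circleMap y ρ θ - y) = 3 / (Real.pi * a ^ 2) * (1 - ρ / a) := by
      intro θ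
      unfold kern
      rw [circleMap_sub_center, norm_circleMap_zero, abs_of_pos hρ.1, max_eq_left]
      have : ρ / a ≤ 1 := by rw [div_le_iff₀ ha]; linarith [hρ.2]
      linarith
    simp_rw [e]
    rw [intervalIntegral.integral_mul_const]
    have := hm ρ hρ.1 hρ.2
    unfold cInt at this
    rw [this]
    field_simp
    ring
  rw [this, intervalIntegral.integral_const_mul, intervalIntegral.integral_sub (by simp)
    (by apply Continuous.intervalIntegrable; fun_prop), intervalIntegral.integral_div,
    integral_pow, integral_id]
  field_simp
  ring

lemma kern_mean' {f : ℂ → ℝ} (hf : Continuous f) {x y : ℂ} {a d m : ℝ} (ha : 0 < a)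
    (hsub : Metric.closedBall y a ⊆ Metric.closedBall x d)
    (hm : ∀ ρ, 0 < ρ → ρ ≤ a → cInt f y ρ = 2 * Real.pi * m) :
    ∫ z in Metric.closedBall x d, f z * kern a (z - y) = m := by
  rw [← kern_mean hf ha hm]
  refine setIntegral_eq_of_subset_of_forall_sdiff_eq_zero measurableSet_closedBall hsub ?_
  intro z hz
  rw [kern_zero ha, mul_zero]
  have := hz.2
  rw [Metric.mem_closedBall, dist_eq_norm, not_le] at this
  exact this.le

lemma cInt_one (k : ℝ) (y : ℂ) (ρ : ℝ) : cInt (fun _ => k) y ρ = 2 * Real.pi * k := by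
  unfold cInt; simp only [intervalIntegral.integral_const, smul_eq_mul]; ring

lemma LocMin.point_bound {v : ℂ → ℝ} {K : NNReal} {Λ R : ℝ} {c : ℂ} (h : LocMin v K Λ c R)
    {x y : ℂ} {a d : ℝ} (ha : 0 < a) (hsub : Metric.closedBall y a ⊆ Metric.closedBall x d)
    (hs : Metric.closedBall y a ⊆ Metric.closedBall c R)
    (hne : ∀ z ∈ Metric.closedBall y a, v z ≠ 0) :
    |v y| ≤ 3 / (Real.pi * a ^ 2) * ∫ z in Metric.closedBall x d, |v z| := by
  have hc := h.lip.continuous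
  have := kern_mean' hc (m := v y) ha hsub (fun ρ h0 hρ =>
    h.cInt_free h0 ((Metric.closedBall_subset_closedBall hρ).trans hs)
      (fun z hz => hne z (Metric.closedBall_subset_closedBall hρ hz)))
  rw [← this, ← integral_const_mul]
  refine (abs_integral_le_integral_abs).trans ?_
  refine integral_mono_of_nonneg (Filter.Eventually.of_forall fun z => abs_nonneg _) ?_
    (Filter.Eventually.of_forall fun z => ?_)
  · exact (continuous_const.mul hc.abs).continuousOn.integrableOn_compact (isCompact_closedBall x d)
  · change |v z * kern a (z - y)| ≤ _
    rw [abs_mul, abs_of_nonneg (kern_nonneg _ _), mul_comm]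
    exact mul_le_mul_of_nonneg_right (kern_le ha _) (abs_nonneg _)

lemma LocMin.diff_bound {v : ℂ → ℝ} {K : NNReal} {Λ R : ℝ} {c : ℂ} (h : LocMin v K Λ c R)
    {x y : ℂ} {d : ℝ} (hd : 0 < d) (hxy : ‖y - x‖ ≤ d / 2)
    (hs : Metric.closedBall x d ⊆ Metric.closedBall c R)
    (hne : ∀ z ∈ Metric.closedBall x d, v z ≠ 0) (k : ℝ) :
    |v y - v x| ≤ 24 / (Real.pi * d ^ 3) * ‖y - x‖ * ∫ z in Metric.closedBall x d, |v z - k| := by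
  have hc := h.lip.continuous
  have ha : 0 < d / 2 := by positivity
  have hfree : ∀ w, Metric.closedBall w (d/2) ⊆ Metric.closedBall x d →
      ∫ z in Metric.closedBall x d, (v z - k) * kern (d/2) (z - w) = v w - k := by
    intro w hw
    refine kern_mean' (f := fun z => v z - k) (hc.sub continuous_const) ha hw (fun ρ h0 hρ => ?_)
    have h1 := h.cInt_free h0 ((Metric.closedBall_subset_closedBall hρ).trans (hw.trans hs))
      (fun z hz => hne z (hw (Metric.closedBall_subset_closedBall hρ hz)))
    have h2 := cInt_one k w ρ
    unfold cInt at h1 h2 ⊢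
    rw [intervalIntegral.integral_sub, h1]
    on_goal 1 => rw [h2]
    · ring
    · exact (hc.comp (continuous_circleMap w ρ)).intervalIntegrable _ _
    · simp
  have hy := hfree y (Metric.closedBall_subset_closedBall' (by rw [dist_eq_norm]; linarith))
  have hx := hfree x (Metric.closedBall_subset_closedBall (by linarith))
  have hintg : ∀ w, IntegrableOn (fun z => (v z - k) * kern (d/2) (z - w)) (Metric.closedBall x d) :=
    fun w => (((hc.sub continuous_const).mul ((kern_cont _).comp
      (continuous_id.sub continuous_const))).continuousOn).integrableOn_compact
      (isCompact_closedBall x d)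
  have e : v y - v x = ∫ z in Metric.closedBall x d,
      ((v z - k) * kern (d/2) (z - y) - (v z - k) * kern (d/2) (z - x)) := by
    rw [integral_sub (hintg y) (hintg x), hy, hx]; ring
  rw [e, ← integral_const_mul]
  refine (abs_integral_le_integral_abs).trans ?_
  refine integral_mono_of_nonneg (Filter.Eventually.of_forall fun z => abs_nonneg _) ?_
    (Filter.Eventually.of_forall fun z => ?_)
  · exact (continuous_const.mul (hc.sub continuous_const).abs).continuousOn.integrableOn_compact
      (isCompact_closedBall x d)
  · change |(v z - k) * kern (d/2) (z - y) - (v z - k) * kern (d/2) (z - x)| ≤ _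
    rw [← mul_sub, abs_mul, mul_comm]
    refine mul_le_mul_of_nonneg_right ?_ (abs_nonneg _)
    refine (kern_lip ha _ _).trans (le_of_eq ?_)
    rw [show z - y - (z - x) = x - y by ring, norm_sub_rev]
    have := Real.pi_pos
    field_simp
    ring

def acfA (v : ℂ → ℝ) (x : ℂ) (ρ : ℝ) : ℝ :=
  ∫ θ in (-Real.pi)..Real.pi, pos (v (circleMap x ρ θ)) * gdot v v (circleMap x ρ θ)
def acfB (v : ℂ → ℝ) (x : ℂ) (ρ : ℝ) : ℝ :=
  ∫ θ in (-Real.pi)..Real.pi, max (v (circleMap x ρ θ)) 0 * dR v (circleMap x ρ θ) θ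
def acfE (v : ℂ → ℝ) (x : ℂ) (r : ℝ) : ℝ := ∫ ρ in (0:ℝ)..r, ρ * acfA v x ρ

lemma neg_pi_le_pi : -Real.pi ≤ Real.pi := by linarith [Real.pi_pos]

lemma meas_param {F : ℝ × ℝ → ℝ} (hF : Measurable F) :
    Measurable fun ρ => ∫ θ in (-Real.pi)..Real.pi, F (ρ, θ) := by
  simp_rw [intervalIntegral.integral_of_le neg_pi_le_pi]
  exact (hF.stronglyMeasurable.integral_prod_right').measurable

lemma meas_circ {f : ℂ → ℝ} (hf : Measurable f) (x : ℂ) :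
    Measurable fun p : ℝ × ℝ => f (circleMap x p.1 p.2) :=
  hf.comp (continuous_circleMap2 x).measurable

lemma meas_acfA {v : ℂ → ℝ} {K : NNReal} (hv : LipschitzWith K v) (x : ℂ) :
    Measurable (acfA v x) :=
  meas_param (F := fun p => pos (v (circleMap x p.1 p.2)) * gdot v v (circleMap x p.1 p.2))
    (meas_circ (f := fun z => pos (v z) * gdot v v z)
      ((measurable_pos.comp hv.continuous.measurable).mul (measurable_gdot v v)) x)

lemma meas_acfB {v : ℂ → ℝ} {K : NNReal} (hv : LipschitzWith K v) (x : ℂ) :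
    Measurable (acfB v x) :=
  meas_param (F := fun p => max (v (circleMap x p.1 p.2)) 0 * dR v (circleMap x p.1 p.2) p.2)
    ((meas_circ (f := fun z => max (v z) 0)
      (hv.continuous.measurable.max measurable_const) x).mul (measurable_dR2 v x))

lemma pos_gdot_le {v : ℂ → ℝ} {K : NNReal} (hv : LipschitzWith K v) (z : ℂ) :
    |pos (v z) * gdot v v z| ≤ 2 * K * K := by
  rw [abs_mul]
  have h1 := abs_gdot_le hv hv z
  have h2 := abs_pos_le (v z)
  nlinarith [abs_nonneg (gdot v v z), abs_nonneg (pos (v z))]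

lemma acfA_nonneg (v : ℂ → ℝ) (x : ℂ) (ρ : ℝ) : 0 ≤ acfA v x ρ :=
  intervalIntegral.integral_nonneg neg_pi_le_pi
    (fun _ _ => mul_nonneg (pos_nonneg _) (gdot_self_nonneg _ _))

lemma acfA_le {v : ℂ → ℝ} {K : NNReal} (hv : LipschitzWith K v) (x : ℂ) (ρ : ℝ) :
    |acfA v x ρ| ≤ 2 * K * K * |Real.pi - -Real.pi| :=
  abs_ii_le (fun _ => pos_gdot_le hv _)

lemma abs_le_of_uIoc {c d ρ : ℝ} (hρ : ρ ∈ uIoc c d) : |ρ| ≤ |c| + |d| := by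
  have := abs_le_max_abs_abs hρ.1.le hρ.2
  refine this.trans ?_
  have k1 := abs_nonneg c
  have k2 := abs_nonneg d
  refine max_le ?_ ?_
  · rcases min_cases c d with h | h <;> rw [h.1] <;> linarith
  · rcases max_cases c d with h | h <;> rw [h.1] <;> linarith

lemma ii_acfA {v : ℂ → ℝ} {K : NNReal} (hv : LipschitzWith K v) (x : ℂ) (c d : ℝ) :
    IntervalIntegrable (fun ρ => ρ * acfA v x ρ) volume c d := by
  refine ii_of_bdd (measurable_id.mul (meas_acfA hv x))
    (C := (|c| + |d|) * (2 * K * K * |Real.pi - -Real.pi|)) (fun ρ hρ => ?_)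
  change |ρ * acfA v x ρ| ≤ _
  rw [abs_mul]
  exact mul_le_mul (abs_le_of_uIoc hρ) (acfA_le hv x ρ) (abs_nonneg _) (by positivity)

lemma max_v_le {v : ℂ → ℝ} {K : NNReal} (hv : LipschitzWith K v) (x z : ℂ) :
    max (v z) 0 ≤ |v x| + K * ‖z - x‖ := by
  have := hv.dist_le_mul z x
  rw [Real.dist_eq, dist_eq_norm] at this
  have h1 := le_abs_self (v z - v x)
  have h2 := le_abs_self (v x)
  have : (0:ℝ) ≤ K * ‖z - x‖ := by positivity
  exact max_le (by linarith) (by positivity)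

lemma acfB_le {v : ℂ → ℝ} {K : NNReal} (hv : LipschitzWith K v) (x : ℂ) (ρ : ℝ) :
    |acfB v x ρ| ≤ (|v x| + K * |ρ|) * (2 * K) * |Real.pi - -Real.pi| := by
  refine abs_ii_le (fun θ => ?_)
  rw [abs_mul]
  refine mul_le_mul ?_ (abs_dR_le hv _ _) (abs_nonneg _) (by positivity)
  rw [abs_of_nonneg (le_max_right _ _)]
  have := max_v_le hv x (circleMap x ρ θ)
  rwa [circleMap_sub_center, norm_circleMap_zero] at this

lemma ii_acfB {v : ℂ → ℝ} {K : NNReal} (hv : LipschitzWith K v) (x : ℂ) (c d : ℝ) :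
    IntervalIntegrable (fun ρ => ρ * acfB v x ρ) volume c d := by
  refine ii_of_bdd (measurable_id.mul (meas_acfB hv x))
    (C := (|c| + |d|) * ((|v x| + K * (|c| + |d|)) * (2 * K) * |Real.pi - -Real.pi|)) (fun ρ hρ => ?_)
  change |ρ * acfB v x ρ| ≤ _
  rw [abs_mul]
  have h := abs_le_of_uIoc hρ
  refine mul_le_mul h ((acfB_le hv x ρ).trans ?_) (abs_nonneg _) (by positivity)
  gcongr

lemma ae_ne (c : ℝ) : ∀ᵐ θ : ℝ, θ ≠ c := by simp [ae_iff, measure_singleton]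

/-- congruence of circle integrals from a.e. statement -/
lemma circ_congr {f g : ℝ → ℝ} (h : ∀ᵐ θ : ℝ, θ ∈ Ioo (-Real.pi) Real.pi → f θ = g θ) :
    ∫ θ in (-Real.pi)..Real.pi, f θ = ∫ θ in (-Real.pi)..Real.pi, g θ := by
  refine intervalIntegral.integral_congr_ae ?_
  filter_upwards [h, ae_ne Real.pi] with θ h1 h2 h3
  rw [uIoc_of_le neg_pi_le_pi] at h3
  exact h1 ⟨h3.1, lt_of_le_of_ne h3.2 h2⟩

def zprof (a b t : ℝ) : ℝ := max 0 (min (b - a) (b - t))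

lemma zprof_lip (a b : ℝ) : LipschitzWith 1 (zprof a b) := by
  have : LipschitzWith 1 (fun t : ℝ => b - t) := by
    refine LipschitzWith.of_dist_le_mul fun s t => ?_
    rw [dist_sub_left, NNReal.coe_one, one_mul]
  exact (this.const_min (b - a)).const_max 0

lemma zprof_nonneg (a b t : ℝ) : 0 ≤ zprof a b t := le_max_left _ _
lemma zprof_le {a b t : ℝ} (hab : a ≤ b) : zprof a b t ≤ b - a :=
  max_le (by linarith) (min_le_left _ _)
lemma zprof_out {a b t : ℝ} (ht : b ≤ t) : zprof a b t = 0 :=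
  max_eq_left ((min_le_right _ _).trans (by linarith))
lemma zprof_in {a b t : ℝ} (hab : a ≤ b) (ht : t ≤ a) : zprof a b t = b - a := by
  unfold zprof; rw [min_eq_left (by linarith), max_eq_right (by linarith)]
lemma zprof_deriv_in {a b t : ℝ} (hab : a ≤ b) (ht : t < a) : HasDerivAt (zprof a b) 0 t := by
  refine (hasDerivAt_const t (b - a)).congr_of_eventuallyEq ?_
  filter_upwards [gt_mem_nhds ht] with s hs using zprof_in hab hs.le
lemma zprof_deriv_mid {a b t : ℝ} (h1 : a < t) (h2 : t < b) : HasDerivAt (zprof a b) (-1) t := by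
  refine ((hasDerivAt_id t).const_sub b).congr_of_eventuallyEq ?_
  filter_upwards [lt_mem_nhds h1, gt_mem_nhds h2] with s hs hs2
  unfold zprof
  rw [min_eq_right (by linarith), max_eq_right (by linarith)]; rfl

def ztest (v : ℂ → ℝ) (x : ℂ) (a b : ℝ) (z : ℂ) : ℝ := max (v z) 0 * zprof a b ‖z - x‖

lemma ztest_lip {v : ℂ → ℝ} {K : NNReal} (hv : LipschitzWith K v) (x : ℂ) {a b : ℝ}
    (ha : 0 < a) (hab : a ≤ b) : ∃ K', LipschitzWith K' (ztest v x a b) := by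
  have hb : 0 < b := ha.trans_le hab
  set N : ℝ := |v x| + K * b with hN
  have hN0 : 0 ≤ N := by positivity
  have e : ztest v x a b = fun z => min (max (v z) 0) N * zprof a b ‖z - x‖ := by
    ext1 z
    unfold ztest
    rcases le_total b ‖z - x‖ with h | h
    · rw [zprof_out h, mul_zero, mul_zero]
    · rw [min_eq_left]
      refine (max_v_le hv x z).trans ?_
      rw [hN]
      gcongr
  have hf : LipschitzWith K (fun z => min (max (v z) 0) N) := (hv.max_const 0).min_const N
  have hg : LipschitzWith 1 (fun z : ℂ => zprof a b ‖z - x‖) := by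
    have := (zprof_lip a b).comp (lip_norm_sub x)
    rwa [mul_one] at this
  refine ⟨(N + b * K).toNNReal, ?_⟩
  rw [e]
  refine LipschitzWith.of_dist_le_mul fun z w => ?_
  rw [Real.coe_toNNReal _ (by positivity), Real.dist_eq]
  have h1 := hf.dist_le_mul z w
  have h2 := hg.dist_le_mul z w
  rw [Real.dist_eq] at h1 h2
  rw [NNReal.coe_one, one_mul] at h2
  set f1 := min (max (v z) 0) N
  set f2 := min (max (v w) 0) N
  set g1 := zprof a b ‖z - x‖
  set g2 := zprof a b ‖w - x‖
  have h3 : |f1| ≤ N := by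
    rw [abs_of_nonneg (le_min (le_max_right _ _) hN0)]; exact min_le_right _ _
  have h4 : |g2| ≤ b := by
    rw [abs_of_nonneg (zprof_nonneg _ _ _)]; exact (zprof_le hab).trans (by linarith)
  calc |f1 * g1 - f2 * g2| = |f1 * (g1 - g2) + g2 * (f1 - f2)| := by congr 1; ring
    _ ≤ |f1| * |g1 - g2| + |g2| * |f1 - f2| := by
        refine (abs_add_le _ _).trans ?_; rw [abs_mul, abs_mul]
    _ ≤ N * dist z w + b * (K * dist z w) := by gcongr
    _ = _ := by ring

lemma fderiv_of_min {f : ℂ → ℝ} {z : ℂ} (h0 : ∀ w, 0 ≤ f w) (hz : f z = 0) : fderiv ℝ f z = 0 := by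
  apply IsLocalMin.fderiv_eq_zero
  exact Filter.Eventually.of_forall fun w => by rw [hz]; exact h0 w

lemma ztest_gdot {v : ℂ → ℝ} {x : ℂ} {a b ρ θ f' : ℝ} (hρ : 0 < ρ)
    (hvc : Continuous v)
    (hv : DifferentiableAt ℝ v (circleMap x ρ θ))
    (hη : DifferentiableAt ℝ (ztest v x a b) (circleMap x ρ θ))
    (hf : HasDerivAt (zprof a b) f' ρ) :
    gdot v (ztest v x a b) (circleMap x ρ θ) =
      zprof a b ρ * (pos (v (circleMap x ρ θ)) * gdot v v (circleMap x ρ θ)) +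
      f' * (max (v (circleMap x ρ θ)) 0 * dR v (circleMap x ρ θ) θ) := by
  set z := circleMap x ρ θ with hz
  by_cases hp : 0 < v z
  · have hev : ∀ᶠ w in nhds z, 0 < v w := hvc.continuousAt.eventually (lt_mem_nhds hp)
    have h1 := hasDerivAt_radial hη
    have h2 := hasDerivAt_angular hη
    have v1 := hasDerivAt_radial hv
    have v2 := hasDerivAt_angular hv
    have c1 : ContinuousAt (fun ρ => circleMap x ρ θ) ρ := by
      unfold circleMap; fun_prop
    have c2 : ContinuousAt (fun θ => circleMap x ρ θ) θ := (continuous_circleMap x ρ).continuousAt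
    have e1 := (v1.mul hf).congr_of_eventuallyEq (f₁ := fun ρ => ztest v x a b (circleMap x ρ θ)) (by
      filter_upwards [lt_mem_nhds hρ, c1.eventually hev] with t ht ht2
      simp only [Pi.mul_apply]
      unfold ztest
      rw [circleMap_sub_center, norm_circleMap_zero, abs_of_pos ht, max_eq_left ht2.le])
    have e2 := (v2.mul_const (zprof a b ρ)).congr_of_eventuallyEq
      (f₁ := fun θ => ztest v x a b (circleMap x ρ θ)) (by
      filter_upwards [c2.eventually hev] with t ht2
      unfold ztest
      rw [circleMap_sub_center, norm_circleMap_zero, abs_of_pos hρ, max_eq_left ht2.le])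
    have k1 := h1.unique e1
    have k2 := h2.unique e2
    rw [← hz] at k1 k2
    have k3 : dT (ztest v x a b) z θ = dT v z θ * zprof a b ρ := by
      have : ρ * dT (ztest v x a b) z θ = ρ * (dT v z θ * zprof a b ρ) := by rw [k2]; ring
      exact mul_left_cancel₀ hρ.ne' this
    rw [gdot_polar v _ z θ, k1, k3, ← dR_sq_add_dT_sq v z θ, max_eq_left hp.le]
    simp only [pos, hp, if_true]
    ring
  · have h0 : fderiv ℝ (ztest v x a b) z = 0 := by
      refine fderiv_of_min (fun w => mul_nonneg (le_max_right _ _) (zprof_nonneg _ _ _)) ?_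
      unfold ztest; rw [max_eq_right (not_lt.1 hp), zero_mul]
    unfold gdot
    rw [h0, max_eq_right (not_lt.1 hp)]
    simp [pos, hp]

lemma meas_v_circ {v : ℂ → ℝ} (hv : Continuous v) (x : ℂ) (ρ : ℝ) :
    Measurable fun θ => v (circleMap x ρ θ) :=
  (hv.comp (continuous_circleMap x ρ)).measurable

lemma ii_circA {v : ℂ → ℝ} {K : NNReal} (hv : LipschitzWith K v) (x : ℂ) (ρ : ℝ) :
    IntervalIntegrable (fun θ => pos (v (circleMap x ρ θ)) *
      gdot v v (circleMap x ρ θ)) volume (-Real.pi) Real.pi := by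
  refine ii_of_bdd ?_ (fun θ _ => pos_gdot_le hv _)
  have m2 : Measurable fun θ : ℝ => gdot v v (circleMap x ρ θ) :=
    (measurable_gdot v v).comp (continuous_circleMap x ρ).measurable
  exact (measurable_pos.comp (meas_v_circ hv.continuous x ρ)).mul m2

lemma meas_dR_circ (v : ℂ → ℝ) (x : ℂ) (ρ : ℝ) :
    Measurable fun θ : ℝ => dR v (circleMap x ρ θ) θ := by
  have hc := (continuous_circleMap x ρ).measurable
  have h1 := (measurable_fderiv_apply_const ℝ v 1).comp hc
  have h2 := (measurable_fderiv_apply_const ℝ v Complex.I).comp hc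
  exact (h1.mul Real.measurable_cos).add (h2.mul Real.measurable_sin)

lemma meas_dT_circ (v : ℂ → ℝ) (x : ℂ) (ρ : ℝ) :
    Measurable fun θ : ℝ => dT v (circleMap x ρ θ) θ := by
  have hc := (continuous_circleMap x ρ).measurable
  have h1 := (measurable_fderiv_apply_const ℝ v 1).comp hc
  have h2 := (measurable_fderiv_apply_const ℝ v Complex.I).comp hc
  exact (h1.neg.mul Real.measurable_sin).add (h2.mul Real.measurable_cos)

lemma ii_circB {v : ℂ → ℝ} {K : NNReal} (hv : LipschitzWith K v) (x : ℂ) (ρ : ℝ) :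
    IntervalIntegrable (fun θ => max (v (circleMap x ρ θ)) 0 *
      dR v (circleMap x ρ θ) θ) volume (-Real.pi) Real.pi := by
  refine ii_of_bdd (C := (|v x| + K * |ρ|) * (2 * K)) ?_ (fun θ _ => ?_)
  · exact ((meas_v_circ hv.continuous x ρ).max measurable_const).mul (meas_dR_circ v x ρ)
  · rw [abs_mul]
    refine mul_le_mul ?_ (abs_dR_le hv _ _) (abs_nonneg _) (by positivity)
    rw [abs_of_nonneg (le_max_right _ _)]
    have := max_v_le hv x (circleMap x ρ θ)
    rwa [circleMap_sub_center, norm_circleMap_zero] at this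

lemma LocMin.acf1 {v : ℂ → ℝ} {K : NNReal} {Λ R : ℝ} {c : ℂ} (h : LocMin v K Λ c R)
    {x : ℂ} {a b : ℝ} (ha : 0 < a) (hab : a < b)
    (hs : Metric.closedBall x b ⊆ Metric.closedBall c R) :
    (b - a) * acfE v x a ≤ ∫ ρ in a..b, ρ * acfB v x ρ := by
  have hb : 0 < b := ha.trans hab
  obtain ⟨K', hηl⟩ := ztest_lip h.lip x ha hab.le
  have hpi := Real.pi_pos
  have hor := h.ortho (C := b) hηl hb hs (fun z hz => by
      rw [Metric.mem_closedBall, dist_eq_norm, not_le] at hz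
      unfold ztest; rw [zprof_out hz.le, mul_zero]) (fun z => by
      unfold ztest
      rw [abs_mul, mul_comm, abs_of_nonneg (zprof_nonneg _ _ _)]
      refine mul_le_mul ((zprof_le hab.le).trans (by linarith)) ?_ (abs_nonneg _) hb.le
      rw [abs_of_nonneg (le_max_right _ _)]
      exact max_le (le_abs_self _) (abs_nonneg _))
  rw [polar_integral (measurable_gdot _ _) x hb.le (fun z _ => abs_gdot_le h.lip hηl z)] at hor
  have hiA := ii_circA h.lip x
  have hiB := ii_circB h.lip x
  have key : ∀ᵐ ρ : ℝ, 0 < ρ → ∀ f', HasDerivAt (zprof a b) f' ρ →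
      ∫ θ in (-Real.pi)..Real.pi, gdot v (ztest v x a b) (circleMap x ρ θ) =
      zprof a b ρ * acfA v x ρ + f' * acfB v x ρ := by
    filter_upwards [polar_ae hηl.ae_differentiableAt x, polar_ae h.lip.ae_differentiableAt x]
      with ρ hρ hρ2 h0 f' hf'
    unfold acfA acfB
    rw [← intervalIntegral.integral_const_mul, ← intervalIntegral.integral_const_mul,
      ← intervalIntegral.integral_add ((hiA ρ).const_mul _) ((hiB ρ).const_mul _)]
    refine circ_congr ?_
    filter_upwards [hρ h0, hρ2 h0] with θ h1 h2 hm
    exact ztest_gdot h0 h.lip.continuous (h2 hm) (h1 hm) hf'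
  set G : ℝ → ℝ := fun ρ => ρ * ∫ θ in (-Real.pi)..Real.pi,
    gdot v (ztest v x a b) (circleMap x ρ θ) with hG
  have hGi : ∀ c d, IntervalIntegrable G volume c d := by
    intro c d
    refine ii_of_bdd (measurable_id.mul (meas_param (F := fun p => gdot v (ztest v x a b)
      (circleMap x p.1 p.2)) (meas_circ (measurable_gdot _ _) x)))
      (C := (|c| + |d|) * (2 * K * K' * |Real.pi - -Real.pi|)) (fun ρ hρ => ?_)
    change |ρ * _| ≤ _
    rw [abs_mul]
    exact mul_le_mul (abs_le_of_uIoc hρ) (abs_ii_le (fun _ => abs_gdot_le h.lip hηl _))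
      (abs_nonneg _) (by positivity)
  have i1 : ∫ ρ in (0:ℝ)..a, G ρ = (b - a) * acfE v x a := by
    unfold acfE
    rw [← intervalIntegral.integral_const_mul]
    refine intervalIntegral.integral_congr_ae ?_
    filter_upwards [key, ae_ne a] with ρ hk hn hm
    rw [uIoc_of_le ha.le] at hm
    have hlt := lt_of_le_of_ne hm.2 hn
    rw [hG]; dsimp only
    rw [hk hm.1 0 (zprof_deriv_in hab.le hlt), zprof_in hab.le hm.2]
    ring
  have i2 : - ∫ ρ in a..b, ρ * acfB v x ρ ≤ ∫ ρ in a..b, G ρ := by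
    rw [← intervalIntegral.integral_neg]
    refine intervalIntegral.integral_mono_ae_restrict hab.le (ii_acfB h.lip x a b).neg (hGi a b) ?_
    refine (ae_restrict_iff' measurableSet_Icc).2 ?_
    filter_upwards [key, ae_ne a, ae_ne b] with ρ hk hna hnb hm
    have h1 : a < ρ := lt_of_le_of_ne hm.1 (Ne.symm hna)
    have h2 : ρ < b := lt_of_le_of_ne hm.2 hnb
    have h0 : 0 < ρ := ha.trans h1
    simp only [hG]
    rw [hk h0 (-1) (zprof_deriv_mid h1 h2)]
    have : 0 ≤ ρ * (zprof a b ρ * acfA v x ρ) :=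
      mul_nonneg h0.le (mul_nonneg (zprof_nonneg _ _ _) (acfA_nonneg _ _ _))
    linarith
  have i3 := intervalIntegral.integral_add_adjacent_intervals (hGi 0 a) (hGi a b)
  have i4 : ∫ ρ in (0:ℝ)..b, G ρ = 0 := hor
  linarith

lemma LocMin.acf2 {v : ℂ → ℝ} {K : NNReal} {Λ R : ℝ} {c : ℂ} (h : LocMin v K Λ c R)
    {x : ℂ} {R' : ℝ} (hR' : 0 < R')
    (hs : Metric.closedBall x R' ⊆ Metric.closedBall c R) :
    ∀ᵐ ρ : ℝ, 0 < ρ → ρ < R' → acfE v x ρ ≤ ρ * acfB v x ρ := by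
  filter_upwards [(ii_acfB h.lip x 0 R').ae_hasDerivAt_integral] with ρ hρ h0 hρR
  have hd := hρ (by rw [uIcc_of_le hR'.le]; exact ⟨h0.le, hρR.le⟩) 0 left_mem_uIcc
  have ht := hd.tendsto_slope_zero_right
  refine ge_of_tendsto ht ?_
  have : Ioo 0 (R' - ρ) ∈ nhdsWithin (0:ℝ) (Ioi 0) := Ioo_mem_nhdsGT (by linarith)
  filter_upwards [this] with t ht
  rw [intervalIntegral.integral_interval_sub_left (ii_acfB h.lip x _ _) (ii_acfB h.lip x _ _)]
  have h1 := h.acf1 h0 (show ρ < ρ + t by linarith [ht.1])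
    ((Metric.closedBall_subset_closedBall (by linarith [ht.2])).trans hs)
  rw [smul_eq_mul, inv_mul_eq_div, le_div_iff₀ ht.1]
  linarith

lemma lip_circ {v : ℂ → ℝ} {K : NNReal} (hv : LipschitzWith K v) (x : ℂ) (ρ : ℝ) :
    LipschitzWith (K * Real.nnabs ρ) (fun θ : ℝ => v (circleMap x ρ θ)) :=
  hv.comp (lipschitzWith_circleMap x ρ)

lemma periodic_shift {f : ℝ → ℝ} (hf : Function.Periodic f (2 * Real.pi)) (t : ℝ) :
    ∫ θ in t..(t + 2 * Real.pi), f θ = ∫ θ in (-Real.pi)..Real.pi, f θ := by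
  rw [hf.intervalIntegral_add_eq t (-Real.pi)]
  congr 1; ring

lemma circ_deriv_periodic (v : ℂ → ℝ) (x : ℂ) (ρ : ℝ) :
    Function.Periodic (deriv fun θ => v (circleMap x ρ θ)) (2 * Real.pi) := by
  intro θ
  rw [← deriv_comp_add_const]
  congr 1
  ext1 t
  rw [periodic_circleMap x ρ t]

lemma acf3 {v : ℂ → ℝ} {K : NNReal} (hv : LipschitzWith K v) {x : ℂ} {ρ : ℝ} (hρ : 0 < ρ)
    (hd : ∀ᵐ θ : ℝ, θ ∈ Ioo (-Real.pi) Real.pi → DifferentiableAt ℝ v (circleMap x ρ θ))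
    (hz : ∃ θ, v (circleMap x ρ θ) ≤ 0) :
    2 * Real.pi * acfB v x ρ ≤
      (∫ θ in (-Real.pi)..Real.pi, pos (v (circleMap x ρ θ))) * (ρ * acfA v x ρ) := by
  obtain ⟨t, ht⟩ := hz
  have hpi := Real.pi_pos
  have hper := periodic_circleMap x ρ
  have hw := wirtinger (lip_circ hv x ρ) (a := t) (b := t + 2 * Real.pi) (by linarith) ht
    (by rw [hper t]; exact ht)
  have p1 : Function.Periodic (fun θ => (max (v (circleMap x ρ θ)) 0) ^ 2) (2 * Real.pi) :=
    fun θ => by simp only [hper θ]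
  have p2 : Function.Periodic (fun θ => pos (v (circleMap x ρ θ))) (2 * Real.pi) :=
    fun θ => by simp only [hper θ]
  have p3 : Function.Periodic (fun θ => pos (v (circleMap x ρ θ)) *
      (deriv (fun θ => v (circleMap x ρ θ)) θ) ^ 2) (2 * Real.pi) :=
    fun θ => by simp only [hper θ, circ_deriv_periodic v x ρ θ]
  rw [periodic_shift p1, periodic_shift p2, periodic_shift p3] at hw
  set m := ∫ θ in (-Real.pi)..Real.pi, pos (v (circleMap x ρ θ)) with hm
  have hm0 : 0 ≤ m := intervalIntegral.integral_nonneg neg_pi_le_pi (fun _ _ => pos_nonneg _)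
  set X := ∫ θ in (-Real.pi)..Real.pi, (max (v (circleMap x ρ θ)) 0) ^ 2 with hX
  set Y := ∫ θ in (-Real.pi)..Real.pi, pos (v (circleMap x ρ θ)) * (dR v (circleMap x ρ θ) θ) ^ 2
    with hY
  set Z := ∫ θ in (-Real.pi)..Real.pi, pos (v (circleMap x ρ θ)) * (dT v (circleMap x ρ θ) θ) ^ 2
    with hZ
  have hpm := measurable_pos.comp (meas_v_circ hv.continuous x ρ)
  have iX : IntervalIntegrable (fun θ => (max (v (circleMap x ρ θ)) 0) ^ 2) volume
      (-Real.pi) Real.pi := by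
    apply Continuous.intervalIntegrable
    exact (((hv.continuous.comp (continuous_circleMap x ρ)).max continuous_const).pow 2)
  have bd : ∀ s D L : ℝ, |D| ≤ L → |pos s * D ^ 2| ≤ L ^ 2 := by
    intro s D L hD
    rw [abs_mul, abs_pow]
    have := pow_le_pow_left₀ (abs_nonneg _) hD 2
    nlinarith [abs_pos_le s, abs_nonneg (pos s), sq_nonneg (|D|)]
  have iY : IntervalIntegrable (fun θ => pos (v (circleMap x ρ θ)) *
      (dR v (circleMap x ρ θ) θ) ^ 2) volume (-Real.pi) Real.pi :=
    ii_of_bdd (hpm.mul ((meas_dR_circ v x ρ).pow_const 2)) (C := (2 * K) ^ 2)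
      (fun θ _ => bd _ _ _ (abs_dR_le hv _ _))
  have iZ : IntervalIntegrable (fun θ => pos (v (circleMap x ρ θ)) *
      (dT v (circleMap x ρ θ) θ) ^ 2) volume (-Real.pi) Real.pi :=
    ii_of_bdd (hpm.mul ((meas_dT_circ v x ρ).pow_const 2)) (C := (2 * K) ^ 2)
      (fun θ _ => bd _ _ _ (abs_dT_le hv _ _))
  have hA : acfA v x ρ = Y + Z := by
    rw [hY, hZ, ← intervalIntegral.integral_add iY iZ]
    unfold acfA
    congr 1; ext1 θ
    rw [← dR_sq_add_dT_sq v _ θ]; ring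
  have hZ0 : 0 ≤ Z := intervalIntegral.integral_nonneg neg_pi_le_pi
    (fun _ _ => mul_nonneg (pos_nonneg _) (sq_nonneg _))
  have hY0 : 0 ≤ Y := intervalIntegral.integral_nonneg neg_pi_le_pi
    (fun _ _ => mul_nonneg (pos_nonneg _) (sq_nonneg _))
  have hX0 : 0 ≤ X := intervalIntegral.integral_nonneg neg_pi_le_pi (fun _ _ => sq_nonneg _)
  have hZ2 : ∫ θ in (-Real.pi)..Real.pi, pos (v (circleMap x ρ θ)) *
      (deriv (fun θ => v (circleMap x ρ θ)) θ) ^ 2 = ρ ^ 2 * Z := by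
    rw [hZ, ← intervalIntegral.integral_const_mul]
    refine circ_congr ?_
    filter_upwards [hd] with θ h1 h2
    rw [(hasDerivAt_angular (h1 h2)).deriv]; ring
  rw [hZ2] at hw
  have hB : ∀ κ > 0, 2 * acfB v x ρ ≤ κ * X + Y / κ := by
    intro κ hκ
    have : κ * X + Y / κ = ∫ θ in (-Real.pi)..Real.pi, (κ * (max (v (circleMap x ρ θ)) 0) ^ 2 +
        (pos (v (circleMap x ρ θ)) * (dR v (circleMap x ρ θ) θ) ^ 2) / κ) := by
      rw [intervalIntegral.integral_add (iX.const_mul κ) (iY.div_const κ),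
        intervalIntegral.integral_const_mul, intervalIntegral.integral_div]
    rw [this]
    unfold acfB
    rw [← intervalIntegral.integral_const_mul]
    refine intervalIntegral.integral_mono_on neg_pi_le_pi ((ii_circB hv x ρ).const_mul 2)
      ((iX.const_mul κ).add (iY.div_const κ)) (fun θ _ => ?_)
    by_cases hp : 0 < v (circleMap x ρ θ)
    · rw [max_eq_left hp.le, show pos (v (circleMap x ρ θ)) = 1 by simp [pos, hp]]
      set a := v (circleMap x ρ θ)
      set d := dR v (circleMap x ρ θ) θ
      have : κ * a ^ 2 + 1 * d ^ 2 / κ - 2 * (a * d) = (κ * a - d) ^ 2 / κ := by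
        field_simp; ring
      have h2 : 0 ≤ (κ * a - d) ^ 2 / κ := by positivity
      linarith
    · rw [max_eq_right (not_lt.1 hp), show pos (v (circleMap x ρ θ)) = 0 by simp [pos, hp]]
      simp
  have hfin : ∀ ε > 0, 2 * Real.pi * acfB v x ρ ≤ (m + ε) * (ρ * (Y + Z)) := by
    intro ε hε
    have hme : 0 < m + ε := by linarith
    have h1 := hB (Real.pi / ((m + ε) * ρ)) (by positivity)
    have h2 : Real.pi * (Real.pi / ((m + ε) * ρ) * X) ≤ (m + ε) * ρ * Z := by
      have e : Real.pi * (Real.pi / ((m + ε) * ρ) * X) = Real.pi ^ 2 * X / ((m + ε) * ρ) := by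
        field_simp
      rw [e, div_le_iff₀ (by positivity)]
      have : m ^ 2 * (ρ ^ 2 * Z) ≤ (m + ε) ^ 2 * (ρ ^ 2 * Z) := by
        gcongr; linarith
      nlinarith
    have h3 : Real.pi * (Y / (Real.pi / ((m + ε) * ρ))) = (m + ε) * ρ * Y := by
      field_simp
    have h4 := mul_le_mul_of_nonneg_left h1 hpi.le
    nlinarith
  rw [hA]
  have ht : Filter.Tendsto (fun ε : ℝ => (m + ε) * (ρ * (Y + Z))) (nhdsWithin 0 (Ioi 0))
      (nhds ((m + 0) * (ρ * (Y + Z)))) := by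
    apply Filter.Tendsto.mono_left _ nhdsWithin_le_nhds
    apply Continuous.tendsto
    fun_prop
  rw [add_zero] at ht
  refine ge_of_tendsto ht ?_
  filter_upwards [self_mem_nhdsWithin] with ε hε
  exact hfin ε hε

lemma acfB_zero {v : ℂ → ℝ} {x : ℂ} {ρ : ℝ} (h : ∀ θ, v (circleMap x ρ θ) ≤ 0) :
    acfB v x ρ = 0 := by
  unfold acfB
  simp_rw [fun θ => max_eq_right (h θ)]
  simp

lemma acfE_nonneg (v : ℂ → ℝ) (x : ℂ) {r : ℝ} (hr : 0 ≤ r) : 0 ≤ acfE v x r :=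
  intervalIntegral.integral_nonneg hr (fun _ hρ => mul_nonneg hρ.1 (acfA_nonneg _ _ _))

lemma acf_alg {E F e f m n : ℝ} (hE : 0 ≤ E) (hF : 0 ≤ F) (he : 0 ≤ e) (hf : 0 ≤ f)
    (hm : 0 ≤ m) (hn : 0 ≤ n) (hmn : m + n ≤ 2 * Real.pi) (h1 : 2 * Real.pi * E ≤ m * e)
    (h2 : 2 * Real.pi * F ≤ n * f) : 4 * (E * F) ≤ e * F + E * f := by
  have hpi := Real.pi_pos
  rcases hE.eq_or_lt with h | hE'
  · rw [← h]; simp; positivity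
  rcases hF.eq_or_lt with h | hF'
  · rw [← h]; simp; positivity
  have hm' : 0 < m := by
    rcases hm.eq_or_lt with h | h
    · rw [← h] at h1; nlinarith
    · exact h
  have hn' : 0 < n := by
    rcases hn.eq_or_lt with h | h
    · rw [← h] at h2; nlinarith
    · exact h
  have k1 : 2 * Real.pi * E * n * F ≤ m * e * n * F := by gcongr
  have k2 : 2 * Real.pi * F * m * E ≤ n * f * m * E := by gcongr
  have k3 : 4 * (m * n) ≤ (m + n) * (2 * Real.pi) := by nlinarith [sq_nonneg (m - n)]
  have k4 : (m * n) * (4 * (E * F)) ≤ (m * n) * (e * F + E * f) := by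
    nlinarith [mul_pos hE' hF']
  exact le_of_mul_le_mul_left k4 (mul_pos hm' hn')

lemma LocMin.acf4 {v : ℂ → ℝ} {K : NNReal} {Λ R : ℝ} {c : ℂ} (h : LocMin v K Λ c R)
    {x : ℂ} {R' : ℝ} (hR' : 0 < R')
    (hs : Metric.closedBall x R' ⊆ Metric.closedBall c R) :
    ∀ᵐ ρ : ℝ, 0 < ρ → ρ < R' →
      4 * (acfE v x ρ * acfE (fun z => - v z) x ρ) ≤
        ρ * ((ρ * acfA v x ρ) * acfE (fun z => - v z) x ρ +
          acfE v x ρ * (ρ * acfA (fun z => - v z) x ρ)) := by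
  have hl := h.lip
  have hl' := h.neg.lip
  filter_upwards [h.acf2 hR' hs, h.neg.acf2 hR' hs, polar_ae hl.ae_differentiableAt x,
    polar_ae hl'.ae_differentiableAt x] with ρ h1 h2 d1 d2 h0 hρ
  have k1 := h1 h0 hρ
  have k2 := h2 h0 hρ
  have e1 := acfE_nonneg v x h0.le
  have e2 := acfE_nonneg (fun z => - v z) x h0.le
  have a1 := acfA_nonneg v x ρ
  have a2 := acfA_nonneg (fun z => - v z) x ρ
  by_cases hp : ∃ θ, v (circleMap x ρ θ) ≤ 0
  swap
  · push Not at hp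
    rw [acfB_zero (fun θ => by linarith [hp θ]), mul_zero] at k2
    rw [le_antisymm k2 e2]
    simp only [mul_zero, zero_add]
    positivity
  by_cases hn : ∃ θ, - v (circleMap x ρ θ) ≤ 0
  swap
  · push Not at hn
    rw [acfB_zero (fun θ => by linarith [hn θ]), mul_zero] at k1
    rw [le_antisymm k1 e1]
    simp only [mul_zero, zero_mul, add_zero]
    positivity
  have b1 := acf3 hl h0 (d1 h0) hp
  have b2 := acf3 hl' h0 (d2 h0) hn
  have hm : ∀ w : ℂ → ℝ, Continuous w → IntervalIntegrable (fun θ => pos (w (circleMap x ρ θ)))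
      volume (-Real.pi) Real.pi := fun w hw =>
    ii_of_bdd (measurable_pos.comp (meas_v_circ hw x ρ)) (fun θ _ => abs_pos_le _)
  have hsum : (∫ θ in (-Real.pi)..Real.pi, pos (v (circleMap x ρ θ))) +
      (∫ θ in (-Real.pi)..Real.pi, pos (- v (circleMap x ρ θ))) ≤ 2 * Real.pi := by
    rw [← intervalIntegral.integral_add (hm v hl.continuous) (hm (fun z => - v z) hl'.continuous)]
    have := intervalIntegral.integral_mono_on neg_pi_le_pi
      ((hm v hl.continuous).add (hm (fun z => - v z) hl'.continuous))
      (intervalIntegrable_const (c := (1:ℝ))) (fun θ _ => ?_)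
    · refine this.trans (le_of_eq ?_)
      simp; ring
    · unfold pos
      split_ifs <;> first | linarith | norm_num
  have := acf_alg e1 e2 (e := ρ * (ρ * acfA v x ρ)) (f := ρ * (ρ * acfA (fun z => - v z) x ρ))
    (by positivity) (by positivity)
    (intervalIntegral.integral_nonneg neg_pi_le_pi (fun _ _ => pos_nonneg _))
    (intervalIntegral.integral_nonneg neg_pi_le_pi (fun _ _ => pos_nonneg _)) hsum
    (by nlinarith [Real.pi_pos]) (by nlinarith [Real.pi_pos])
  linarith

lemma LocMin.acf5 {v : ℂ → ℝ} {K : NNReal} {Λ R : ℝ} {c : ℂ} (h : LocMin v K Λ c R)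
    {x : ℂ} {r R' : ℝ} (hr : 0 < r) (hrR : r ≤ R')
    (hs : Metric.closedBall x R' ⊆ Metric.closedBall c R) :
    acfE v x r * acfE (fun z => - v z) x r * R' ^ 4 ≤
      acfE v x R' * acfE (fun z => - v z) x R' * r ^ 4 := by
  have hR' : 0 < R' := hr.trans_le hrR
  have hl := h.lip
  have hl' := h.neg.lip
  have ac : ∀ w : ℂ → ℝ, LipschitzWith K w → AbsolutelyContinuousOnInterval (acfE w x) r R' := by
    intro w hw
    have := (ii_acfA hw x 0 R').absolutelyContinuousOnInterval_intervalIntegral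
      (c := 0) left_mem_uIcc
    refine this.mono ?_
    rw [uIcc_of_le hrR, uIcc_of_le hR'.le]
    exact Icc_subset_Icc_left hr.le
  have acp : AbsolutelyContinuousOnInterval (fun ρ : ℝ => (ρ ^ 4)⁻¹) r R' := by
    apply ContDiffOn.absolutelyContinuousOnInterval
    rw [uIcc_of_le hrR]
    refine ContDiffOn.inv (contDiff_id.pow 4).contDiffOn (fun t ht => ?_)
    have : 0 < t := hr.trans_le ht.1
    exact (pow_pos this 4).ne'
  have acF := ((ac v hl).fun_mul (ac _ hl')).fun_mul acp
  have hintg := acF.integral_deriv_eq_sub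
  have hnn : 0 ≤ ∫ ρ in r..R', deriv (fun ρ => acfE v x ρ * acfE (fun z => - v z) x ρ *
      (ρ ^ 4)⁻¹) ρ := by
    refine intervalIntegral.integral_nonneg_of_ae_restrict hrR ?_
    refine (ae_restrict_iff' measurableSet_Icc).2 ?_
    filter_upwards [h.acf4 hR' hs, (ii_acfA hl x 0 R').ae_hasDerivAt_integral,
      (ii_acfA hl' x 0 R').ae_hasDerivAt_integral, ae_ne R'] with ρ h4 d1 d2 hne hm
    have h0 : 0 < ρ := hr.trans_le hm.1
    have hρR := lt_of_le_of_ne hm.2 hne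
    have hmem : ρ ∈ uIcc 0 R' := by rw [uIcc_of_le hR'.le]; exact ⟨h0.le, hm.2⟩
    have D1 : HasDerivAt (acfE v x) (ρ * acfA v x ρ) ρ := d1 hmem 0 left_mem_uIcc
    have D2 : HasDerivAt (acfE (fun z => - v z) x) (ρ * acfA (fun z => - v z) x ρ) ρ :=
      d2 hmem 0 left_mem_uIcc
    have D3 : HasDerivAt (fun ρ : ℝ => (ρ ^ 4)⁻¹) (-(4 * ρ ^ 3) / (ρ ^ 4) ^ 2) ρ := by
      have := (hasDerivAt_pow 4 ρ).inv (by positivity)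
      refine HasDerivAt.congr_deriv (f := fun ρ : ℝ => (ρ ^ 4)⁻¹) this ?_
      norm_num
    have D := ((D1.mul D2).mul D3).deriv
    have e : (acfE v x * acfE (fun z => - v z) x * fun ρ : ℝ => (ρ ^ 4)⁻¹) =
      (fun ρ => acfE v x ρ * acfE (fun z => - v z) x ρ * (ρ ^ 4)⁻¹) := rfl
    rw [e] at D
    simp only [Pi.zero_apply]
    rw [D]
    have k := h4 h0 hρR
    simp only [Pi.mul_apply]
    set E := acfE v x ρ
    set F := acfE (fun z => - v z) x ρ
    set A := acfA v x ρ
    set A' := acfA (fun z => - v z) x ρ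
    have : (ρ * A * F + E * (ρ * A')) * (ρ ^ 4)⁻¹ + E * F * (-(4 * ρ ^ 3) / (ρ ^ 4) ^ 2) =
      (ρ * (ρ * A * F + E * (ρ * A')) - 4 * (E * F)) / ρ ^ 5 := by
      field_simp
      ring
    rw [this]
    exact div_nonneg (by linarith) (by positivity)
  rw [hintg] at hnn
  have h6 : acfE v x r * acfE (fun z => - v z) x r * (r ^ 4)⁻¹ ≤
    acfE v x R' * acfE (fun z => - v z) x R' * (R' ^ 4)⁻¹ := by linarith
  rw [← div_eq_mul_inv, ← div_eq_mul_inv, div_le_div_iff₀ (by positivity) (by positivity)] at h6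
  exact h6

lemma ion_gdot {v η : ℂ → ℝ} {K K' : NNReal} (hv : LipschitzWith K v) (hη : LipschitzWith K' η)
    (x : ℂ) (r : ℝ) : IntegrableOn (gdot v η) (Metric.closedBall x r) :=
  Measure.integrableOn_of_bounded (M := 2 * K * K')
    (by simp [Complex.volume_closedBall, ENNReal.mul_eq_top])
    (measurable_gdot v η).aestronglyMeasurable
    (Filter.Eventually.of_forall fun z => abs_gdot_le hv hη z)

lemma LocMin.acfE_le_one {v : ℂ → ℝ} {K : NNReal} {Λ R : ℝ} {c : ℂ} (h : LocMin v K Λ c R)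
    {x : ℂ} {r : ℝ} (hr : 0 < r)
    (hs : Metric.closedBall x r ⊆ Metric.closedBall c R) : acfE v x r ≤ 1 := by
  have hl := h.lip
  have e : acfE v x r = ∫ z in Metric.closedBall x r, pos (v z) * gdot v v z := by
    rw [polar_integral _ x hr.le (fun z _ => pos_gdot_le hl z)]
    · rfl
    · exact (measurable_pos.comp hl.continuous.measurable).mul (measurable_gdot v v)
  rw [e]
  refine le_trans ?_ h.energy
  refine le_trans (integral_mono_of_nonneg (Filter.Eventually.of_forall fun z =>
    mul_nonneg (pos_nonneg _) (gdot_self_nonneg _ _)) (ion_gdot hl hl x r)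
    (Filter.Eventually.of_forall fun z => ?_)) ?_
  · exact mul_le_of_le_one_left (gdot_self_nonneg _ _) (pos_le_one _)
  · exact setIntegral_mono_set (ion_gdot hl hl c R)
      (Filter.Eventually.of_forall fun z => gdot_self_nonneg _ _) (LE.le.eventuallyLE hs)

lemma LocMin.acf_min {v : ℂ → ℝ} {K : NNReal} {Λ R : ℝ} {c : ℂ} (h : LocMin v K Λ c R)
    {x : ℂ} {r R' : ℝ} (hr : 0 < r) (hrR : r ≤ R')
    (hs : Metric.closedBall x R' ⊆ Metric.closedBall c R) :
    acfE v x r * R' ^ 2 ≤ r ^ 2 ∨ acfE (fun z => - v z) x r * R' ^ 2 ≤ r ^ 2 := by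
  have hR' : 0 < R' := hr.trans_le hrR
  by_contra! hcon
  have h5 := h.acf5 hr hrR hs
  have a1 := h.acfE_le_one hR' hs
  have a2 := h.neg.acfE_le_one hR' hs
  have b1 := acfE_nonneg v x hR'.le
  have b2 := acfE_nonneg (fun z => - v z) x hR'.le
  have h6 : acfE v x R' * acfE (fun z => - v z) x R' ≤ 1 := by nlinarith
  have h7 : r ^ 2 * r ^ 2 < (acfE v x r * R' ^ 2) * (acfE (fun z => - v z) x r * R' ^ 2) :=
    mul_lt_mul'' hcon.1 hcon.2 (by positivity) (by positivity)
  have h8 : acfE v x R' * acfE (fun z => - v z) x R' * r ^ 4 ≤ r ^ 4 :=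
    mul_le_of_le_one_left (by positivity) h6
  nlinarith

lemma circ_X {v : ℂ → ℝ} {K : NNReal} (hv : LipschitzWith K v) {x : ℂ} {ρ : ℝ}
    (hd : ∀ᵐ θ : ℝ, θ ∈ Ioo (-Real.pi) Real.pi → DifferentiableAt ℝ v (circleMap x ρ θ))
    (hz : ∃ θ, v (circleMap x ρ θ) ≤ 0) :
    ∫ θ in (-Real.pi)..Real.pi, (max (v (circleMap x ρ θ)) 0) ^ 2 ≤ 4 * ρ ^ 2 * acfA v x ρ := by
  obtain ⟨t, ht⟩ := hz
  have hpi := Real.pi_pos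
  have hper := periodic_circleMap x ρ
  have hw := wirtinger (lip_circ hv x ρ) (a := t) (b := t + 2 * Real.pi) (by linarith) ht
    (by rw [hper t]; exact ht)
  have p1 : Function.Periodic (fun θ => (max (v (circleMap x ρ θ)) 0) ^ 2) (2 * Real.pi) :=
    fun θ => by simp only [hper θ]
  have p2 : Function.Periodic (fun θ => pos (v (circleMap x ρ θ))) (2 * Real.pi) :=
    fun θ => by simp only [hper θ]
  have p3 : Function.Periodic (fun θ => pos (v (circleMap x ρ θ)) *
      (deriv (fun θ => v (circleMap x ρ θ)) θ) ^ 2) (2 * Real.pi) :=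
    fun θ => by simp only [hper θ, circ_deriv_periodic v x ρ θ]
  rw [periodic_shift p1, periodic_shift p2, periodic_shift p3] at hw
  set m := ∫ θ in (-Real.pi)..Real.pi, pos (v (circleMap x ρ θ)) with hm
  have hpm := measurable_pos.comp (meas_v_circ hv.continuous x ρ)
  have hm0 : 0 ≤ m := intervalIntegral.integral_nonneg neg_pi_le_pi (fun _ _ => pos_nonneg _)
  have hm1 : m ≤ 2 * Real.pi := by
    have := intervalIntegral.integral_mono_on neg_pi_le_pi
      (ii_of_bdd hpm (C := 1) (fun θ _ => abs_pos_le _))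
      (intervalIntegrable_const (c := (1:ℝ))) (fun θ _ => pos_le_one _)
    refine this.trans (le_of_eq ?_)
    simp; ring
  set X := ∫ θ in (-Real.pi)..Real.pi, (max (v (circleMap x ρ θ)) 0) ^ 2 with hX
  have hYA : ∫ θ in (-Real.pi)..Real.pi, pos (v (circleMap x ρ θ)) *
      (deriv (fun θ => v (circleMap x ρ θ)) θ) ^ 2 ≤ ρ ^ 2 * acfA v x ρ := by
    unfold acfA
    rw [← intervalIntegral.integral_const_mul]
    have hm : Measurable fun θ => pos (v (circleMap x ρ θ)) *
      (deriv (fun θ => v (circleMap x ρ θ)) θ) ^ 2 := hpm.mul ((measurable_deriv _).pow_const 2)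
    refine intervalIntegral.integral_mono_ae_restrict neg_pi_le_pi
      (ii_of_bdd hm (C := (K * Real.nnabs ρ : NNReal) ^ 2) (fun θ _ => ?_))
      ((ii_circA hv x ρ).const_mul _) ?_
    · rw [abs_mul, abs_pow]
      have h1 := norm_deriv_le_of_lipschitz (lip_circ hv x ρ) (x₀ := θ)
      rw [Real.norm_eq_abs] at h1
      have := pow_le_pow_left₀ (abs_nonneg _) h1 2
      nlinarith [abs_pos_le (v (circleMap x ρ θ)), abs_nonneg (pos (v (circleMap x ρ θ))),
        sq_nonneg (|deriv (fun θ => v (circleMap x ρ θ)) θ|)]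
    · refine (ae_restrict_iff' measurableSet_Icc).2 ?_
      filter_upwards [hd, ae_ne Real.pi, ae_ne (-Real.pi)] with θ h1 h2 h3 h4
      have h5 := h1 ⟨lt_of_le_of_ne h4.1 (Ne.symm h3), lt_of_le_of_ne h4.2 h2⟩
      rw [(hasDerivAt_angular h5).deriv, ← dR_sq_add_dT_sq v _ θ]
      have := pos_nonneg (v (circleMap x ρ θ))
      nlinarith [mul_nonneg (mul_nonneg this (sq_nonneg ρ))
        (sq_nonneg (dR v (circleMap x ρ θ) θ))]
  have hA := acfA_nonneg v x ρ
  have k1 : m ^ 2 ≤ (2 * Real.pi) ^ 2 := pow_le_pow_left₀ hm0 hm1 2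
  have k2 : Real.pi ^ 2 * X ≤ Real.pi ^ 2 * (4 * ρ ^ 2 * acfA v x ρ) := by
    refine hw.trans ((mul_le_mul_of_nonneg_left hYA (sq_nonneg m)).trans ?_)
    refine (mul_le_mul_of_nonneg_right k1 (by positivity)).trans (le_of_eq ?_)
    ring
  exact le_of_mul_le_mul_left k2 (by positivity)

lemma circ_abs {v : ℂ → ℝ} {K : NNReal} (hv : LipschitzWith K v) {x : ℂ} {ρ C : ℝ} (hρ : 0 < ρ)
    (hd : ∀ᵐ θ : ℝ, θ ∈ Ioo (-Real.pi) Real.pi → DifferentiableAt ℝ v (circleMap x ρ θ))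
    (hC : |cInt v x ρ| ≤ C * ρ) :
    ∫ θ in (-Real.pi)..Real.pi, |v (circleMap x ρ θ)| ≤
      (C + 2 * Real.pi) * ρ + 4 * (ρ * acfA v x ρ) := by
  have hA := acfA_nonneg v x ρ
  have hpi := Real.pi_pos
  have hc : Continuous fun θ => v (circleMap x ρ θ) :=
    hv.continuous.comp (continuous_circleMap x ρ)
  have hab := abs_le.1 hC
  by_cases hz : ∃ θ, v (circleMap x ρ θ) ≤ 0
  · have hX := circ_X hv hd hz
    have i1 : IntervalIntegrable (fun θ => v (circleMap x ρ θ)) volume (-Real.pi) Real.pi :=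
      hc.intervalIntegrable _ _
    have i2 : IntervalIntegrable (fun θ => (max (v (circleMap x ρ θ)) 0) ^ 2) volume
      (-Real.pi) Real.pi := ((hc.max continuous_const).pow 2).intervalIntegrable _ _
    have hmono : ∫ θ in (-Real.pi)..Real.pi, |v (circleMap x ρ θ)| ≤
        ∫ θ in (-Real.pi)..Real.pi, ((ρ + (max (v (circleMap x ρ θ)) 0) ^ 2 * ρ⁻¹) -
          v (circleMap x ρ θ)) := by
      refine intervalIntegral.integral_mono_on neg_pi_le_pi (hc.abs.intervalIntegrable _ _)
        (((intervalIntegrable_const).add (i2.mul_const _)).sub i1) (fun θ _ => ?_)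
      set t := v (circleMap x ρ θ)
      have e : |t| = 2 * max t 0 - t := by
        rcases le_total 0 t with h | h
        · rw [abs_of_nonneg h, max_eq_left h]; ring
        · rw [abs_of_nonpos h, max_eq_right h]; ring
      rw [e]
      have : 2 * max t 0 ≤ ρ + (max t 0) ^ 2 * ρ⁻¹ := by
        have : ρ + (max t 0) ^ 2 * ρ⁻¹ - 2 * max t 0 = (max t 0 - ρ) ^ 2 * ρ⁻¹ := by
          field_simp; ring
        have h2 : 0 ≤ (max t 0 - ρ) ^ 2 * ρ⁻¹ := by positivity
        linarith
      linarith
    rw [intervalIntegral.integral_sub ((intervalIntegrable_const).add (i2.mul_const _)) i1,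
      intervalIntegral.integral_add intervalIntegrable_const (i2.mul_const _),
      intervalIntegral.integral_mul_const, intervalIntegral.integral_const] at hmono
    have h3 : (∫ θ in (-Real.pi)..Real.pi, (max (v (circleMap x ρ θ)) 0) ^ 2) * ρ⁻¹ ≤
        4 * (ρ * acfA v x ρ) := by
      refine (mul_le_mul_of_nonneg_right hX (by positivity)).trans (le_of_eq ?_)
      field_simp
    have h4 : ∫ θ in (-Real.pi)..Real.pi, v (circleMap x ρ θ) = cInt v x ρ := rfl
    rw [h4, smul_eq_mul] at hmono
    linarith [hab.1]
  · push Not at hz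
    have : ∫ θ in (-Real.pi)..Real.pi, |v (circleMap x ρ θ)| = cInt v x ρ := by
      unfold cInt; congr 1; ext1 θ; exact abs_of_pos (hz θ)
    rw [this]
    have : 0 ≤ ρ * acfA v x ρ := by positivity
    nlinarith [hab.2]

lemma LocMin.abs_int_aux {v : ℂ → ℝ} {K : NNReal} {Λ R : ℝ} {c : ℂ} (h : LocMin v K Λ c R)
    {x : ℂ} (hx : v x = 0) {r R' : ℝ} (hr : 0 < r) (hrR : r ≤ R')
    (hs : Metric.closedBall x R' ⊆ Metric.closedBall c R)
    (hE : acfE v x r * R' ^ 2 ≤ r ^ 2) :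
    ∫ z in Metric.closedBall x r, |v z| ≤ (10 * Real.pi + Λ * Real.pi + 4 / R' ^ 2) * r ^ 3 := by
  have hl := h.lip
  have hR' : 0 < R' := hr.trans_le hrR
  have hΛ := h.hΛ
  have hpi := Real.pi_pos
  have bdv : ∀ z ∈ Metric.closedBall x r, |(|v z|)| ≤ K * r := by
    intro z hz
    have := hl.dist_le_mul z x
    rw [Real.dist_eq, hx, sub_zero] at this
    rw [abs_abs]
    exact this.trans (mul_le_mul_of_nonneg_left hz K.2)
  have hm : Measurable fun z => |v z| := hl.continuous.abs.measurable
  rw [polar_integral hm x hr.le bdv]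
  set D := 10 * Real.pi + Λ * Real.pi with hD
  have hle : ∫ ρ in (0:ℝ)..r, ρ * ∫ θ in (-Real.pi)..Real.pi, |v (circleMap x ρ θ)| ≤
      ∫ ρ in (0:ℝ)..r, (D * r ^ 2 + 4 * r * (ρ * acfA v x ρ)) := by
    refine intervalIntegral.integral_mono_ae_restrict hr.le ?_
      (intervalIntegrable_const.add ((ii_acfA hl x 0 r).const_mul _)) ?_
    · refine ii_of_bdd (C := r * (K * r * |Real.pi - -Real.pi|))
        (measurable_id.mul (meas_param
          (F := fun p => |v (circleMap x p.1 p.2)|) (meas_circ hm x))) (fun ρ hρ => ?_)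
      rw [uIoc_of_le hr.le] at hρ
      change |ρ * _| ≤ _
      rw [abs_mul, abs_of_pos hρ.1]
      refine mul_le_mul hρ.2 (abs_ii_le fun θ => ?_) (abs_nonneg _) hr.le
      refine bdv _ ?_
      rw [Metric.mem_closedBall, dist_eq_norm, circleMap_sub_center, norm_circleMap_zero, abs_of_pos hρ.1]
      exact hρ.2
    · refine (ae_restrict_iff' measurableSet_Icc).2 ?_
      filter_upwards [polar_ae hl.ae_differentiableAt x, ae_ne (0:ℝ)] with ρ hd hne hm
      have h0 : 0 < ρ := lt_of_le_of_ne hm.1 (Ne.symm hne)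
      have k1 := circ_abs hl h0 (hd h0) (h.cInt_zero hx h0
        ((Metric.closedBall_subset_closedBall (hm.2.trans hrR)).trans hs))
      have k2 : (8 * Real.pi + Λ * Real.pi + 2 * Real.pi) * ρ ≤ D * r := by
        rw [hD]
        have : 0 ≤ 10 * Real.pi + Λ * Real.pi := by positivity
        nlinarith [mul_le_mul_of_nonneg_left hm.2 this]
      have hA := acfA_nonneg v x ρ
      have hDp : 0 ≤ D := by positivity
      have k3 := mul_le_mul_of_nonneg_left (k1.trans (add_le_add_left k2 _)) h0.le
      refine k3.trans ?_
      have k4 : ρ * (D * r) ≤ D * r ^ 2 := by nlinarith [mul_nonneg hDp hr.le, hm.2]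
      have k5 : ρ * (4 * (ρ * acfA v x ρ)) ≤ 4 * r * (ρ * acfA v x ρ) := by
        have : 0 ≤ ρ * acfA v x ρ := by positivity
        nlinarith [hm.2]
      linarith
  refine hle.trans ?_
  rw [intervalIntegral.integral_add intervalIntegrable_const ((ii_acfA hl x 0 r).const_mul _),
    intervalIntegral.integral_const, intervalIntegral.integral_const_mul]
  have e : ∫ ρ in (0:ℝ)..r, ρ * acfA v x ρ = acfE v x r := rfl
  rw [e, smul_eq_mul]
  have hE2 : acfE v x r ≤ r ^ 2 / R' ^ 2 := by rw [le_div_iff₀ (by positivity)]; exact hE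
  have := mul_le_mul_of_nonneg_left hE2 (show 0 ≤ 4 * r by positivity)
  calc _ ≤ (r - 0) * (D * r ^ 2) + 4 * r * (r ^ 2 / R' ^ 2) := by linarith
    _ = _ := by ring

lemma LocMin.abs_int {v : ℂ → ℝ} {K : NNReal} {Λ R : ℝ} {c : ℂ} (h : LocMin v K Λ c R)
    {x : ℂ} (hx : v x = 0) {r R' : ℝ} (hr : 0 < r) (hrR : r ≤ R')
    (hs : Metric.closedBall x R' ⊆ Metric.closedBall c R) :
    ∫ z in Metric.closedBall x r, |v z| ≤ (10 * Real.pi + Λ * Real.pi + 4 / R' ^ 2) * r ^ 3 := by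
  rcases h.acf_min hr hrR hs with hE | hE
  · exact h.abs_int_aux hx hr hrR hs hE
  · have := h.neg.abs_int_aux (by simp [hx]) hr hrR hs hE
    simpa only [abs_neg] using this

lemma gdot_sub_const (v η : ℂ → ℝ) (k : ℝ) (z : ℂ) :
    gdot (fun z => v z - k) η z = gdot v η z := by
  unfold gdot
  rw [fderiv_sub_const]

lemma LocMin.sub_const {v : ℂ → ℝ} {K : NNReal} {Λ R : ℝ} {c : ℂ} (h : LocMin v K Λ c R)
    {R' : ℝ} (hR : R' ≤ R) (k : ℝ)
    (hne : ∀ z ∈ Metric.closedBall c R', v z ≠ 0) :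
    LocMin (fun z => v z - k) K Λ c R' where
  lip := LipschitzWith.of_dist_le_mul fun a b => by
    rw [dist_sub_right]; exact h.lip.dist_le_mul a b
  hΛ := h.hΛ
  h1 := by
    intro η K' x ρ hη hρ hs hz
    have := h.h1 η K' x ρ hη hρ (hs.trans (Metric.closedBall_subset_closedBall hR)) hz
    simpa only [gdot_sub_const] using this
  h2 := by
    intro η K' x ρ hη hρ hs hz _
    obtain ⟨z0, hz0, hmin⟩ := (isCompact_closedBall x ρ).exists_isMinOn
      ⟨x, Metric.mem_closedBall_self hρ.le⟩ (f := fun z => |v z|)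
      (h.lip.continuous.abs.continuousOn)
    obtain ⟨z1, hz1, hmax⟩ := (isCompact_closedBall x ρ).exists_isMaxOn
      ⟨x, Metric.mem_closedBall_self hρ.le⟩ (f := fun z => |η z|)
      (hη.continuous.abs.continuousOn)
    have hm : 0 < |v z0| := abs_pos.2 (hne z0 (hs hz0))
    have := h.ortho hη hρ (hs.trans (Metric.closedBall_subset_closedBall hR)) hz
      (C := |η z1| / |v z0|) (fun z => by
        by_cases hzm : z ∈ Metric.closedBall x ρ
        · have a1 : |v z0| ≤ |v z| := hmin hzm
          have a2 : |η z| ≤ |η z1| := hmax hzm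
          refine a2.trans ?_
          rw [div_mul_eq_mul_div, le_div_iff₀ hm]
          exact mul_le_mul_of_nonneg_left a1 (abs_nonneg _)
        · rw [hz z hzm, abs_zero]; positivity)
    simp only [gdot_sub_const, this, mul_zero, zero_add]
    exact integral_nonneg fun z => gdot_self_nonneg _ _
  energy := by
    refine le_trans ?_ h.energy
    have e : gdot (fun z => v z - k) (fun z => v z - k) = gdot v v := by
      ext1 z; rw [gdot_sub_const, gdot_comm, gdot_sub_const]
    rw [e]
    exact setIntegral_mono_set (ion_gdot h.lip h.lip c R)
      (Filter.Eventually.of_forall fun z => gdot_self_nonneg _ _)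
      (LE.le.eventuallyLE (Metric.closedBall_subset_closedBall hR))

def locC (R Λ : ℝ) : ℝ := 1536 / Real.pi * (10 * Real.pi + Λ * Real.pi + 64 / R ^ 2)

lemma nearest_zero {v : ℂ → ℝ} (hv : Continuous v) {y x : ℂ} (hx : v x = 0) (hy : v y ≠ 0) :
    ∃ x0, v x0 = 0 ∧ 0 < dist x0 y ∧ dist x0 y ≤ dist x y ∧
      ∀ z ∈ Metric.closedBall y (dist x0 y / 2), v z ≠ 0 := by
  have hcl : IsClosed {z | v z = 0} := isClosed_eq hv continuous_const
  obtain ⟨x0, h0, hd⟩ := hcl.exists_infDist_eq_dist ⟨x, hx⟩ y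
  have hpos : 0 < dist x0 y := dist_pos.2 (fun h => hy (h ▸ h0))
  refine ⟨x0, h0, hpos, ?_, ?_⟩
  · rw [dist_comm, ← hd, dist_comm]; exact Metric.infDist_le_dist_of_mem hx
  · intro z hz hz0
    have := Metric.infDist_le_dist_of_mem (x := y) (s := {z | v z = 0}) hz0
    rw [hd, dist_comm y x0, dist_comm y z] at this
    have := this.trans hz
    linarith

lemma LocMin.main {v : ℂ → ℝ} {K : NNReal} {Λ R : ℝ} {c : ℂ} (h : LocMin v K Λ c R)
    (hR : 0 < R) : ∀ᶠ z in nhds c, |v z - v c| ≤ locC R Λ * ‖z - c‖ := by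
  have hΛ := h.hΛ
  have hpi := Real.pi_pos
  have hc := h.lip.continuous
  set M := 10 * Real.pi + Λ * Real.pi + 64 / R ^ 2 with hM
  have hMp : 0 ≤ M := by positivity
  have hev : ∀ ε > 0, ∀ᶠ z in nhds c, ‖z - c‖ ≤ ε := fun ε hε => by
    filter_upwards [Metric.closedBall_mem_nhds c hε] with z hz
    rwa [Metric.mem_closedBall, dist_eq_norm] at hz
  -- integral bound for zeros
  have hI : ∀ x0, v x0 = 0 → dist x0 c ≤ R / 4 → ∀ r, 0 < r → r ≤ R / 2 →
      ∫ z in Metric.closedBall x0 r, |v z| ≤ M * r ^ 3 := by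
    intro x0 h0 hd r hr hrR
    refine (h.abs_int h0 hr hrR (Metric.closedBall_subset_closedBall' (by linarith))).trans ?_
    refine mul_le_mul_of_nonneg_right ?_ (by positivity)
    rw [hM]
    have : 4 / (R / 2) ^ 2 ≤ 64 / R ^ 2 := by
      rw [div_pow, div_div_eq_mul_div]
      exact div_le_div_of_nonneg_right (by norm_num) (by positivity)
    linarith
  have habs : ∀ y r x d, Metric.closedBall y r ⊆ Metric.closedBall x d →
      ∫ z in Metric.closedBall y r, |v z| ≤ ∫ z in Metric.closedBall x d, |v z| := by
    intro y r x d hs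
    exact setIntegral_mono_set (hc.abs.continuousOn.integrableOn_compact (isCompact_closedBall _ _))
      (Filter.Eventually.of_forall fun z => abs_nonneg _) (LE.le.eventuallyLE hs)
  by_cases hvc : v c = 0
  · filter_upwards [hev (R / 8) (by positivity)] with y hy
    rw [hvc, sub_zero]
    by_cases hvy : v y = 0
    · rw [hvy, abs_zero]; unfold locC; positivity
    obtain ⟨x1, h1, hp, hle, hne⟩ := nearest_zero hc hvc hvy
    set d := dist x1 y with hd
    have hyc : dist y c = ‖y - c‖ := dist_eq_norm _ _
    have hdy : d ≤ ‖y - c‖ := by rw [← hyc, dist_comm y c]; exact hle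
    have hx1c : dist x1 c ≤ R / 4 := by
      have := dist_triangle x1 y c
      linarith
    have hpb := h.point_bound (x := x1) (d := 2 * d) (half_pos hp)
      (Metric.closedBall_subset_closedBall' (by rw [dist_comm y x1]; linarith))
      (Metric.closedBall_subset_closedBall' (by linarith)) hne
    have hi := hI x1 h1 hx1c (2 * d) (by linarith) (by linarith)
    calc |v y| ≤ 3 / (Real.pi * (d / 2) ^ 2) * (M * (2 * d) ^ 3) :=
          hpb.trans (mul_le_mul_of_nonneg_left hi (by positivity))
      _ = 96 / Real.pi * M * d := by field_simp; ring
      _ ≤ 1536 / Real.pi * M * ‖y - c‖ := by gcongr; norm_num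
  by_cases hz : ∃ x, dist x c ≤ R / 4 ∧ v x = 0
  · obtain ⟨x, hxd, hx⟩ := hz
    obtain ⟨x1, h1, hp, hle, hne⟩ := nearest_zero hc hx hvc
    set d := dist x1 c with hd
    filter_upwards [hev (d / 2 / 2) (by positivity)] with y hy
    have hb := h.diff_bound (half_pos hp) hy
      (Metric.closedBall_subset_closedBall (by linarith)) hne 0
    simp only [sub_zero] at hb
    have hi := hI x1 h1 (by linarith) (2 * d) (by linarith) (by linarith)
    have hi2 := (habs c (d / 2) x1 (2 * d)
      (Metric.closedBall_subset_closedBall' (by rw [dist_comm c x1]; linarith))).trans hi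
    calc |v y - v c| ≤ 24 / (Real.pi * (d / 2) ^ 3) * ‖y - c‖ * (M * (2 * d) ^ 3) :=
          hb.trans (mul_le_mul_of_nonneg_left hi2 (by positivity))
      _ = 1536 / Real.pi * M * ‖y - c‖ := by field_simp; ring
  · push Not at hz
    filter_upwards [hev (R / 4 / 2) (by positivity)] with y hy
    have hne : ∀ z ∈ Metric.closedBall c (R / 4), v z ≠ 0 := fun z hz' => hz z hz'
    have hb := h.diff_bound (d := R / 4) (by positivity) hy
      (Metric.closedBall_subset_closedBall (by linarith)) hne (v c)
    have hw := h.sub_const (R' := R / 4) (by linarith) (v c) hne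
    have hi := hw.abs_int (x := c) (sub_self _) (r := R / 4) (R' := R / 4) (by positivity) le_rfl
      le_rfl
    have e : 10 * Real.pi + Λ * Real.pi + 4 / (R / 4) ^ 2 = M := by rw [hM]; field_simp; ring
    rw [e] at hi
    calc |v y - v c| ≤ 24 / (Real.pi * (R / 4) ^ 3) * ‖y - c‖ * (M * (R / 4) ^ 3) :=
          hb.trans (mul_le_mul_of_nonneg_left hi (by positivity))
      _ = 24 / Real.pi * M * ‖y - c‖ := by field_simp
      _ ≤ 1536 / Real.pi * M * ‖y - c‖ := by gcongr; norm_num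

lemma bdd_inf (l a : ℝ) : BddBelow (range fun k : ℤ => |a + (k : ℝ) * l|) :=
  ⟨0, by rintro _ ⟨k, rfl⟩; exact abs_nonneg _⟩

lemma inf_nonneg (l a : ℝ) : 0 ≤ ⨅ k : ℤ, |a + (k : ℝ) * l| := Real.iInf_nonneg fun _ => abs_nonneg _

lemma inf_le_abs (l a : ℝ) : ⨅ k : ℤ, |a + (k : ℝ) * l| ≤ |a| := by
  have := ciInf_le (bdd_inf l a) 0
  simpa using this

/-- upper bound of the cone distance -/
lemma coneDist_le {l r s θ φ : ℝ} (hr : 0 ≤ r) (hs : 0 ≤ s) :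
    coneDist l (r, θ) (s, φ) ≤ |r - s| + max r s * |θ - φ| := by
  unfold coneDist
  simp only
  set δ := ⨅ k : ℤ, |θ - φ + (k : ℝ) * l| with hδ
  have h0 : 0 ≤ δ := inf_nonneg _ _
  have h1 : δ ≤ |θ - φ| := inf_le_abs _ _
  set m := min δ Real.pi with hm
  have hm0 : 0 ≤ m := le_min h0 Real.pi_pos.le
  have hm1 : m ≤ |θ - φ| := (min_le_left _ _).trans h1
  have hc := Real.one_sub_sq_div_two_le_cos (x := m)
  have hM : 0 ≤ max r s := le_max_of_le_left hr
  refine Real.sqrt_le_iff.2 ⟨by positivity, ?_⟩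
  have h2 : r * s ≤ max r s * max r s := mul_le_mul (le_max_left _ _) (le_max_right _ _) hs hM
  have h3 : m ^ 2 ≤ |θ - φ| ^ 2 := pow_le_pow_left₀ hm0 hm1 2
  have h4 : r * s * m ^ 2 ≤ (max r s * max r s) * |θ - φ| ^ 2 :=
    mul_le_mul h2 h3 (sq_nonneg _) (by positivity)
  have h5 : 2 * r * s * (1 - m ^ 2 / 2) ≤ 2 * r * s * Real.cos m :=
    mul_le_mul_of_nonneg_left hc (by positivity)
  have h6 : |r - s| ^ 2 = (r - s) ^ 2 := sq_abs _
  have h7 : 0 ≤ |r - s| * (max r s * |θ - φ|) := by positivity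
  nlinarith

lemma coneDist_ge1 {l r s θ φ : ℝ} (hr : 0 ≤ r) (hs : 0 ≤ s) :
    |r - s| ≤ coneDist l (r, θ) (s, φ) := by
  unfold coneDist
  simp only
  refine Real.le_sqrt_of_sq_le ?_
  rw [sq_abs]
  nlinarith [Real.cos_le_one (min (⨅ k : ℤ, |θ - φ + (k : ℝ) * l|) Real.pi), mul_nonneg hr hs]

lemma coneDist_ge2 {l r s θ φ : ℝ} (hr : 0 ≤ r) (hs : 0 ≤ s) :
    s * min (⨅ k : ℤ, |θ - φ + (k : ℝ) * l|) Real.pi ≤ Real.pi * coneDist l (r, θ) (s, φ) := by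
  unfold coneDist
  simp only
  set m := min (⨅ k : ℤ, |θ - φ + (k : ℝ) * l|) Real.pi with hm
  have hpi := Real.pi_pos
  have hm0 : 0 ≤ m := le_min (inf_nonneg _ _) Real.pi_pos.le
  have hm1 : m ≤ Real.pi := min_le_right _ _
  have key : s * m / Real.pi ≤ √(r ^ 2 + s ^ 2 - 2 * r * s * Real.cos m) := by
    refine Real.le_sqrt_of_sq_le ?_
    rcases le_total m (Real.pi / 2) with h | h
    · have h1 := Real.mul_le_sin hm0 h
      have h2 : m / Real.pi ≤ Real.sin m := by
        have : 0 ≤ m / Real.pi := by positivity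
        have e : 2 / Real.pi * m = 2 * (m / Real.pi) := by ring
        linarith
      have h3 : (s * m / Real.pi) ^ 2 ≤ s ^ 2 * Real.sin m ^ 2 := by
        rw [mul_div_assoc, mul_pow]
        exact mul_le_mul_of_nonneg_left (pow_le_pow_left₀ (by positivity) h2 2) (sq_nonneg _)
      nlinarith [sq_nonneg (r - s * Real.cos m), Real.sin_sq_add_cos_sq m]
    · have h1 : Real.cos m ≤ 0 := Real.cos_nonpos_of_pi_div_two_le_of_le h (by linarith)
      have h2 : s * m / Real.pi ≤ s := by
        rw [div_le_iff₀ hpi]; exact mul_le_mul_of_nonneg_left hm1 hs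
      have h3 : (s * m / Real.pi) ^ 2 ≤ s ^ 2 := pow_le_pow_left₀ (by positivity) h2 2
      nlinarith [mul_nonneg hr hs, sq_nonneg r]
  rw [div_le_iff₀ hpi] at key
  linarith

/-- periodization of a function vanishing at the ends of a period -/
lemma per_lip {g : ℝ → ℝ} {K l t : ℝ} (hK : 0 ≤ K) (hl : 0 < l) (hg : ∀ a b, |g a - g b| ≤ K * |a - b|)
    (h0 : g t = 0) (h1 : g (t + l) = 0) (a b : ℝ) :
    |g (toIcoMod hl t a) - g (toIcoMod hl t b)| ≤ K * |a - b| := by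
  wlog hab : a ≤ b generalizing a b
  · rw [abs_sub_comm, abs_sub_comm a b]; exact this b a (le_of_not_ge hab)
  have ha := toIcoMod_mem_Ico hl t a
  have hb := toIcoMod_mem_Ico hl t b
  have ea := toIcoMod_add_toIcoDiv_zsmul hl t a
  have eb := toIcoMod_add_toIcoDiv_zsmul hl t b
  set a' := toIcoMod hl t a
  set b' := toIcoMod hl t b
  set n := toIcoDiv hl t a
  set m := toIcoDiv hl t b
  rw [zsmul_eq_mul] at ea eb
  have hba : |a - b| = b - a := by rw [abs_sub_comm]; exact abs_of_nonneg (by linarith)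
  rw [hba]
  rcases lt_trichotomy n m with h | h | h
  · have hnm : (n : ℝ) + 1 ≤ m := by exact_mod_cast h
    have k1 := hg a' (t + l)
    have k2 := hg b' t
    rw [h1, sub_zero, abs_of_nonpos (by linarith [ha.2] : a' - (t + l) ≤ 0)] at k1
    rw [h0, sub_zero, abs_of_nonneg (by linarith [hb.1] : 0 ≤ b' - t)] at k2
    have k3 := abs_sub (g a') (g b')
    have k4 : l + b' - a' ≤ b - a := by nlinarith
    nlinarith
  · have e : a' - b' = a - b := by rw [← ea, ← eb, h]; ring
    have := hg a' b'
    rw [e, hba] at this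
    exact this
  · exfalso
    have hnm : (m : ℝ) + 1 ≤ n := by exact_mod_cast h
    nlinarith [ha.1, hb.2]

def clift (w : ℝ → ℝ → ℝ) (z : ℂ) : ℝ := w (Real.exp (min z.re 0)) z.im

lemma exp_diff (a b : ℝ) : |Real.exp a - Real.exp b| ≤ max (Real.exp a) (Real.exp b) * |a - b| := by
  wlog h : b ≤ a generalizing a b
  · rw [abs_sub_comm, max_comm, abs_sub_comm a b]; exact this b a (le_of_not_ge h)
  rw [abs_of_nonneg (sub_nonneg.2 (Real.exp_le_exp.2 h)), max_eq_left (Real.exp_le_exp.2 h),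
    abs_of_nonneg (sub_nonneg.2 h)]
  have h1 := Real.add_one_le_exp (b - a)
  have h2 : Real.exp b = Real.exp a * Real.exp (b - a) := by rw [← Real.exp_add]; congr 1; ring
  rw [h2]
  nlinarith [Real.exp_pos a]

lemma clift_loc {l : ℝ} {w : ℝ → ℝ → ℝ} (hw : ConeLip l 1 w) : ∃ K : NNReal, ∀ z z',
    |clift w z - clift w z'| ≤
      K * (max (Real.exp (min z.re 0)) (Real.exp (min z'.re 0)) * ‖z - z'‖) := by
  obtain ⟨K, hK⟩ := hw.lipschitz
  refine ⟨(2 * |K|).toNNReal, fun z z' => ?_⟩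
  rw [Real.coe_toNNReal _ (by positivity)]
  have hmem : ∀ z : ℂ, Real.exp (min z.re 0) ∈ Icc (0:ℝ) 1 := fun z =>
    ⟨(Real.exp_pos _).le, Real.exp_le_one_iff.2 (min_le_right _ _)⟩
  have h1 := hK (Real.exp (min z.re 0), z.im) (Real.exp (min z'.re 0), z'.im) (hmem z) (hmem z')
  have h2 := coneDist_le (l := l) (θ := z.im) (φ := z'.im) (hmem z).1 (hmem z').1
  have h3 := exp_diff (min z.re 0) (min z'.re 0)
  set M := max (Real.exp (min z.re 0)) (Real.exp (min z'.re 0)) with hM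
  have hM0 : 0 ≤ M := le_max_of_le_left (hmem z).1
  have h4 : |min z.re 0 - min z'.re 0| ≤ ‖z - z'‖ := by
    refine (abs_min_sub_min_le_max _ _ _ _).trans (max_le ?_ (by simp))
    rw [← Complex.sub_re]; exact Complex.abs_re_le_norm _
  have h5 : |z.im - z'.im| ≤ ‖z - z'‖ := by
    rw [← Complex.sub_im]; exact Complex.abs_im_le_norm _
  have h6 : coneDist l (Real.exp (min z.re 0), z.im) (Real.exp (min z'.re 0), z'.im) ≤
      2 * (M * ‖z - z'‖) := by
    have := mul_le_mul_of_nonneg_left h4 hM0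
    have := mul_le_mul_of_nonneg_left h5 hM0
    linarith
  have h7 : 0 ≤ coneDist l (Real.exp (min z.re 0), z.im) (Real.exp (min z'.re 0), z'.im) :=
    Real.sqrt_nonneg _
  refine h1.trans ((mul_le_mul_of_nonneg_right (le_abs_self K) h7).trans ?_)
  have := mul_le_mul_of_nonneg_left h6 (abs_nonneg K)
  linarith

lemma clift_lip {l : ℝ} {w : ℝ → ℝ → ℝ} (hw : ConeLip l 1 w) : ∃ K : NNReal,
    LipschitzWith K (clift w) := by
  obtain ⟨K, hK⟩ := clift_loc hw
  refine ⟨K, LipschitzWith.of_dist_le_mul fun z z' => ?_⟩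
  rw [Real.dist_eq, dist_eq_norm]
  refine (hK z z').trans (mul_le_mul_of_nonneg_left ?_ K.2)
  refine mul_le_of_le_one_left (norm_nonneg _) (max_le ?_ ?_) <;>
  exact Real.exp_le_one_iff.2 (min_le_right _ _)

lemma clift_fderiv {l : ℝ} {w : ℝ → ℝ → ℝ} (hw : ConeLip l 1 w) : ∃ C : ℝ, 0 ≤ C ∧ ∀ z : ℂ,
    ‖fderiv ℝ (clift w) z‖ ≤ C * Real.exp z.re := by
  obtain ⟨K, hK⟩ := clift_loc hw
  refine ⟨K * Real.exp 1, by positivity, fun z => ?_⟩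
  refine norm_fderiv_le_of_lip' ℝ (by positivity) ?_
  filter_upwards [Metric.closedBall_mem_nhds z one_pos] with z' hz'
  rw [Metric.mem_closedBall, dist_eq_norm] at hz'
  rw [Real.norm_eq_abs]
  refine (hK z' z).trans ?_
  rw [mul_assoc, mul_assoc, ← mul_assoc (Real.exp 1)]
  refine mul_le_mul_of_nonneg_left (mul_le_mul_of_nonneg_right ?_ (norm_nonneg _)) K.2
  rw [← Real.exp_add]
  have : z'.re - z.re ≤ 1 := by
    rw [← Complex.sub_re]; exact ((le_abs_self _).trans (Complex.abs_re_le_norm _)).trans hz'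
  refine max_le ?_ ?_ <;> rw [Real.exp_le_exp]
  · exact (min_le_left _ _).trans (by linarith)
  · exact (min_le_left _ _).trans (by linarith)

lemma clift_gdot {l : ℝ} {w : ℝ → ℝ → ℝ} (hw : ConeLip l 1 w) : ∃ C : ℝ, 0 ≤ C ∧ ∀ z : ℂ,
    |gdot (clift w) (clift w) z| ≤ C * Real.exp (2 * z.re) := by
  obtain ⟨C, hC, h⟩ := clift_fderiv hw
  refine ⟨2 * C ^ 2, by positivity, fun z => ?_⟩
  rw [abs_of_nonneg (gdot_self_nonneg _ _)]
  unfold gdot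
  have b : ∀ a : ℂ, ‖a‖ = 1 → fderiv ℝ (clift w) z a * fderiv ℝ (clift w) z a ≤
      (C * Real.exp z.re) ^ 2 := by
    intro a ha
    have h1 := (fderiv ℝ (clift w) z).le_opNorm a
    rw [ha, mul_one] at h1
    have := pow_le_pow_left₀ (norm_nonneg _) (h1.trans (h z)) 2
    rw [Real.norm_eq_abs, sq_abs] at this
    linarith
  have b1 := b 1 (by simp)
  have b2 := b Complex.I (by simp)
  have e : (C * Real.exp z.re) ^ 2 = C ^ 2 * Real.exp (2 * z.re) := by
    rw [mul_pow, ← Real.exp_nat_mul]; norm_num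
  rw [e] at b1 b2
  linarith

/-- potential -/
def pot (lp lm t : ℝ) : ℝ := (if 0 < t then lp else 0) + (if t < 0 then lm else 0)

lemma measurable_pot (lp lm : ℝ) : Measurable (pot lp lm) :=
  (Measurable.ite measurableSet_Ioi measurable_const measurable_const).add
    (Measurable.ite measurableSet_Iio measurable_const measurable_const)

lemma pot_nonneg {lp lm : ℝ} (hlp : 0 ≤ lp) (hlm : 0 ≤ lm) (t : ℝ) : 0 ≤ pot lp lm t := by
  unfold pot; split_ifs <;> linarith

lemma pot_le {lp lm : ℝ} (hlp : 0 ≤ lp) (hlm : 0 ≤ lm) (t : ℝ) : pot lp lm t ≤ lp + lm := by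
  unfold pot; split_ifs <;> linarith

/-- energy density in logarithmic coordinates -/
def dens (lp lm : ℝ) (v : ℂ → ℝ) (z : ℂ) : ℝ :=
  gdot v v z + pot lp lm (v z) * Real.exp (2 * z.re)

lemma meas_dens (lp lm : ℝ) {v : ℂ → ℝ} (hv : Continuous v) : Measurable (dens lp lm v) :=
  (measurable_gdot v v).add (((measurable_pot lp lm).comp hv.measurable).mul (by fun_prop))

lemma dens_bound {l lp lm : ℝ} (hlp : 0 ≤ lp) (hlm : 0 ≤ lm) {w : ℝ → ℝ → ℝ} (hw : ConeLip l 1 w) :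
    ∃ C : ℝ, ∀ z : ℂ, |dens lp lm (clift w) z| ≤ C * Real.exp (2 * z.re) := by
  obtain ⟨C, hC, h⟩ := clift_gdot hw
  refine ⟨C + (lp + lm), fun z => ?_⟩
  unfold dens
  refine (abs_add_le _ _).trans ?_
  rw [abs_mul, Real.abs_exp, abs_of_nonneg (pot_nonneg hlp hlm _), add_mul]
  exact add_le_add (h z) (mul_le_mul_of_nonneg_right (pot_le hlp hlm _) (Real.exp_pos _).le)

def cpt (p : ℝ × ℝ) : ℂ := ⟨p.1, p.2⟩

lemma cont_cpt : Continuous cpt := Complex.equivRealProdCLM.symm.continuous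

lemma strip_int {G : ℂ → ℝ} (hG : Measurable G) {C : ℝ} (hb : ∀ z, |G z| ≤ C * Real.exp (2 * z.re))
    (a b : ℝ) : IntegrableOn (fun p : ℝ × ℝ => G (cpt p)) (Iio 0 ×ˢ Ioo a b) := by
  have h1 : Integrable (fun s : ℝ => C * Real.exp (2 * s)) (volume.restrict (Iio 0)) := by
    have := (integrableOn_exp_mul_Iic (a := 2) (by norm_num) 0).mono_set Iio_subset_Iic_self
    exact this.const_mul C
  have h2 : Integrable (fun _ : ℝ => (1:ℝ)) (volume.restrict (Ioo a b)) := by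
    rw [integrable_const_iff]; right; exact ⟨by simp⟩
  have h3 := h1.mul_prod h2
  rw [Measure.prod_restrict, ← Measure.volume_eq_prod] at h3
  refine Integrable.mono' h3 (hG.comp cont_cpt.measurable).aestronglyMeasurable ?_
  refine Filter.Eventually.of_forall fun p => ?_
  have := hb (cpt p)
  rw [mul_one]
  exact this

lemma strip_shift {G : ℂ → ℝ} (hG : Measurable G) {C l : ℝ} (hl : 0 < l)
    (hb : ∀ z, |G z| ≤ C * Real.exp (2 * z.re))
    (hp : ∀ s θ, G (cpt (s, θ + l)) = G (cpt (s, θ))) (t : ℝ) :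
    ∫ p in Iio (0:ℝ) ×ˢ Ioo (0:ℝ) l, G (cpt p) =
      ∫ p in Iio (0:ℝ) ×ˢ Ioo t (t + l), G (cpt p) := by
  have h1 := strip_int hG hb 0 l
  have h2 := strip_int hG hb t (t + l)
  rw [Measure.volume_eq_prod] at h1 h2 ⊢
  rw [setIntegral_prod _ h1, setIntegral_prod _ h2]
  congr 1; ext1 s
  rw [← integral_Ioc_eq_integral_Ioo, ← integral_Ioc_eq_integral_Ioo,
    ← intervalIntegral.integral_of_le hl.le, ← intervalIntegral.integral_of_le (by linarith)]
  have := Function.Periodic.intervalIntegral_add_eq (f := fun θ => G (cpt (s, θ))) (T := l)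
    (fun θ => hp s θ) 0 t
  rwa [zero_add] at this

lemma mp_cpt : MeasurePreserving cpt := Complex.volume_preserving_equiv_real_prod.symm

lemma emb_cpt : MeasurableEmbedding cpt := Complex.measurableEquivRealProd.symm.measurableEmbedding

lemma clift_log {w : ℝ → ℝ → ℝ} {r θ : ℝ} (h0 : 0 < r) (h1 : r < 1) :
    clift w ⟨Real.log r, θ⟩ = w r θ := by
  unfold clift
  simp only
  rw [min_eq_left (Real.log_nonpos h0.le h1.le), Real.exp_log h0]

lemma clift_exp {w : ℝ → ℝ → ℝ} {s θ : ℝ} (h0 : s < 0) :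
    clift w ⟨s, θ⟩ = w (Real.exp s) θ := by
  unfold clift
  simp only
  rw [min_eq_left h0.le]

lemma gradSq_exp {w : ℝ → ℝ → ℝ} {s θ : ℝ} (hs : s < 0)
    (hd : DifferentiableAt ℝ (clift w) (cpt (s, θ))) :
    gradSq w (Real.exp s, θ) * Real.exp s * Real.exp s = gdot (clift w) (clift w) (cpt (s, θ)) := by
  have hes := Real.exp_pos s
  have he1 : Real.exp s < 1 := Real.exp_lt_one_iff.2 hs
  have hf := hd.hasFDerivAt
  set L := fderiv ℝ (clift w) (cpt (s, θ)) with hL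
  have d1 : HasDerivAt (fun r => w r θ) (L 1 * (Real.exp s)⁻¹) (Real.exp s) := by
    have a1 : HasDerivAt (fun r : ℝ => (⟨Real.log r, θ⟩ : ℂ)) (((Real.exp s)⁻¹ : ℝ) : ℂ) (Real.exp s) := by
      have := ((Real.hasDerivAt_log hes.ne').ofReal_comp).add_const ((θ : ℂ) * Complex.I)
      refine this.congr_of_eventuallyEq (Filter.Eventually.of_forall fun r => ?_)
      exact Complex.mk_eq_add_mul_I _ _
    have e : (⟨Real.log (Real.exp s), θ⟩ : ℂ) = cpt (s, θ) := by rw [Real.log_exp]; rfl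
    have a2 := HasFDerivAt.comp_hasDerivAt (Real.exp s) (f := fun r : ℝ => (⟨Real.log r, θ⟩ : ℂ))
      (l := clift w) (l' := L) (by rw [e]; exact hf) a1
    have a3 : L (((Real.exp s)⁻¹ : ℝ) : ℂ) = L 1 * (Real.exp s)⁻¹ := by
      rw [clm_decomp, Complex.ofReal_re, Complex.ofReal_im]; ring
    rw [a3] at a2
    refine a2.congr_of_eventuallyEq ?_
    filter_upwards [Ioo_mem_nhds hes he1] with r hr
    exact (clift_log hr.1 hr.2).symm
  have d2 : HasDerivAt (fun φ => w (Real.exp s) φ) (L Complex.I) θ := by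
    have a1 : HasDerivAt (fun φ : ℝ => (⟨s, φ⟩ : ℂ)) Complex.I θ := by
      have := (((hasDerivAt_id θ).ofReal_comp).mul_const Complex.I).const_add (s : ℂ)
      simp only [Complex.ofReal_one, one_mul] at this
      refine this.congr_of_eventuallyEq (Filter.Eventually.of_forall fun r => ?_)
      exact Complex.mk_eq_add_mul_I _ _
    have a2 := HasFDerivAt.comp_hasDerivAt θ (f := fun φ : ℝ => (⟨s, φ⟩ : ℂ))
      (l := clift w) (l' := L) hf a1
    refine a2.congr_of_eventuallyEq (Filter.Eventually.of_forall fun φ => ?_)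
    exact (clift_exp hs).symm
  unfold gradSq gdot
  simp only
  rw [d1.deriv, d2.deriv, ← hL]
  field_simp

lemma image_exp (l : ℝ) : (fun p : ℝ × ℝ => (Real.exp p.1, p.2)) '' (Iio 0 ×ˢ Ioo 0 l) =
    Ioo (0:ℝ) 1 ×ˢ Ioo 0 l := by
  ext p
  constructor
  · rintro ⟨q, hq, rfl⟩
    exact ⟨⟨Real.exp_pos _, Real.exp_lt_one_iff.2 hq.1⟩, hq.2⟩
  · intro hp
    exact ⟨(Real.log p.1, p.2), ⟨Real.log_neg hp.1.1 hp.1.2, hp.2⟩,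
      by simp only; rw [Real.exp_log hp.1.1]⟩

lemma J_formula {l lp lm : ℝ} {w : ℝ → ℝ → ℝ} (hw : ConeLip l 1 w) :
    Jfun l lp lm w 1 = ∫ p in Iio (0:ℝ) ×ˢ Ioo (0:ℝ) l, dens lp lm (clift w) (cpt p) := by
  obtain ⟨K, hK⟩ := clift_lip hw
  unfold Jfun
  have hms : MeasurableSet (Iio (0:ℝ) ×ˢ Ioo (0:ℝ) l) := measurableSet_Iio.prod measurableSet_Ioo
  let D : ℝ × ℝ → (ℝ × ℝ →L[ℝ] ℝ × ℝ) := fun p =>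
    ((ContinuousLinearMap.toSpanSingleton ℝ (Real.exp p.1)).prodMap (ContinuousLinearMap.id ℝ ℝ))
  have hdet : ∀ p, |(D p).det| = Real.exp p.1 := by
    intro p
    have : (D p).det = Real.exp p.1 := by
      rw [ContinuousLinearMap.det]
      have e : ((D p : ℝ × ℝ →L[ℝ] ℝ × ℝ) : ℝ × ℝ →ₗ[ℝ] ℝ × ℝ) =
        LinearMap.prodMap (LinearMap.toSpanSingleton ℝ ℝ (Real.exp p.1)) LinearMap.id := rfl
      rw [e, LinearMap.det_prodMap]
      simp [LinearMap.det_ring]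
    rw [this, Real.abs_exp]
  have hD : ∀ p ∈ Iio (0:ℝ) ×ˢ Ioo (0:ℝ) l, HasFDerivWithinAt
      (fun p : ℝ × ℝ => (Real.exp p.1, p.2)) (D p) (Iio (0:ℝ) ×ˢ Ioo (0:ℝ) l) p := by
    intro p _
    refine HasFDerivAt.hasFDerivWithinAt ?_
    exact HasFDerivAt.prodMap p (f := Real.exp) (f₂ := fun x : ℝ => x)
      (Real.hasDerivAt_exp p.1).hasFDerivAt (hasFDerivAt_id p.2)
  have hinj : InjOn (fun p : ℝ × ℝ => (Real.exp p.1, p.2)) (Iio (0:ℝ) ×ˢ Ioo (0:ℝ) l) := by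
    intro p _ q _ h
    simp only [Prod.mk.injEq, Real.exp_eq_exp] at h
    exact Prod.ext h.1 h.2
  rw [← image_exp l, integral_image_eq_integral_abs_det_fderiv_smul volume hms hD hinj]
  refine setIntegral_congr_ae hms ?_
  have hae := mp_cpt.quasiMeasurePreserving.ae hK.ae_differentiableAt
  filter_upwards [hae] with p hp hpm
  rw [hdet, smul_eq_mul]
  have := gradSq_exp (θ := p.2) hpm.1 hp
  unfold dens
  change _ = gdot (clift w) (clift w) (cpt (p.1, p.2)) + _
  rw [← this]
  have e1 : clift w (cpt p) = w (Real.exp p.1) p.2 := clift_exp hpm.1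
  have e2 : Real.exp (2 * (cpt p).re) = Real.exp p.1 * Real.exp p.1 := by
    rw [← Real.exp_add]; congr 1; change 2 * p.1 = _; ring
  rw [e1, e2]
  unfold pot
  ring

/-- the strip -/
def strip (t l : ℝ) : Set ℂ := {z | z.re < 0 ∧ t < z.im ∧ z.im < t + l}

lemma strip_open (t l : ℝ) : IsOpen (strip t l) :=
  (isOpen_lt Complex.continuous_re continuous_const).inter
    ((isOpen_lt continuous_const Complex.continuous_im).inter
      (isOpen_lt Complex.continuous_im continuous_const))

lemma strip_eq (t l : ℝ) (G : ℂ → ℝ) : ∫ p in Iio (0:ℝ) ×ˢ Ioo t (t + l), G (cpt p) =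
    ∫ z in strip t l, G z :=
  mp_cpt.setIntegral_preimage_emb emb_cpt G (strip t l)

lemma clift_per {l : ℝ} {w : ℝ → ℝ → ℝ} (hw : ConeLip l 1 w) (z : ℂ) :
    clift w (z + l * Complex.I) = clift w z := by
  unfold clift
  simp [hw.periodic]

lemma fderiv_per {v : ℂ → ℝ} {a : ℂ} (h : ∀ z, v (z + a) = v z) (z : ℂ) :
    fderiv ℝ v (z + a) = fderiv ℝ v z := by
  rw [← fderiv_comp_add_right]
  congr 1; ext1 x; exact h x

lemma dens_per {l lp lm : ℝ} {w : ℝ → ℝ → ℝ} (hw : ConeLip l 1 w) (s θ : ℝ) :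
    dens lp lm (clift w) (cpt (s, θ + l)) = dens lp lm (clift w) (cpt (s, θ)) := by
  have e : cpt (s, θ + l) = cpt (s, θ) + l * Complex.I := by
    apply Complex.ext <;> simp [cpt]
  unfold dens gdot
  rw [e, fderiv_per (clift_per hw), clift_per hw]
  simp

lemma strip_integrable {l lp lm : ℝ} (hlp : 0 ≤ lp) (hlm : 0 ≤ lm)
    {w : ℝ → ℝ → ℝ} (hw : ConeLip l 1 w) (t : ℝ) :
    IntegrableOn (dens lp lm (clift w)) (strip t l) := by
  obtain ⟨K, hK⟩ := clift_lip hw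
  obtain ⟨C, hC⟩ := dens_bound hlp hlm hw
  have := strip_int (meas_dens lp lm hK.continuous) hC t (t + l)
  exact (mp_cpt.integrableOn_comp_preimage emb_cpt (s := strip t l)).1 this

lemma J_strip {l lp lm : ℝ} (hl : 0 < l) (hlp : 0 ≤ lp) (hlm : 0 ≤ lm)
    {w : ℝ → ℝ → ℝ} (hw : ConeLip l 1 w) (t : ℝ) :
    Jfun l lp lm w 1 = ∫ z in strip t l, dens lp lm (clift w) z := by
  obtain ⟨K, hK⟩ := clift_lip hw
  obtain ⟨C, hC⟩ := dens_bound hlp hlm hw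
  rw [J_formula hw, strip_shift (meas_dens lp lm hK.continuous) hl hC (dens_per hw) t, strip_eq]

lemma Dir_strip {l : ℝ} (hl : 0 < l)
    {w : ℝ → ℝ → ℝ} (hw : ConeLip l 1 w) (t : ℝ) :
    Dir l w 1 = ∫ z in strip t l, gdot (clift w) (clift w) z := by
  have h := J_strip hl le_rfl le_rfl hw t
  have e : Jfun l 0 0 w 1 = Dir l w 1 := by unfold Jfun Dir; simp
  rw [← e, h]
  congr 1; ext1 z; unfold dens pot; simp

/-- periodization -/
def pz (η : ℂ → ℝ) {l : ℝ} (hl : 0 < l) (t : ℝ) (z : ℂ) : ℝ := η ⟨z.re, toIcoMod hl t z.im⟩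

/-- admissible test functions -/
structure Adm (η : ℂ → ℝ) (K' : NNReal) (l t s0 B : ℝ) : Prop where
  lip : LipschitzWith K' η
  bdd : ∀ z, |η z| ≤ B
  supp : ∀ z, η z ≠ 0 → s0 < z.re ∧ z.re < 0 ∧ t < z.im ∧ z.im < t + l

lemma Adm.dre {η : ℂ → ℝ} {K' : NNReal} {l t s0 B : ℝ} (h : Adm η K' l t s0 B) (a b y : ℝ) :
    |η ⟨a, y⟩ - η ⟨b, y⟩| ≤ K' * |a - b| := by
  have := h.lip.dist_le_mul ⟨a, y⟩ ⟨b, y⟩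
  rw [Real.dist_eq, dist_eq_norm] at this
  refine this.trans (le_of_eq ?_)
  have e : (⟨a, y⟩ : ℂ) - ⟨b, y⟩ = ((a - b : ℝ) : ℂ) := by apply Complex.ext <;> simp
  rw [e, Complex.norm_real, Real.norm_eq_abs]

lemma Adm.dim {η : ℂ → ℝ} {K' : NNReal} {l t s0 B : ℝ} (h : Adm η K' l t s0 B) (s a b : ℝ) :
    |η ⟨s, a⟩ - η ⟨s, b⟩| ≤ K' * |a - b| := by
  have := h.lip.dist_le_mul ⟨s, a⟩ ⟨s, b⟩
  rw [Real.dist_eq, dist_eq_norm] at this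
  refine this.trans (le_of_eq ?_)
  have e : (⟨s, a⟩ : ℂ) - ⟨s, b⟩ = ((a - b : ℝ) : ℂ) * Complex.I := by apply Complex.ext <;> simp
  rw [e, norm_mul, Complex.norm_I, mul_one, Complex.norm_real, Real.norm_eq_abs]

lemma Adm.pz_dim {η : ℂ → ℝ} {K' : NNReal} {l t s0 B : ℝ} (h : Adm η K' l t s0 B) (hl : 0 < l)
    (s a b : ℝ) : |pz η hl t ⟨s, a⟩ - pz η hl t ⟨s, b⟩| ≤ K' * |a - b| := by
  refine per_lip (g := fun y => η ⟨s, y⟩) K'.2 hl (fun a b => h.dim s a b) ?_ ?_ a b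
  · by_contra hne; have := (h.supp _ hne).2.2.1; simp at this
  · by_contra hne; have := (h.supp _ hne).2.2.2; simp at this

lemma pz_per (η : ℂ → ℝ) {l : ℝ} (hl : 0 < l) (t s θ : ℝ) (k : ℤ) :
    pz η hl t ⟨s, θ + k * l⟩ = pz η hl t ⟨s, θ⟩ := by
  unfold pz
  simp only
  rw [← zsmul_eq_mul, toIcoMod_add_zsmul]

lemma Adm.pz_inf {η : ℂ → ℝ} {K' : NNReal} {l t s0 B : ℝ} (h : Adm η K' l t s0 B) (hl : 0 < l)
    (s a b : ℝ) : |pz η hl t ⟨s, a⟩ - pz η hl t ⟨s, b⟩| ≤ K' * ⨅ k : ℤ, |a - b + (k : ℝ) * l| := by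
  rw [Real.mul_iInf_of_nonneg (NNReal.coe_nonneg K')]
  refine le_ciInf fun k => ?_
  rw [← pz_per η hl t s a k]
  refine (h.pz_dim hl s _ _).trans (le_of_eq ?_)
  congr 2; ring

lemma Adm.pz_min {η : ℂ → ℝ} {K' : NNReal} {l t s0 B : ℝ} (h : Adm η K' l t s0 B) (hl : 0 < l)
    (s a b : ℝ) : |pz η hl t ⟨s, a⟩ - pz η hl t ⟨s, b⟩| ≤
      (K' + 2 * B / Real.pi) * min (⨅ k : ℤ, |a - b + (k : ℝ) * l|) Real.pi := by
  have hpi := Real.pi_pos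
  have hB : 0 ≤ B := (abs_nonneg _).trans (h.bdd 0)
  have h0 := inf_nonneg l (a - b)
  have hK := K'.2
  rcases le_total (⨅ k : ℤ, |a - b + (k : ℝ) * l|) Real.pi with hc | hc
  · rw [min_eq_left hc]
    refine (h.pz_inf hl s a b).trans (mul_le_mul_of_nonneg_right ?_ h0)
    have : 0 ≤ 2 * B / Real.pi := by positivity
    linarith
  · rw [min_eq_right hc]
    have h1 := abs_sub (pz η hl t ⟨s, a⟩) (pz η hl t ⟨s, b⟩)
    have h2 : |pz η hl t ⟨s, a⟩| ≤ B := h.bdd _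
    have h3 : |pz η hl t ⟨s, b⟩| ≤ B := h.bdd _
    have e : (K' + 2 * B / Real.pi) * Real.pi = K' * Real.pi + 2 * B := by field_simp
    rw [e]
    have : 0 ≤ (K':ℝ) * Real.pi := by positivity
    linarith

lemma log_lip {r0 a b : ℝ} (h0 : 0 < r0) (ha : r0 ≤ a) (hb : r0 ≤ b) :
    |Real.log a - Real.log b| ≤ r0⁻¹ * |a - b| := by
  wlog hab : b ≤ a generalizing a b
  · rw [abs_sub_comm, abs_sub_comm a b]; exact this hb ha (le_of_not_ge hab)
  have hb0 : 0 < b := h0.trans_le hb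
  have ha0 : 0 < a := h0.trans_le ha
  rw [abs_of_nonneg (sub_nonneg.2 (Real.log_le_log hb0 hab)), abs_of_nonneg (sub_nonneg.2 hab),
    ← Real.log_div ha0.ne' hb0.ne']
  refine (Real.log_le_sub_one_of_pos (by positivity)).trans ?_
  have : a / b - 1 = b⁻¹ * (a - b) := by field_simp
  rw [this]
  exact mul_le_mul_of_nonneg_right (inv_anti₀ h0 hb) (by linarith)

lemma Adm.pz_zero {η : ℂ → ℝ} {K' : NNReal} {l t s0 B : ℝ} (h : Adm η K' l t s0 B) (hl : 0 < l)
    {z : ℂ} (hz : z.re ≤ s0 ∨ 0 ≤ z.re) : pz η hl t z = 0 := by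
  by_contra hne
  have h1 := h.supp _ hne
  rcases hz with hz | hz
  · exact absurd h1.1 (not_lt.2 hz)
  · exact absurd h1.2.1 (not_lt.2 hz)

lemma Adm.pz_cut {η : ℂ → ℝ} {K' : NNReal} {l t s0 B : ℝ} (h : Adm η K' l t s0 B) (hl : 0 < l)
    {r : ℝ} (hr : 0 ≤ r) (θ : ℝ) :
    pz η hl t ⟨Real.log r, θ⟩ = pz η hl t ⟨Real.log (max r (Real.exp s0)), θ⟩ := by
  rcases le_total r (Real.exp s0) with hc | hc
  · rw [max_eq_right hc, h.pz_zero hl (z := ⟨Real.log (Real.exp s0), θ⟩) (by simp)]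
    apply h.pz_zero hl
    rcases hr.eq_or_lt with h0 | h0
    · right; simp [← h0]
    · left; exact (Real.log_le_iff_le_exp h0).2 hc
  · rw [max_eq_left hc]

lemma Adm.pz_r {η : ℂ → ℝ} {K' : NNReal} {l t s0 B : ℝ} (h : Adm η K' l t s0 B) (hl : 0 < l)
    {r s : ℝ} (hr : 0 ≤ r) (hs : 0 ≤ s) (θ : ℝ) :
    |pz η hl t ⟨Real.log r, θ⟩ - pz η hl t ⟨Real.log s, θ⟩| ≤ K' * ((Real.exp s0)⁻¹ * |r - s|) := by
  rw [h.pz_cut hl hr, h.pz_cut hl hs]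
  refine (h.dre _ _ _).trans (mul_le_mul_of_nonneg_left ?_ K'.2)
  refine (log_lip (Real.exp_pos s0) (le_max_right _ _) (le_max_right _ _)).trans
    (mul_le_mul_of_nonneg_left ?_ (by positivity))
  refine (abs_max_sub_max_le_max _ _ _ _).trans (max_le le_rfl (by simp))

def compW (u : ℝ → ℝ → ℝ) (ψ : ℂ → ℝ) (r θ : ℝ) : ℝ := u r θ + ψ ⟨Real.log r, θ⟩

lemma Adm.comp_lip {η : ℂ → ℝ} {K' : NNReal} {l t s0 B : ℝ} (h : Adm η K' l t s0 B) (hl : 0 < l)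
    {u : ℝ → ℝ → ℝ} (hu : ConeLip l 1 u) : ConeLip l 1 (compW u (pz η hl t)) where
  periodic := by
    intro r θ
    unfold compW
    rw [hu.periodic]
    have := pz_per η hl t (Real.log r) θ 1
    rw [Int.cast_one, one_mul] at this
    rw [this]
  lipschitz := by
    obtain ⟨K, hK⟩ := hu.lipschitz
    set r0 := Real.exp s0 with hr0
    have hr0p : 0 < r0 := Real.exp_pos _
    have hB : 0 ≤ B := (abs_nonneg _).trans (h.bdd 0)
    have hpi := Real.pi_pos
    set A := (K' + 2 * B / Real.pi) with hA
    have hA0 : 0 ≤ A := by positivity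
    refine ⟨K + (K' * r0⁻¹ + A * (r0⁻¹ * Real.pi)), fun p q hp hq => ?_⟩
    have h1 := hK p q hp hq
    have h2 := h.pz_r hl hp.1 hq.1 p.2
    have h3 : |p.1 - q.1| ≤ coneDist l p q := coneDist_ge1 (l := l) (θ := p.2) (φ := q.2) hp.1 hq.1
    have hd0 : 0 ≤ coneDist l p q := Real.sqrt_nonneg _
    have h4 : |pz η hl t ⟨Real.log q.1, p.2⟩ - pz η hl t ⟨Real.log q.1, q.2⟩| ≤
        A * (r0⁻¹ * Real.pi) * coneDist l p q := by
      rcases le_total r0 q.1 with hc | hc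
      · refine (h.pz_min hl _ _ _).trans ?_
        rw [mul_assoc, mul_assoc]
        refine mul_le_mul_of_nonneg_left ?_ hA0
        rw [inv_mul_eq_div, le_div_iff₀ hr0p]
        have h5 : q.1 * min (⨅ k : ℤ, |p.2 - q.2 + (k : ℝ) * l|) Real.pi ≤
          Real.pi * coneDist l p q := coneDist_ge2 (l := l) (θ := p.2) (φ := q.2) hp.1 hq.1
        have h6 : 0 ≤ min (⨅ k : ℤ, |p.2 - q.2 + (k : ℝ) * l|) Real.pi :=
          le_min (inf_nonneg _ _) hpi.le
        nlinarith [mul_le_mul_of_nonneg_right hc h6]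
      · rw [h.pz_cut hl hq.1 p.2, h.pz_cut hl hq.1 q.2, ← hr0, max_eq_right hc, hr0, Real.log_exp,
          h.pz_zero hl (Or.inl le_rfl), h.pz_zero hl (Or.inl le_rfl), sub_zero, abs_zero]
        positivity
    unfold compW
    have e : u p.1 p.2 + pz η hl t ⟨Real.log p.1, p.2⟩ - (u q.1 q.2 + pz η hl t ⟨Real.log q.1, q.2⟩)
      = (u p.1 p.2 - u q.1 q.2) +
        ((pz η hl t ⟨Real.log p.1, p.2⟩ - pz η hl t ⟨Real.log q.1, p.2⟩) +
        (pz η hl t ⟨Real.log q.1, p.2⟩ - pz η hl t ⟨Real.log q.1, q.2⟩)) := by ring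
    rw [e]
    refine (abs_add_le _ _).trans ?_
    have h7 := abs_add_le (pz η hl t ⟨Real.log p.1, p.2⟩ - pz η hl t ⟨Real.log q.1, p.2⟩)
      (pz η hl t ⟨Real.log q.1, p.2⟩ - pz η hl t ⟨Real.log q.1, q.2⟩)
    have h8 : (K':ℝ) * (r0⁻¹ * |p.1 - q.1|) ≤ K' * r0⁻¹ * coneDist l p q := by
      rw [mul_assoc]; gcongr
    linarith

lemma Adm.clift_comp {η : ℂ → ℝ} {K' : NNReal} {l t s0 B : ℝ} (h : Adm η K' l t s0 B) (hl : 0 < l)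
    (u : ℝ → ℝ → ℝ) : clift (compW u (pz η hl t)) = fun z => clift u z + pz η hl t z := by
  ext1 z
  unfold clift compW
  rw [Real.log_exp]
  congr 1
  rcases le_total z.re 0 with hz | hz
  · rw [min_eq_left hz]
  · rw [min_eq_right hz, h.pz_zero hl (Or.inr hz), h.pz_zero hl (Or.inr le_rfl)]

lemma pz_strip (η : ℂ → ℝ) {l : ℝ} (hl : 0 < l) {t : ℝ} {z : ℂ} (hz : z ∈ strip t l) :
    pz η hl t z = η z := by
  unfold pz
  rw [(toIcoMod_eq_self hl).2 ⟨hz.2.1.le, hz.2.2⟩]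

lemma gdot_add {v η : ℂ → ℝ} {z : ℂ} (hv : DifferentiableAt ℝ v z) (hη : DifferentiableAt ℝ η z) :
    gdot (fun z => v z + η z) (fun z => v z + η z) z =
      gdot v v z + (2 * gdot v η z + gdot η η z) := by
  unfold gdot
  rw [fderiv_fun_add hv hη]
  simp only [add_apply]
  ring

lemma Adm.min_ineq {η : ℂ → ℝ} {K' : NNReal} {l t s0 B lp lm : ℝ} (h : Adm η K' l t s0 B)
    (hl : 0 < l) (hlp : 0 ≤ lp) (hlm : 0 ≤ lm) {u : ℝ → ℝ → ℝ} (hu : IsMinimizerJ l lp lm 1 u)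
    {x : ℂ} {ρ : ℝ} (hs : Metric.closedBall x ρ ⊆ strip t l)
    (hz : ∀ z, z ∉ Metric.closedBall x ρ → η z = 0) :
    0 ≤ ∫ z in Metric.closedBall x ρ, (2 * gdot (clift u) η z + gdot η η z +
      (pot lp lm (clift u z + η z) - pot lp lm (clift u z)) * Real.exp (2 * z.re)) := by
  obtain ⟨K, hK⟩ := clift_lip hu.1
  have hw := h.comp_lip hl hu.1
  have hJ := hu.2 _ hw (fun θ => by
    unfold compW
    rw [Real.log_one, h.pz_zero hl (Or.inr le_rfl), add_zero])
  rw [J_strip hl hlp hlm hu.1 t, J_strip hl hlp hlm hw t, ← sub_nonneg,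
    ← integral_sub (strip_integrable hlp hlm hw t) (strip_integrable hlp hlm hu.1 t)] at hJ
  refine hJ.trans (le_of_eq ?_)
  rw [← setIntegral_eq_of_subset_of_forall_sdiff_eq_zero (strip_open t l).measurableSet hs]
  · refine setIntegral_congr_ae (strip_open t l).measurableSet ?_
    filter_upwards [hK.ae_differentiableAt, h.lip.ae_differentiableAt] with z d1 d2 hm
    have heq : pz η hl t =ᶠ[nhds z] η := by
      filter_upwards [(strip_open t l).mem_nhds hm] with y hy using pz_strip η hl hy
    have hf : fderiv ℝ (fun z => clift u z + pz η hl t z) z =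
        fderiv ℝ (fun z => clift u z + η z) z :=
      Filter.EventuallyEq.fderiv_eq (heq.mono fun y hy => by simp only [hy])
    have e1 : gdot (fun z => clift u z + pz η hl t z) (fun z => clift u z + pz η hl t z) z =
        gdot (fun z => clift u z + η z) (fun z => clift u z + η z) z := by
      unfold gdot; rw [hf]
    rw [h.clift_comp hl u]
    unfold dens
    rw [e1, gdot_add d1 d2]; simp only [pz_strip η hl hm]
    ring
  · intro z hzm
    have h0 : η =ᶠ[nhds z] fun _ => 0 := by
      filter_upwards [Metric.isClosed_closedBall.isOpen_compl.mem_nhds hzm.2] with y hy using hz y hy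
    have hf : fderiv ℝ η z = 0 := by rw [h0.fderiv_eq]; simp
    rw [hz z hzm.2]
    unfold gdot
    rw [hf]
    simp

lemma pot_same (lp lm : ℝ) {a b : ℝ} (h : |b| ≤ |a| / 2) : pot lp lm (a + b) = pot lp lm a := by
  unfold pot
  rcases lt_trichotomy a 0 with ha | ha | ha
  · rw [abs_of_neg ha] at h
    have := abs_le.1 h
    rw [if_neg (by linarith), if_pos (by linarith), if_neg (by linarith), if_pos ha]
  · subst ha
    have : b = 0 := by simpa using h
    simp [this]
  · rw [abs_of_pos ha] at h
    have := abs_le.1 h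
    rw [if_pos (by linarith), if_neg (by linarith), if_pos ha, if_neg (by linarith)]

lemma ball_strip {l R : ℝ} {c : ℂ} (hRl : R < l / 2) (hRc : c.re + R < 0) :
    Metric.closedBall c R ⊆ strip (c.im - l / 2) l := by
  intro z hz
  rw [mem_closedBall_iff_norm] at hz
  have h1 := abs_le.1 ((Complex.abs_re_le_norm (z - c)).trans hz)
  have h2 := abs_le.1 ((Complex.abs_im_le_norm (z - c)).trans hz)
  simp only [Complex.sub_re, Complex.sub_im] at h1 h2
  refine ⟨?_, ?_, ?_⟩ <;> linarith

lemma mk_adm {l R : ℝ} {c : ℂ} (hRl : R < l / 2) (hRc : c.re + R < 0)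
    {η : ℂ → ℝ} {K' : NNReal} {x : ℂ} {ρ : ℝ} (hη : LipschitzWith K' η)
    (hs : Metric.closedBall x ρ ⊆ Metric.closedBall c R)
    (hz : ∀ z, z ∉ Metric.closedBall x ρ → η z = 0) :
    ∃ B, Adm η K' l (c.im - l / 2) (c.re - R - 1) B := by
  obtain ⟨B, hB⟩ := (isCompact_closedBall x ρ).exists_bound_of_continuousOn hη.continuous.continuousOn
  refine ⟨max B 0, hη, ?_, ?_⟩
  · intro z
    by_cases hm : z ∈ Metric.closedBall x ρ
    · exact (hB z hm).trans (le_max_left _ _)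
    · rw [hz z hm]; simp
  · intro z hne
    have hm : z ∈ Metric.closedBall x ρ := by by_contra h; exact hne (hz z h)
    have h1 := ball_strip hRl hRc (hs hm)
    have hm' := hs hm
    rw [mem_closedBall_iff_norm] at hm'
    have h2 := abs_le.1 ((Complex.abs_re_le_norm (z - c)).trans hm')
    simp only [Complex.sub_re] at h2
    exact ⟨by linarith, h1⟩

lemma mk_locmin {l lp lm R : ℝ} {c : ℂ} (hl : 0 < l) (hlp : 0 ≤ lp) (hlm : 0 ≤ lm)
    (hRl : R < l / 2) (hRc : c.re + R < 0) {u : ℝ → ℝ → ℝ} (hu : IsMinimizerJ l lp lm 1 u)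
    (hD : Dir l u 1 ≤ 1) : ∃ K, LocMin (clift u) K (lp + lm) c R := by
  obtain ⟨K, hK⟩ := clift_lip hu.1
  refine ⟨K, hK, by linarith, ?_, ?_, ?_⟩
  · intro η K' x ρ hη hρ hs hz
    obtain ⟨B, hA⟩ := mk_adm hRl hRc hη hs hz
    have hst := hs.trans (ball_strip hRl hRc)
    have h := hA.min_ineq hl hlp hlm hu hst hz
    have i1 := ion_gdot hK hη x ρ
    have i2 := ion_gdot hη hη x ρ
    have hfin : volume (Metric.closedBall x ρ) < ⊤ := measure_closedBall_lt_top
    have hc : IntegrableOn (fun _ : ℂ => lp + lm) (Metric.closedBall x ρ) :=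
      integrableOn_const hfin.ne
    have hmeas : Measurable (fun z : ℂ => (pot lp lm (clift u z + η z) - pot lp lm (clift u z)) *
        Real.exp (2 * z.re)) := by
      refine Measurable.mul (Measurable.sub ?_ ?_) (by fun_prop)
      · exact (measurable_pot lp lm).comp (hK.continuous.add hη.continuous).measurable
      · exact (measurable_pot lp lm).comp hK.continuous.measurable
    have hb : ∀ z ∈ Metric.closedBall x ρ, |(pot lp lm (clift u z + η z) - pot lp lm (clift u z)) *
        Real.exp (2 * z.re)| ≤ lp + lm := by
      intro z hm
      have e1 : Real.exp (2 * z.re) ≤ 1 := Real.exp_le_one_iff.2 (by linarith [(hst hm).1])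
      have a1 := pot_nonneg hlp hlm (clift u z + η z)
      have a2 := pot_nonneg hlp hlm (clift u z)
      have b1 := pot_le hlp hlm (clift u z + η z)
      have b2 := pot_le hlp hlm (clift u z)
      rw [abs_mul, abs_of_pos (Real.exp_pos _)]
      calc _ ≤ (lp + lm) * 1 := mul_le_mul (abs_le.2 ⟨by linarith, by linarith⟩) e1
            (Real.exp_pos _).le (by linarith)
        _ = _ := mul_one _
    have i3 : IntegrableOn (fun z : ℂ => (pot lp lm (clift u z + η z) - pot lp lm (clift u z)) *
        Real.exp (2 * z.re)) (Metric.closedBall x ρ) :=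
      Measure.integrableOn_of_bounded (M := lp + lm) hfin.ne hmeas.aestronglyMeasurable
        ((ae_restrict_iff' Metric.isClosed_closedBall.measurableSet).2
          (Filter.Eventually.of_forall fun z hm => hb z hm))
    have i4 : IntegrableOn (fun z => 2 * gdot (clift u) η z + gdot η η z) (Metric.closedBall x ρ) :=
      (i1.const_mul 2).add i2
    rw [integral_add i4 i3, integral_add (i1.const_mul 2) i2,
      integral_const_mul] at h
    have h3 : ∫ z in Metric.closedBall x ρ, (pot lp lm (clift u z + η z) - pot lp lm (clift u z)) *
        Real.exp (2 * z.re) ≤ (lp + lm) * (Real.pi * ρ ^ 2) := by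
      refine (setIntegral_mono_on i3 hc Metric.isClosed_closedBall.measurableSet
        (fun z hm => (le_abs_self _).trans (hb z hm))).trans (le_of_eq ?_)
      rw [setIntegral_const, vol_closedBall x hρ.le, smul_eq_mul, mul_comm]
    linarith
  · intro η K' x ρ hη hρ hs hz hh
    obtain ⟨B, hA⟩ := mk_adm hRl hRc hη hs hz
    have hst := hs.trans (ball_strip hRl hRc)
    have h := hA.min_ineq hl hlp hlm hu hst hz
    have i1 := ion_gdot hK hη x ρ
    have i2 := ion_gdot hη hη x ρ
    simp only [fun z => pot_same lp lm (hh z), sub_self, zero_mul, add_zero] at h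
    rwa [integral_add (i1.const_mul 2) i2, integral_const_mul] at h
  · refine le_trans ?_ hD
    rw [Dir_strip hl hu.1 (c.im - l / 2)]
    have hi : IntegrableOn (gdot (clift u) (clift u)) (strip (c.im - l / 2) l) := by
      have := strip_integrable le_rfl le_rfl hu.1 (c.im - l / 2)
      refine this.congr_fun (fun z _ => ?_) (strip_open _ _).measurableSet
      unfold dens pot; simp
    exact setIntegral_mono_set hi (Filter.Eventually.of_forall fun z => gdot_self_nonneg _ _)
      (ball_strip hRl hRc).eventuallyLE

/-- Degenerate Lipschitz estimate: there is `C = C(l, λ₊, λ₋) > 0` such that every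
minimizer of `J(C_1, λ₊, λ₋)` with Dirichlet energy at most `1` satisfies
`|Du| ≤ C/r` almost everywhere on the annulus `C_{1/2} ∖ C_r`, for every
`r ∈ (0, 1/2)`. -/
theorem lipschitz_estimate_away_from_vertex (l lp lm : ℝ) (hl : 0 < l)
    (hlp : 0 ≤ lp) (hlm : 0 ≤ lm) :
    ∃ C > (0:ℝ), ∀ u : ℝ → ℝ → ℝ, IsMinimizerJ l lp lm 1 u → Dir l u 1 ≤ 1 →
      ∀ r ∈ Set.Ioo (0:ℝ) (1/2),
        ∀ᵐ p : ℝ × ℝ, p ∈ Set.Ioc r (1/2) ×ˢ Set.Ioo (0:ℝ) l →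
          Real.sqrt (gradSq u p) ≤ C / r := by
  have hlog : 0 < Real.log 2 := Real.log_pos (by norm_num)
  set R := min (l / 2) (Real.log 2) / 2 with hRdef
  have hmin : 0 < min (l / 2) (Real.log 2) := lt_min (by linarith) hlog
  have hR : 0 < R := by positivity
  have hRl : R < l / 2 := by have := min_le_left (l / 2) (Real.log 2); linarith
  have hR2 : R < Real.log 2 := by have := min_le_right (l / 2) (Real.log 2); linarith
  set A := locC R (lp + lm) with hA
  have hA0 : 0 < A := by
    rw [hA]; unfold locC
    have := Real.pi_pos
    have : 0 ≤ (lp + lm) := by linarith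
    positivity
  refine ⟨3 * A, by positivity, fun u hu hD r hr => Filter.Eventually.of_forall fun p hp => ?_⟩
  obtain ⟨s, θ⟩ := p
  have hs1 : r < s := hp.1.1
  have hs2 : s ≤ 1 / 2 := hp.1.2
  have hs0 : 0 < s := hr.1.trans hs1
  have hls : Real.log s ≤ - Real.log 2 := by
    rw [← Real.log_inv]; exact Real.log_le_log hs0 (by linarith)
  obtain ⟨K, hM⟩ := mk_locmin (c := ⟨Real.log s, θ⟩) hl hlp hlm hRl (by simp only; linarith) hu hD
  have hev := hM.main hR
  have g1 : ‖deriv (fun s => u s θ) s‖ ≤ A * (2 / s) := by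
    refine norm_deriv_le_of_lip' (by positivity) ?_
    have hcont : ContinuousAt (fun x : ℝ => (⟨Real.log x, θ⟩ : ℂ)) s := by
      have : (fun x : ℝ => (⟨Real.log x, θ⟩ : ℂ)) =
          fun x : ℝ => ((Real.log x : ℝ) : ℂ) + θ * Complex.I := by
        ext1 x; apply Complex.ext <;> simp
      rw [this]
      exact (Complex.continuous_ofReal.continuousAt.comp (Real.continuousAt_log hs0.ne')).add
        continuousAt_const
    filter_upwards [hcont.eventually hev, Ioo_mem_nhds (show s / 2 < s by linarith)
      (show s < 1 by linarith)] with x hx hx2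
    rw [clift_log (by linarith [hx2.1]) hx2.2, clift_log hs0 (by linarith)] at hx
    have e : (⟨Real.log x, θ⟩ : ℂ) - ⟨Real.log s, θ⟩ = ((Real.log x - Real.log s : ℝ) : ℂ) := by
      apply Complex.ext <;> simp
    rw [e, Complex.norm_real, Real.norm_eq_abs] at hx
    rw [Real.norm_eq_abs, Real.norm_eq_abs]
    refine hx.trans ?_
    rw [mul_assoc]
    refine mul_le_mul_of_nonneg_left ?_ hA0.le
    have := log_lip (show 0 < s / 2 by linarith) hx2.1.le (show s / 2 ≤ s by linarith)
    rwa [inv_div] at this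
  have g2 : ‖deriv (fun φ => u s φ) θ‖ ≤ A := by
    refine norm_deriv_le_of_lip' hA0.le ?_
    have hcont : ContinuousAt (fun x : ℝ => (⟨Real.log s, x⟩ : ℂ)) θ := by
      have : (fun x : ℝ => (⟨Real.log s, x⟩ : ℂ)) =
          fun x : ℝ => ((Real.log s : ℝ) : ℂ) + x * Complex.I := by
        ext1 x; apply Complex.ext <;> simp
      rw [this]
      fun_prop
    filter_upwards [hcont.eventually hev] with x hx
    rw [clift_log hs0 (by linarith), clift_log hs0 (by linarith)] at hx
    have e : (⟨Real.log s, x⟩ : ℂ) - ⟨Real.log s, θ⟩ = ((x - θ : ℝ) : ℂ) * Complex.I := by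
      apply Complex.ext <;> simp
    rw [e, norm_mul, Complex.norm_I, mul_one, Complex.norm_real] at hx
    exact hx
  rw [Real.norm_eq_abs] at g1 g2
  have q1 := sq_le_sq' (by linarith [abs_nonneg (deriv (fun s => u s θ) s)]) g1
  have q2 := sq_le_sq' (by linarith [abs_nonneg (deriv (fun φ => u s φ) θ)]) g2
  rw [sq_abs] at q1 q2
  have hle : Real.sqrt (gradSq u (s, θ)) ≤ 3 * A / s := by
    apply Real.sqrt_le_iff.2 ⟨by positivity, ?_⟩
    unfold gradSq
    simp only
    have q3 := div_le_div_of_nonneg_right q2 (sq_nonneg s)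
    have e : (3 * A / s) ^ 2 = (A * (2 / s)) ^ 2 + 5 * (A ^ 2 / s ^ 2) := by field_simp; ring
    have : 0 ≤ A ^ 2 / s ^ 2 := by positivity
    linarith
  refine hle.trans ?_
  exact div_le_div_of_nonneg_left (by positivity) hr.1 hs1.le
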